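/- Suppose Y ⊆ V is a G-stable algebraic subset such that (1) Y_apr is Zariski dense in Y, and (2) π(Y) ⊆ V//G is the zero set of invariants f_1, …, f_k and every stratum of V which intersects Y and is not almost principal has codimension at least k+1 in V. Then Y is G-saturated. -/

import Mathlib

/-!
Common framework: a "compact Lie group / complex reductive group acting on a
finite-dimensional module" is modelled as a subgroup of invertible `n × n`
matrices over `𝕜 = ℝ` or `ℂ` acting on `Fin n → 𝕜` by `Matrix.mulVec`.
Polynomial functions on the module are `MvPolynomial (Fin n) 𝕜`.
-/

set_option synthInstance.maxHeartbeats 1000000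
set_option maxHeartbeats 1000000

noncomputable section

open MvPolynomial

namespace ZPaper

variable (𝕜 : Type) [RCLike 𝕜] (n : ℕ)

/-- The zero set of a family of polynomials. -/
def zeroSet (S : Set (MvPolynomial (Fin n) 𝕜)) : Set (Fin n → 𝕜) :=
  {v | ∀ p ∈ S, eval v p = 0}

/-- A subset of `𝕜ⁿ` is algebraic if it is the zero set of a family of polynomials. -/
def IsAlgebraicSet (X : Set (Fin n → 𝕜)) : Prop :=
  ∃ S : Set (MvPolynomial (Fin n) 𝕜), X = zeroSet 𝕜 n S

/-- The vanishing ideal `I(X)` of a subset `X ⊆ 𝕜ⁿ`. -/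
def vanishingIdeal (X : Set (Fin n → 𝕜)) : Ideal (MvPolynomial (Fin n) 𝕜) where
  carrier := {p | ∀ x ∈ X, eval x p = 0}
  zero_mem' := by intro x _; simp
  add_mem' := by intro a b ha hb x hx; simp [ha x hx, hb x hx]
  smul_mem' := by intro c p hp x hx; simp [smul_eq_mul, hp x hx]

/-- The Zariski closure of a subset of `𝕜ⁿ`. -/
def zclosure (A : Set (Fin n → 𝕜)) : Set (Fin n → 𝕜) :=
  zeroSet 𝕜 n (vanishingIdeal 𝕜 n A : Set (MvPolynomial (Fin n) 𝕜))

/-- `A` is Zariski dense in `X`: every polynomial vanishing on `A` vanishes on `X`. -/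
def ZDenseIn (A X : Set (Fin n → 𝕜)) : Prop :=
  ∀ p : MvPolynomial (Fin n) 𝕜, (∀ a ∈ A, eval a p = 0) → ∀ x ∈ X, eval x p = 0

/-- A set of matrices is a subgroup of `GL_n(𝕜)`. -/
def IsMatSubgroup (G : Set (Matrix (Fin n) (Fin n) 𝕜)) : Prop :=
  (1 : Matrix (Fin n) (Fin n) 𝕜) ∈ G ∧ (∀ a ∈ G, ∀ b ∈ G, a * b ∈ G) ∧
    ∀ a ∈ G, IsUnit a ∧ a⁻¹ ∈ G

/-- `X` is a `G`-stable subset of `𝕜ⁿ`. -/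
def Stabilizes (G : Set (Matrix (Fin n) (Fin n) 𝕜)) (X : Set (Fin n → 𝕜)) : Prop :=
  ∀ g ∈ G, ∀ x ∈ X, Matrix.mulVec g x ∈ X

/-- A polynomial is `G`-invariant. -/
def Invariant (G : Set (Matrix (Fin n) (Fin n) 𝕜)) (p : MvPolynomial (Fin n) 𝕜) : Prop :=
  ∀ g ∈ G, ∀ v : Fin n → 𝕜, eval (Matrix.mulVec g v) p = eval v p

/-- `I_G(X)`: the ideal generated by the `G`-invariant polynomials vanishing on `X`,
i.e. by `I(X)^G = I(X) ∩ 𝕜[V]^G`. -/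
def invariantIdeal (G : Set (Matrix (Fin n) (Fin n) 𝕜)) (X : Set (Fin n → 𝕜)) :
    Ideal (MvPolynomial (Fin n) 𝕜) :=
  Ideal.span {p | Invariant 𝕜 n G p ∧ ∀ x ∈ X, eval x p = 0}

/-- `X` is `G`-reduced: `I_G(X) = I(X)`. -/
def IsGReduced (G : Set (Matrix (Fin n) (Fin n) 𝕜)) (X : Set (Fin n → 𝕜)) : Prop :=
  invariantIdeal 𝕜 n G X = vanishingIdeal 𝕜 n X

/-- `X` is almost `G`-reduced: `√I_G(X) = I(X)`. -/
def IsAlmostGReduced (G : Set (Matrix (Fin n) (Fin n) 𝕜)) (X : Set (Fin n → 𝕜)) : Prop :=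
  (invariantIdeal 𝕜 n G X).radical = vanishingIdeal 𝕜 n X

/-- The orbit `G·v`. -/
def orbit (G : Set (Matrix (Fin n) (Fin n) 𝕜)) (v : Fin n → 𝕜) : Set (Fin n → 𝕜) :=
  (fun g => Matrix.mulVec g v) '' G

/-- The isotropy group `G_v`. -/
def isotropy (G : Set (Matrix (Fin n) (Fin n) 𝕜)) (v : Fin n → 𝕜) :
    Set (Matrix (Fin n) (Fin n) 𝕜) :=
  {g ∈ G | Matrix.mulVec g v = v}

/-- Matrix exponential. -/
def mexp (A : Matrix (Fin n) (Fin n) 𝕜) : Matrix (Fin n) (Fin n) 𝕜 :=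
  ∑' k : ℕ, ((k.factorial : 𝕜)⁻¹) • A ^ k

/-- The Lie algebra of a matrix group: matrices whose one-parameter subgroup lies in `G`. -/
def lieAlgebra (G : Set (Matrix (Fin n) (Fin n) 𝕜)) : Set (Matrix (Fin n) (Fin n) 𝕜) :=
  {A | ∀ t : 𝕜, mexp 𝕜 n (t • A) ∈ G}

/-- The tangent space `T_v(G·v)` to the orbit, i.e. `𝔤·v`. -/
def orbitTangent (G : Set (Matrix (Fin n) (Fin n) 𝕜)) (v : Fin n → 𝕜) :
    Submodule 𝕜 (Fin n → 𝕜) :=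
  Submodule.span 𝕜 ((fun A => Matrix.mulVec A v) '' lieAlgebra 𝕜 n G)

/-- `N` is a `G_v`-stable complement to `T_v(G·v)` in `𝕜ⁿ` (a slice at `v`). -/
def IsSliceComplement (G : Set (Matrix (Fin n) (Fin n) 𝕜)) (v : Fin n → 𝕜)
    (N : Submodule 𝕜 (Fin n → 𝕜)) : Prop :=
  IsCompl (orbitTangent 𝕜 n G v) N ∧
    ∀ g ∈ isotropy 𝕜 n G v, ∀ x ∈ N, Matrix.mulVec g x ∈ N

/-- The image of `H` in `GL(N)` is trivial. -/
def ActsTriviallyOn (H : Set (Matrix (Fin n) (Fin n) 𝕜))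
    (N : Submodule 𝕜 (Fin n → 𝕜)) : Prop :=
  ∀ g ∈ H, ∀ x ∈ N, Matrix.mulVec g x = x

/-- The image of `H` in `GL(N)` is finite. -/
def HasFiniteImageOn (H : Set (Matrix (Fin n) (Fin n) 𝕜))
    (N : Submodule 𝕜 (Fin n → 𝕜)) : Prop :=
  Set.Finite ((fun g => fun x : N => Matrix.mulVec g (x : Fin n → 𝕜)) '' H)

/-- The orbit `G·v` is (Zariski) closed. -/
def HasClosedOrbit (G : Set (Matrix (Fin n) (Fin n) 𝕜)) (v : Fin n → 𝕜) : Prop :=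
  zclosure 𝕜 n (orbit 𝕜 n G v) ⊆ orbit 𝕜 n G v

/-- `v` lies on a principal orbit: `G·v` is closed and the isotropy group acts trivially on
some (hence any) slice at `v`. -/
def IsPrincipalPt (G : Set (Matrix (Fin n) (Fin n) 𝕜)) (v : Fin n → 𝕜) : Prop :=
  HasClosedOrbit 𝕜 n G v ∧
    ∃ N, IsSliceComplement 𝕜 n G v N ∧ ActsTriviallyOn 𝕜 n (isotropy 𝕜 n G v) N

/-- `v` lies on an almost principal orbit. -/
def IsAlmostPrincipalPt (G : Set (Matrix (Fin n) (Fin n) 𝕜)) (v : Fin n → 𝕜) : Prop :=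
  HasClosedOrbit 𝕜 n G v ∧
    ∃ N, IsSliceComplement 𝕜 n G v N ∧ HasFiniteImageOn 𝕜 n (isotropy 𝕜 n G v) N

/-- The set of principal points `V_pr`. -/
def prPoints (G : Set (Matrix (Fin n) (Fin n) 𝕜)) : Set (Fin n → 𝕜) :=
  {v | IsPrincipalPt 𝕜 n G v}

/-- The set of almost principal points `V_apr`. -/
def aprPoints (G : Set (Matrix (Fin n) (Fin n) 𝕜)) : Set (Fin n → 𝕜) :=
  {v | IsAlmostPrincipalPt 𝕜 n G v}

/-- `π⁻¹(π(Y))`: all points that the invariants cannot separate from `Y`. -/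
def saturation (G : Set (Matrix (Fin n) (Fin n) 𝕜)) (Y : Set (Fin n → 𝕜)) :
    Set (Fin n → 𝕜) :=
  {v | ∃ y ∈ Y, ∀ p, Invariant 𝕜 n G p → eval v p = eval y p}

/-- `Y` is `G`-saturated: `Y = π⁻¹(π(Y))`. -/
def IsSaturated (G : Set (Matrix (Fin n) (Fin n) 𝕜)) (Y : Set (Fin n → 𝕜)) : Prop :=
  Y = saturation 𝕜 n G Y

/-- The fiber `π⁻¹(π(v))` of the quotient morphism. -/
def piFiber (G : Set (Matrix (Fin n) (Fin n) 𝕜)) (v : Fin n → 𝕜) : Set (Fin n → 𝕜) :=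
  {u | ∀ p, Invariant 𝕜 n G p → eval u p = eval v p}

/-- The invariant ring `𝕜[V]^G` as a subalgebra of `𝕜[V]`. -/
def invariantSubalgebra (G : Set (Matrix (Fin n) (Fin n) 𝕜)) :
    Subalgebra 𝕜 (MvPolynomial (Fin n) 𝕜) where
  carrier := {p | Invariant 𝕜 n G p}
  mul_mem' := by intro a b ha hb g hg v; simp [ha g hg v, hb g hg v]
  one_mem' := by intro g hg v; simp
  add_mem' := by intro a b ha hb g hg v; simp [ha g hg v, hb g hg v]
  zero_mem' := by intro g hg v; simp
  algebraMap_mem' := by intro r g hg v; simp [MvPolynomial.algebraMap_eq]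

/-- The representation is cofree: `𝕜[V]` is a free module over `𝕜[V]^G`. -/
def IsCofree (G : Set (Matrix (Fin n) (Fin n) 𝕜)) : Prop :=
  Module.Free ↥(invariantSubalgebra 𝕜 n G) (MvPolynomial (Fin n) 𝕜)

/-- The vanishing ideal of `π(Y)` in `𝕜[V//G] = 𝕜[V]^G`. -/
def quotVanishingIdeal (G : Set (Matrix (Fin n) (Fin n) 𝕜)) (Y : Set (Fin n → 𝕜)) :
    Ideal ↥(invariantSubalgebra 𝕜 n G) where
  carrier := {p | ∀ y ∈ Y, eval y (p : MvPolynomial (Fin n) 𝕜) = 0}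
  zero_mem' := by intro y hy; simp
  add_mem' := by intro a b ha hb y hy; simp [ha y hy, hb y hy]
  smul_mem' := by intro c p hp y hy; simp [smul_eq_mul, hp y hy]

/-- The module is stable: there is a nonempty Zariski-open set of points with closed orbit. -/
def IsStableModule (G : Set (Matrix (Fin n) (Fin n) 𝕜)) : Prop :=
  ∃ U : Set (Fin n → 𝕜), U.Nonempty ∧ IsAlgebraicSet 𝕜 n Uᶜ ∧
    ∀ v ∈ U, HasClosedOrbit 𝕜 n G v

/-- `G` is Zariski closed in `GL_n(𝕜)`. -/
def IsZClosedInGL (G : Set (Matrix (Fin n) (Fin n) 𝕜)) : Prop :=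
  ∃ P : Set (MvPolynomial (Fin n × Fin n) 𝕜),
    G = {g | IsUnit g ∧ ∀ p ∈ P, eval (fun ij => g ij.1 ij.2) p = 0}

/-- `G` is a (linearly) reductive algebraic group: a Zariski closed subgroup of `GL_n`
containing a Zariski-dense compact subgroup (the unitarian trick characterization). -/
def IsReductiveGroup (G : Set (Matrix (Fin n) (Fin n) 𝕜)) : Prop :=
  IsMatSubgroup 𝕜 n G ∧ IsZClosedInGL 𝕜 n G ∧
    ∃ K : Set (Matrix (Fin n) (Fin n) 𝕜), K ⊆ G ∧ IsCompact K ∧ IsMatSubgroup 𝕜 n K ∧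
      ∀ p : MvPolynomial (Fin n × Fin n) 𝕜,
        (∀ k ∈ K, eval (fun ij => k ij.1 ij.2) p = 0) →
          ∀ g ∈ G, eval (fun ij => g ij.1 ij.2) p = 0

/-- The isotropy groups of `v` and `w` are conjugate in `G`. -/
def ConjIsotropy (G : Set (Matrix (Fin n) (Fin n) 𝕜)) (v w : Fin n → 𝕜) : Prop :=
  ∃ g ∈ G, isotropy 𝕜 n G w = (fun h => g * h * g⁻¹) '' isotropy 𝕜 n G v

/-- The (Luna) stratum of `V` determined by a point `v` with closed orbit: the inverse image
under `π` of the set of closed orbits with isotropy group conjugate to `G_v`. -/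
def stratumOf (G : Set (Matrix (Fin n) (Fin n) 𝕜)) (v : Fin n → 𝕜) : Set (Fin n → 𝕜) :=
  {u | ∃ w, HasClosedOrbit 𝕜 n G w ∧ w ∈ zclosure 𝕜 n (orbit 𝕜 n G u) ∧
    ConjIsotropy 𝕜 n G v w}

/-- Dimension of (the Zariski closure of) a subset of `𝕜ⁿ`, as the Krull dimension of its
coordinate ring. -/
def adim (X : Set (Fin n → 𝕜)) : WithBot ℕ∞ :=
  ringKrullDim (MvPolynomial (Fin n) 𝕜 ⧸ vanishingIdeal 𝕜 n X)

/-- A nonempty algebraic set with prime vanishing ideal, i.e. an irreducible algebraic set. -/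
def IsIrredAlg (Z : Set (Fin n → 𝕜)) : Prop :=
  IsAlgebraicSet 𝕜 n Z ∧ Z.Nonempty ∧ (vanishingIdeal 𝕜 n Z).IsPrime

/-- `Z` is an irreducible component of `Y`. -/
def IsIrredComponentOf (Y Z : Set (Fin n → 𝕜)) : Prop :=
  IsIrredAlg 𝕜 n Z ∧ Z ⊆ Y ∧
    ∀ Z', IsIrredAlg 𝕜 n Z' → Z ⊆ Z' → Z' ⊆ Y → Z' = Z

/-- The rank at `v` of the differential of `f = (f_1, …, f_d) : V → 𝕜^d`. -/
def jacRank {d : ℕ} (f : Fin d → MvPolynomial (Fin n) 𝕜) (v : Fin n → 𝕜) : ℕ :=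
  (Matrix.of fun (i : Fin d) (j : Fin n) => eval v (pderiv j (f i))).rank

/-- A polynomial is `H`-invariant as a function on the submodule `N`. -/
def InvariantOn (H : Set (Matrix (Fin n) (Fin n) 𝕜)) (N : Submodule 𝕜 (Fin n → 𝕜))
    (p : MvPolynomial (Fin n) 𝕜) : Prop :=
  ∀ g ∈ H, ∀ x ∈ N, eval (Matrix.mulVec g x) p = eval x p

/-- The null cone of the `H`-module `N`: points of `N` which the `H`-invariant functions on `N`
cannot separate from `0`. -/
def sliceNullCone (H : Set (Matrix (Fin n) (Fin n) 𝕜)) (N : Submodule 𝕜 (Fin n → 𝕜)) :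
    Set (Fin n → 𝕜) :=
  {x | x ∈ N ∧ ∀ p, InvariantOn 𝕜 n H N p → eval x p = eval (0 : Fin n → 𝕜) p}

/-- The `H`-module `N` is coreduced: the vanishing ideal of its null cone in `𝕜[N]` is
generated by `H`-invariant functions.  (Stated in `𝕜[V]`: the vanishing ideal of the null
cone equals the ideal generated by the invariant functions vanishing on it together with the
vanishing ideal of `N`.) -/
def CoreducedOn (H : Set (Matrix (Fin n) (Fin n) 𝕜)) (N : Submodule 𝕜 (Fin n → 𝕜)) : Prop :=
  vanishingIdeal 𝕜 n (sliceNullCone 𝕜 n H N) =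
    Ideal.span ({p | InvariantOn 𝕜 n H N p ∧ ∀ x ∈ sliceNullCone 𝕜 n H N, eval x p = 0} ∪
      {p | ∀ x ∈ (N : Set (Fin n → 𝕜)), eval x p = 0})

/-- Complexification of a real vector. -/
def cVec (w : Fin n → ℝ) : Fin n → ℂ := fun i => (w i : ℂ)

/-- The complexification `G = K_ℂ` of a compact matrix group `K ⊆ GL_n(ℝ)`: the Zariski
closure of `K` in the complex matrices. -/
def complexifiedGroup (K : Set (Matrix (Fin n) (Fin n) ℝ)) :
    Set (Matrix (Fin n) (Fin n) ℂ) :=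
  {g | ∀ p : MvPolynomial (Fin n × Fin n) ℂ,
    (∀ k ∈ K, eval (fun ij => (k ij.1 ij.2 : ℂ)) p = 0) →
      eval (fun ij => g ij.1 ij.2) p = 0}

/-- The complexification `Y = X_ℂ ⊆ ℂⁿ` of `X ⊆ ℝⁿ`: the Zariski closure of `X` in `ℂⁿ`. -/
def complexification (X : Set (Fin n → ℝ)) : Set (Fin n → ℂ) :=
  zclosure ℂ n (cVec n '' X)

section MatPoly
open Matrix

variable {n : ℕ}

/-- Polynomial functions on the space of square matrices. -/
def MatPoly (f : Matrix (Fin n) (Fin n) ℂ → ℂ) : Prop :=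
  ∃ p : MvPolynomial (Fin n × Fin n) ℂ, ∀ g, eval (fun ij => g ij.1 ij.2) p = f g

lemma matPoly_eval (p : MvPolynomial (Fin n × Fin n) ℂ) :
    MatPoly fun g : Matrix (Fin n) (Fin n) ℂ => eval (fun ij => g ij.1 ij.2) p :=
  ⟨p, fun _ => rfl⟩

lemma matPoly_const (c : ℂ) : MatPoly fun _ : Matrix (Fin n) (Fin n) ℂ => c :=
  ⟨C c, fun _ => by simp⟩

lemma matPoly_entry (i j : Fin n) : MatPoly fun g : Matrix (Fin n) (Fin n) ℂ => g i j :=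
  ⟨X (i, j), fun _ => by simp⟩

lemma MatPoly.add {f f' : Matrix (Fin n) (Fin n) ℂ → ℂ} (h : MatPoly f) (h' : MatPoly f') :
    MatPoly fun g => f g + f' g := by
  obtain ⟨p, hp⟩ := h
  obtain ⟨q, hq⟩ := h'
  exact ⟨p + q, fun g => by simp [hp, hq]⟩

lemma MatPoly.mul {f f' : Matrix (Fin n) (Fin n) ℂ → ℂ} (h : MatPoly f) (h' : MatPoly f') :
    MatPoly fun g => f g * f' g := by
  obtain ⟨p, hp⟩ := h
  obtain ⟨q, hq⟩ := h'
  exact ⟨p * q, fun g => by simp [hp, hq]⟩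

lemma MatPoly.sub {f f' : Matrix (Fin n) (Fin n) ℂ → ℂ} (h : MatPoly f) (h' : MatPoly f') :
    MatPoly fun g => f g - f' g := by
  obtain ⟨p, hp⟩ := h
  obtain ⟨q, hq⟩ := h'
  exact ⟨p - q, fun g => by simp [hp, hq]⟩

lemma MatPoly.sum {ι : Type*} {s : Finset ι} {f : ι → Matrix (Fin n) (Fin n) ℂ → ℂ}
    (h : ∀ i, MatPoly (f i)) : MatPoly fun g => ∑ i ∈ s, f i g := by
  choose p hp using h
  exact ⟨∑ i ∈ s, p i, fun g => by simp [hp]⟩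

lemma MatPoly.eval_comp {ι : Type*} {φ : Matrix (Fin n) (Fin n) ℂ → ι → ℂ}
    (h : ∀ i, MatPoly fun g => φ g i) (p : MvPolynomial ι ℂ) : MatPoly fun g => eval (φ g) p := by
  induction p using MvPolynomial.induction_on with
  | C a => simpa only [eval_C] using matPoly_const a
  | add p q hp hq => simpa only [map_add] using hp.add hq
  | mul_X p i hp => simpa only [map_mul, eval_X] using hp.mul (h i)

lemma MatPoly.comp {f : Matrix (Fin n) (Fin n) ℂ → ℂ} (hf : MatPoly f)
    {φ : Matrix (Fin n) (Fin n) ℂ → Matrix (Fin n) (Fin n) ℂ}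
    (h : ∀ i j, MatPoly fun g => φ g i j) : MatPoly fun g => f (φ g) := by
  obtain ⟨p, hp⟩ := hf
  obtain ⟨q, hq⟩ := MatPoly.eval_comp (φ := fun g ij => φ g ij.1 ij.2) (fun ij => h ij.1 ij.2) p
  exact ⟨q, fun g => (hq g).trans (hp (φ g))⟩

lemma matPoly_mul_mul (A B : Matrix (Fin n) (Fin n) ℂ) (i j : Fin n) :
    MatPoly fun g : Matrix (Fin n) (Fin n) ℂ => (A * g * B) i j := by
  simp only [Matrix.mul_apply]
  exact MatPoly.sum fun k => (MatPoly.sum fun l => (matPoly_const _).mul (matPoly_entry _ _)).mul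
    (matPoly_const _)

lemma matPoly_mulVec (v : Fin n → ℂ) (i : Fin n) :
    MatPoly fun g : Matrix (Fin n) (Fin n) ℂ => (g *ᵥ v) i := by
  simp only [Matrix.mulVec, dotProduct]
  exact MatPoly.sum fun k => (matPoly_entry _ _).mul (matPoly_const _)

lemma matPoly_det : MatPoly fun g : Matrix (Fin n) (Fin n) ℂ => g.det := by
  refine ⟨(Matrix.of fun i j => (X (i, j) : MvPolynomial (Fin n × Fin n) ℂ)).det, fun g => ?_⟩
  rw [RingHom.map_det]
  congr 1
  ext i j
  simp

lemma MatPoly.conj {f : Matrix (Fin n) (Fin n) ℂ → ℂ} (hf : MatPoly f) :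
    MatPoly fun g => star (f gᴴ) := by
  obtain ⟨p, hp⟩ := hf
  suffices h : MatPoly fun g : Matrix (Fin n) (Fin n) ℂ =>
      star (eval (fun ij => gᴴ ij.1 ij.2) p) by
    obtain ⟨q, hq⟩ := h
    exact ⟨q, fun g => (hq g).trans (congrArg star (hp gᴴ))⟩
  clear hp
  induction p using MvPolynomial.induction_on with
  | C a => simpa only [eval_C] using matPoly_const (star a)
  | add p q hp hq => simpa only [map_add, star_add] using hp.add hq
  | mul_X p i hp =>
    simpa only [map_mul, eval_X, star_mul', Matrix.conjTranspose_apply, star_star] using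
      hp.mul (matPoly_entry i.2 i.1)

lemma MatPoly.continuous {f : Matrix (Fin n) (Fin n) ℂ → ℂ} (hf : MatPoly f) : Continuous f := by
  obtain ⟨p, hp⟩ := hf
  have : f = fun g : Matrix (Fin n) (Fin n) ℂ => eval (fun ij => g ij.1 ij.2) p :=
    funext fun g => (hp g).symm
  rw [this]
  exact (MvPolynomial.continuous_eval p).comp (by fun_prop)

end MatPoly

section Mean
open Matrix MeasureTheory

variable {n : ℕ}

lemma IsMatSubgroup.inv_mul {G : Set (Matrix (Fin n) (Fin n) ℂ)} (hG : IsMatSubgroup ℂ n G)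
    {g : Matrix (Fin n) (Fin n) ℂ} (hg : g ∈ G) : g⁻¹ * g = 1 :=
  Matrix.nonsing_inv_mul _ ((Matrix.isUnit_iff_isUnit_det _).1 (hG.2.2 g hg).1)

lemma IsMatSubgroup.mul_inv {G : Set (Matrix (Fin n) (Fin n) ℂ)} (hG : IsMatSubgroup ℂ n G)
    {g : Matrix (Fin n) (Fin n) ℂ} (hg : g ∈ G) : g * g⁻¹ = 1 :=
  Matrix.mul_nonsing_inv _ ((Matrix.isUnit_iff_isUnit_det _).1 (hG.2.2 g hg).1)

/-- The group structure on a matrix subgroup given as a set. -/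
abbrev IsMatSubgroup.group {G : Set (Matrix (Fin n) (Fin n) ℂ)} (hG : IsMatSubgroup ℂ n G) :
    Group G where
  mul a b := ⟨a.1 * b.1, hG.2.1 _ a.2 _ b.2⟩
  one := ⟨1, hG.1⟩
  inv a := ⟨a.1⁻¹, (hG.2.2 _ a.2).2⟩
  mul_assoc a b c := Subtype.ext (mul_assoc a.1 b.1 c.1)
  one_mul a := Subtype.ext (one_mul a.1)
  mul_one a := Subtype.ext (mul_one a.1)
  inv_mul_cancel a := Subtype.ext (hG.inv_mul a.2)

lemma continuousOn_matrix_inv :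
    ContinuousOn (fun g : Matrix (Fin n) (Fin n) ℂ => g⁻¹) {g | IsUnit g} := by
  have h : ∀ g : Matrix (Fin n) (Fin n) ℂ, g⁻¹ = (g.det)⁻¹ • g.adjugate := fun g => by
    rw [Matrix.inv_def, Ring.inverse_eq_inv']
  simp only [h]
  have h1 : Continuous fun g : Matrix (Fin n) (Fin n) ℂ => g.det := by fun_prop
  have h2 : Continuous fun g : Matrix (Fin n) (Fin n) ℂ => g.adjugate := by fun_prop
  exact (h1.continuousOn.inv₀ fun g hg =>
    ((Matrix.isUnit_iff_isUnit_det _).1 hg).ne_zero).smul h2.continuousOn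

/-- A compact matrix group carries a right-invariant mean. -/
lemma exists_mean {K : Set (Matrix (Fin n) (Fin n) ℂ)} (hK : IsMatSubgroup ℂ n K)
    (hc : IsCompact K) :
    ∃ I : C(Matrix (Fin n) (Fin n) ℂ, ℂ) →ₗ[ℂ] ℂ,
      (∀ f c, (∀ k ∈ K, f k = c) → I f = c) ∧
      (∀ f f', (∃ k₀ ∈ K, ∀ k ∈ K, f (k * k₀) = f' k) → I f = I f') ∧
      (∀ f, (∀ k ∈ K, 0 < (f k).re) → 0 < (I f).re) ∧
      ∀ f f', (∀ k ∈ K, f k = star (f' k)) → I f = star (I f') := by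
  let _ : Group K := hK.group
  have hinv : Continuous fun a : K => a.1⁻¹ :=
    continuousOn_matrix_inv.comp_continuous continuous_subtype_val fun a => (hK.2.2 _ a.2).1
  have : IsTopologicalGroup K :=
    { continuous_mul := Continuous.subtype_mk
        ((continuous_subtype_val.comp continuous_fst).mul
          (continuous_subtype_val.comp continuous_snd)) _
      continuous_inv := Continuous.subtype_mk hinv _ }
  have : CompactSpace K := isCompact_iff_compactSpace.1 hc
  let _ : MeasurableSpace K := borel K
  have : BorelSpace K := ⟨rfl⟩
  let μ : Measure K := Measure.haarMeasure ⊤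
  have : IsProbabilityMeasure μ := ⟨by
    have := Measure.haarMeasure_self (K₀ := (⊤ : TopologicalSpace.PositiveCompacts K))
    simpa using this⟩
  have hcont : ∀ f : C(Matrix (Fin n) (Fin n) ℂ, ℂ), Continuous fun a : K => f a.1⁻¹ :=
    fun f => f.continuous.comp hinv
  have hInt : ∀ f : C(Matrix (Fin n) (Fin n) ℂ, ℂ), Integrable (fun a : K => f a.1⁻¹) μ :=
    fun f => (hcont f).integrable_of_hasCompactSupport (HasCompactSupport.of_compactSpace _)
  refine ⟨{ toFun := fun f => ∫ a : K, f a.1⁻¹ ∂μ, map_add' := ?_, map_smul' := ?_ },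
    ?_, ?_, ?_, ?_⟩
  · intro f f'
    exact integral_add (hInt f) (hInt f')
  · intro c f
    exact integral_const_mul c _
  · intro f c h
    have : (fun a : K => f a.1⁻¹) = fun _ => c := funext fun a => h _ (hK.2.2 _ a.2).2
    simp [this]
  · rintro f f' ⟨k₀, hk₀, h⟩
    have h1 : (fun a : K => f' a.1⁻¹) = fun a : K => (fun b : K => f b.1⁻¹) (⟨k₀, hk₀⟩⁻¹ * a) := by
      funext a
      rw [← h _ (hK.2.2 _ a.2).2]
      congr 1
      have : (((⟨k₀, hk₀⟩ : K)⁻¹ * a)⁻¹ : K) = a⁻¹ * ⟨k₀, hk₀⟩ := by group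
      exact (congrArg Subtype.val this).symm
    change ∫ a : K, f a.1⁻¹ ∂μ = ∫ a : K, f' a.1⁻¹ ∂μ
    rw [h1]
    exact (integral_mul_left_eq_self (μ := μ) (fun b : K => f b.1⁻¹) _).symm
  · intro f h
    change 0 < (∫ a : K, f a.1⁻¹ ∂μ).re
    have h2 : (∫ a : K, f a.1⁻¹ ∂μ).re = ∫ a : K, (f a.1⁻¹).re ∂μ := (integral_re (hInt f)).symm
    rw [h2]
    have hpos : ∀ a : K, 0 < (f a.1⁻¹).re := fun a => h _ (hK.2.2 _ a.2).2
    have hi : Integrable (fun a : K => (f a.1⁻¹).re) μ := (hInt f).re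
    rw [integral_pos_iff_support_of_nonneg (fun a => (hpos a).le) hi]
    have : Function.support (fun a : K => (f a.1⁻¹).re) = Set.univ :=
      Set.eq_univ_of_forall fun a => (hpos a).ne'
    rw [this]
    simp
  · intro f f' h
    change ∫ a : K, f a.1⁻¹ ∂μ = star (∫ a : K, f' a.1⁻¹ ∂μ)
    have : (fun a : K => f a.1⁻¹) = fun a : K => starRingEnd ℂ (f' a.1⁻¹) :=
      funext fun a => h _ (hK.2.2 _ a.2).2
    rw [this, integral_conj]
    rfl

end Mean

section Unitary
open Matrix
open scoped ComplexOrder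

variable {n : ℕ}

lemma exists_diag_of_isHermitian {H : Matrix (Fin n) (Fin n) ℂ} (hH : H.IsHermitian) :
    ∃ (U : Matrix (Fin n) (Fin n) ℂ) (a : Fin n → ℝ), Uᴴ * U = 1 ∧
      H = U * diagonal (fun j => (a j : ℂ)) * Uᴴ := by
  refine ⟨hH.eigenvectorUnitary, hH.eigenvalues, ?_, ?_⟩
  · exact (Matrix.mem_unitaryGroup_iff'.1 hH.eigenvectorUnitary.2)
  · exact hH.spectral_theorem

lemma posDef_diag_pos {U : Matrix (Fin n) (Fin n) ℂ} {a : Fin n → ℝ} (hU : Uᴴ * U = 1)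
    (h : ∀ v : Fin n → ℂ, v ≠ 0 →
      0 < (star v ⬝ᵥ ((U * diagonal (fun j => (a j : ℂ)) * Uᴴ) *ᵥ v)).re) (j : Fin n) :
    0 < a j := by
  have h1 := h (U *ᵥ Pi.single j 1) (fun h0 => by
    have h2 : Uᴴ *ᵥ (U *ᵥ Pi.single j 1) = 0 := by rw [h0, Matrix.mulVec_zero]
    rw [Matrix.mulVec_mulVec, hU, Matrix.one_mulVec] at h2
    simpa using congrFun h2 j)
  have h3 : (U * diagonal (fun j => (a j : ℂ)) * Uᴴ) *ᵥ (U *ᵥ Pi.single j 1) =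
      U *ᵥ (diagonal (fun j => (a j : ℂ)) *ᵥ Pi.single j 1) := by
    rw [← Matrix.mulVec_mulVec, Matrix.mulVec_mulVec _ Uᴴ U, hU, Matrix.one_mulVec,
      ← Matrix.mulVec_mulVec]
  have h4 : star (U *ᵥ Pi.single j (1 : ℂ)) ⬝ᵥ (U *ᵥ (diagonal (fun j => (a j : ℂ)) *ᵥ
      Pi.single j 1)) = a j := by
    rw [Matrix.star_mulVec, ← Matrix.dotProduct_mulVec, Matrix.mulVec_mulVec, hU,
      Matrix.one_mulVec]
    simp [Pi.star_single, ]
  rw [h3, h4] at h1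
  simpa using h1

lemma exists_mul_of_posDef {H : Matrix (Fin n) (Fin n) ℂ} (hH : H.IsHermitian)
    (h : ∀ v : Fin n → ℂ, v ≠ 0 → 0 < (star v ⬝ᵥ (H *ᵥ v)).re) :
    ∃ B : Matrix (Fin n) (Fin n) ℂ, IsUnit B ∧ H = Bᴴ * B := by
  obtain ⟨U, a, hU, rfl⟩ := exists_diag_of_isHermitian hH
  have ha := posDef_diag_pos hU h
  have hU' : U * Uᴴ = 1 := mul_eq_one_comm.1 hU
  refine ⟨diagonal (fun j => ((Real.sqrt (a j) : ℝ) : ℂ)) * Uᴴ, ?_, ?_⟩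
  · refine IsUnit.of_mul_eq_one (U * diagonal (fun j => ((Real.sqrt (a j) : ℝ) : ℂ)⁻¹)) ?_
    rw [Matrix.mul_assoc, ← Matrix.mul_assoc Uᴴ, hU, Matrix.one_mul, diagonal_mul_diagonal]
    rw [← diagonal_one]
    congr 1
    funext j
    exact mul_inv_cancel₀ (by exact_mod_cast (Real.sqrt_pos.2 (ha j)).ne')
  · rw [conjTranspose_mul, conjTranspose_conjTranspose, diagonal_conjTranspose]
    have : diagonal (fun j => (a j : ℂ)) =
        diagonal (star fun j => ((Real.sqrt (a j) : ℝ) : ℂ)) *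
          diagonal (fun j => ((Real.sqrt (a j) : ℝ) : ℂ)) := by
      rw [diagonal_mul_diagonal]
      congr 1
      funext j
      simp only [Pi.star_apply, Complex.star_def, Complex.conj_ofReal]
      exact_mod_cast (Real.mul_self_sqrt (ha j).le).symm
    rw [this]
    simp only [Matrix.mul_assoc]

/-- The unitary trick: a reductive group is conjugate to a group stable under conjugate
transposition. -/
lemma exists_conj_star_stable {G : Set (Matrix (Fin n) (Fin n) ℂ)}
    (hG : IsReductiveGroup ℂ n G) :
    ∃ B : Matrix (Fin n) (Fin n) ℂ, IsUnit B ∧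
      ∀ g ∈ G, ∃ g' ∈ G, (B * g * B⁻¹)ᴴ = B * g' * B⁻¹ := by
  obtain ⟨hsub, ⟨P, hP⟩, K, hKG, hKc, hK, hKd⟩ := hG
  obtain ⟨I, hIc, hIr, hIpos, hIstar⟩ := exists_mean hK hKc
  let E : Fin n → Fin n → C(Matrix (Fin n) (Fin n) ℂ, ℂ) := fun i j =>
    ⟨fun k => (kᴴ * k) i j, by fun_prop⟩
  let H : Matrix (Fin n) (Fin n) ℂ := Matrix.of fun i j => I (E i j)
  have hHh : H.IsHermitian := by
    ext i j
    simp only [conjTranspose_apply, H, of_apply]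
    refine (hIstar _ _ fun k _ => ?_).symm
    change (kᴴ * k) i j = star ((kᴴ * k) j i)
    rw [← conjTranspose_apply, conjTranspose_mul, conjTranspose_conjTranspose]
  have hHpos : ∀ v : Fin n → ℂ, v ≠ 0 → 0 < (star v ⬝ᵥ (H *ᵥ v)).re := by
    intro v hv
    have h1 : star v ⬝ᵥ (H *ᵥ v) = I (∑ i, ∑ j, (star (v i) * v j) • E i j) := by
      simp only [map_sum, map_smul, dotProduct, mulVec, H, of_apply, Finset.mul_sum, smul_eq_mul,
        Pi.star_apply]
      refine Finset.sum_congr rfl fun i _ => Finset.sum_congr rfl fun j _ => ?_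
      ring
    rw [h1]
    refine hIpos _ fun k hk => ?_
    have h2 : (∑ i, ∑ j, (star (v i) * v j) • E i j) k = star (k *ᵥ v) ⬝ᵥ (k *ᵥ v) := by
      rw [star_mulVec, ← dotProduct_mulVec, mulVec_mulVec]
      simp only [ContinuousMap.sum_apply, ContinuousMap.smul_apply, dotProduct, mulVec,
        Finset.mul_sum, smul_eq_mul, Pi.star_apply]
      refine Finset.sum_congr rfl fun i _ => Finset.sum_congr rfl fun j _ => ?_
      change star (v i) * v j * (kᴴ * k) i j = _
      ring
    rw [h2]
    have h3 : k *ᵥ v ≠ 0 := fun h0 => hv (by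
      have : k⁻¹ *ᵥ (k *ᵥ v) = 0 := by rw [h0, mulVec_zero]
      rwa [mulVec_mulVec, hK.inv_mul hk, one_mulVec] at this)
    exact (Complex.pos_iff.1 (dotProduct_star_self_pos_iff.2 h3)).1
  obtain ⟨B, hB, hHB⟩ := exists_mul_of_posDef hHh hHpos
  have hinv : ∀ k ∈ K, kᴴ * H * k = H := by
    intro k₀ hk₀
    ext i j
    have h1 : (k₀ᴴ * H * k₀) i j = I (∑ l, ∑ m, (k₀ᴴ i m * k₀ l j) • E m l) := by
      simp only [map_sum, map_smul, Matrix.mul_apply, H, of_apply, Finset.sum_mul, smul_eq_mul]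
      refine Finset.sum_congr rfl fun l _ => Finset.sum_congr rfl fun m _ => ?_
      ring
    rw [h1]
    refine (hIr (E i j) _ ⟨k₀, hk₀, fun k _ => ?_⟩).symm
    change ((k * k₀)ᴴ * (k * k₀)) i j = _
    have h2 : (k * k₀)ᴴ * (k * k₀) = k₀ᴴ * (kᴴ * k) * k₀ := by
      rw [conjTranspose_mul]
      simp only [Matrix.mul_assoc]
    rw [h2, Matrix.mul_apply]
    simp only [ContinuousMap.sum_apply, ContinuousMap.smul_apply, smul_eq_mul]
    refine Finset.sum_congr rfl fun l _ => ?_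
    rw [Matrix.mul_apply, Finset.sum_mul]
    refine Finset.sum_congr rfl fun m _ => ?_
    change k₀ᴴ i m * (kᴴ * k) m l * k₀ l j = k₀ᴴ i m * k₀ l j * (kᴴ * k) m l
    ring
  have hBdet : IsUnit B.det := (Matrix.isUnit_iff_isUnit_det _).1 hB
  have hHu : IsUnit H := by
    rw [hHB]
    exact IsUnit.mul (by simpa using hB.star) hB
  have hHdet : IsUnit H.det := (Matrix.isUnit_iff_isUnit_det _).1 hHu
  have hmem : ∀ g ∈ G, H⁻¹ * gᴴ * H ∈ G := by
    intro g hg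
    rw [hP]
    have hgu : IsUnit g := (hsub.2.2 g hg).1
    have hHi : IsUnit H⁻¹ := by
      rw [Matrix.isUnit_nonsing_inv_iff]
      exact hHu
    refine ⟨(hHi.mul (by simpa using hgu.star)).mul hHu, fun p hp => ?_⟩
    obtain ⟨q, hq⟩ := ((matPoly_eval p).comp (φ := fun g => H⁻¹ * g * H)
      (fun i j => matPoly_mul_mul H⁻¹ H i j)).conj
    have h0 := hKd q (fun k hk => by
      refine (hq k).trans ?_
      have hk1 : H⁻¹ * kᴴ * H = k⁻¹ := by
        have h1 : kᴴ * H = H * k⁻¹ := by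
          conv_rhs => rw [← hinv k hk]
          rw [Matrix.mul_assoc, hK.mul_inv hk, Matrix.mul_one]
        rw [Matrix.mul_assoc, h1, ← Matrix.mul_assoc, Matrix.nonsing_inv_mul _ hHdet,
          Matrix.one_mul]
      change star (eval (fun ij => (H⁻¹ * kᴴ * H) ij.1 ij.2) p) = 0
      rw [hk1]
      have hk2 : k⁻¹ ∈ G := hKG (hK.2.2 k hk).2
      rw [hP] at hk2
      rw [hk2.2 p hp, star_zero]) g hg
    exact star_eq_zero.1 ((hq g).symm.trans h0)
  refine ⟨B, hB, fun g hg => ⟨_, hmem g hg, ?_⟩⟩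
  rw [hHB, conjTranspose_mul, conjTranspose_mul, conjTranspose_nonsing_inv]
  have hBH : IsUnit Bᴴ.det := by
    rw [det_conjTranspose]
    exact hBdet.star
  rw [Matrix.mul_inv_rev]
  have e1 : B * (B⁻¹ * Bᴴ⁻¹ * gᴴ * (Bᴴ * B)) * B⁻¹ =
      (B * B⁻¹) * (Bᴴ⁻¹ * (gᴴ * (Bᴴ * (B * B⁻¹)))) := by
    simp only [Matrix.mul_assoc]
  rw [e1, Matrix.mul_nonsing_inv _ hBdet, Matrix.one_mul, Matrix.mul_one]

end Unitary

section Separation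
open Matrix

variable {n : ℕ}

lemma exists_eval_eq_zero_of_ne_top {σ : Type} [Finite σ] {I : Ideal (MvPolynomial σ ℂ)}
    (hI : I ≠ ⊤) : ∃ x : σ → ℂ, ∀ p ∈ I, eval x p = 0 := by
  obtain ⟨M, hM, hIM⟩ := Ideal.exists_le_maximal I hI
  obtain ⟨x, rfl⟩ := MvPolynomial.isMaximal_iff_eq_vanishingIdeal_singleton.1 hM
  refine ⟨x, fun p hp => ?_⟩
  have := MvPolynomial.mem_vanishingIdeal_singleton_iff x p |>.1 (hIM hp)
  simpa [MvPolynomial.aeval_eq_eval] using this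

lemma exists_generic_translate (q : MvPolynomial (Fin n) ℂ) :
    ∃ T : MvPolynomial (Fin n) (MvPolynomial (Fin n × Fin n) ℂ),
      ∀ (k : Matrix (Fin n) (Fin n) ℂ) (v : Fin n → ℂ), eval (k *ᵥ v) q =
        eval₂ (eval fun ij : Fin n × Fin n => k ij.1 ij.2) v T := by
  induction q using MvPolynomial.induction_on with
  | C a => exact ⟨C (C a), fun k v => by simp⟩
  | add p q hp hq =>
    obtain ⟨T, hT⟩ := hp
    obtain ⟨T', hT'⟩ := hq
    exact ⟨T + T', fun k v => by rw [map_add, eval₂_add, hT, hT']⟩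
  | mul_X p i hp =>
    obtain ⟨T, hT⟩ := hp
    refine ⟨T * ∑ j, C (X (i, j)) * X j, fun k v => ?_⟩
    rw [map_mul, eval₂_mul, hT, eval_X, eval₂_sum]
    simp [mulVec, dotProduct]

/-- Averaging a polynomial over a compact group. -/
lemma exists_average {G : Set (Matrix (Fin n) (Fin n) ℂ)} (hG : IsReductiveGroup ℂ n G)
    (q : MvPolynomial (Fin n) ℂ) :
    ∃ Q, Invariant ℂ n G Q ∧
      ∀ v c, (∀ g ∈ G, eval (g *ᵥ v) q = c) → eval v Q = c := by
  obtain ⟨hsub, ⟨P, hP⟩, K, hKG, hKc, hK, hKd⟩ := hG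
  obtain ⟨I, hIc, hIr, hIpos, hIstar⟩ := exists_mean hK hKc
  obtain ⟨T, hT⟩ := exists_generic_translate q
  obtain ⟨Q, hQ⟩ : ∃ Q : MvPolynomial (Fin n) ℂ, ∀ v,
      ∃ φ : C(Matrix (Fin n) (Fin n) ℂ, ℂ), (∀ k, φ k = eval (k *ᵥ v) q) ∧ eval v Q = I φ := by
    obtain ⟨cf, hcf⟩ : ∃ cf : (Fin n →₀ ℕ) → C(Matrix (Fin n) (Fin n) ℂ, ℂ),
        ∀ m k, cf m k = eval (fun ij : Fin n × Fin n => k ij.1 ij.2) (coeff m T) :=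
      ⟨fun m => ⟨_, (matPoly_eval (coeff m T)).continuous⟩, fun m k => rfl⟩
    refine ⟨∑ m ∈ T.support, monomial m (I (cf m)), fun v =>
      ⟨∑ m ∈ T.support, (∏ i, v i ^ m i) • cf m, fun k => ?_, ?_⟩⟩
    · rw [hT, eval₂_eq']
      simp only [ContinuousMap.sum_apply, ContinuousMap.smul_apply, smul_eq_mul, hcf]
      refine Finset.sum_congr rfl fun m _ => ?_
      rw [mul_comm]
    · simp only [map_sum, map_smul, smul_eq_mul, eval_monomial]
      refine Finset.sum_congr rfl fun m _ => ?_
      rw [Finsupp.prod_fintype _ _ (fun i => pow_zero _), mul_comm]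
  refine ⟨Q, ?_, ?_⟩
  · intro g hg v
    have hp := (MatPoly.eval_comp (φ := fun g => g *ᵥ v) (matPoly_mulVec v) Q).sub
      (matPoly_const (eval v Q))
    obtain ⟨r, hr⟩ := hp
    refine sub_eq_zero.1 ((hr g).symm.trans (hKd r (fun k₀ hk₀ => ?_) g hg))
    refine (hr k₀).trans ?_
    obtain ⟨φ, hφ, h1⟩ := hQ (k₀ *ᵥ v)
    obtain ⟨ψ, hψ, h2⟩ := hQ v
    change eval (k₀ *ᵥ v) Q - eval v Q = 0
    rw [h1, h2, sub_eq_zero]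
    refine (hIr _ _ ⟨k₀, hk₀, fun k _ => ?_⟩).symm
    rw [hφ, hψ, mulVec_mulVec]
  · intro v c h
    obtain ⟨φ, hφ, h1⟩ := hQ v
    rw [h1]
    exact hIc _ _ fun k hk => (hφ k).trans (h k (hKG hk))

/-- Disjoint stable algebraic sets are separated by invariants. -/
lemma exists_invariant_separating {G : Set (Matrix (Fin n) (Fin n) ℂ)}
    (hG : IsReductiveGroup ℂ n G) {A C : Set (Fin n → ℂ)} (hA : IsAlgebraicSet ℂ n A)
    (hC : IsAlgebraicSet ℂ n C) (hAs : Stabilizes ℂ n G A) (hCs : Stabilizes ℂ n G C)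
    (hd : ∀ x ∈ A, x ∉ C) :
    ∃ Q, Invariant ℂ n G Q ∧ (∀ x ∈ A, eval x Q = 0) ∧ ∀ x ∈ C, eval x Q = 1 := by
  obtain ⟨S, rfl⟩ := hA
  obtain ⟨T, rfl⟩ := hC
  have htop : Ideal.span S ⊔ Ideal.span T = ⊤ := by
    by_contra hne
    obtain ⟨x, hx⟩ := exists_eval_eq_zero_of_ne_top hne
    exact hd x (fun p hp => hx p (Ideal.mem_sup_left (Ideal.subset_span hp)))
      (fun p hp => hx p (Ideal.mem_sup_right (Ideal.subset_span hp)))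
  have hspan : ∀ (S : Set (MvPolynomial (Fin n) ℂ)) (p), p ∈ Ideal.span S →
      ∀ x ∈ zeroSet ℂ n S, eval x p = 0 := by
    intro S p hp x hx
    have : Ideal.span S ≤ RingHom.ker (eval x) := Ideal.span_le.2 fun q hq => hx q hq
    exact this hp
  obtain ⟨a, ha, b, hb, hab⟩ := Submodule.mem_sup.1 ((Ideal.eq_top_iff_one _).1 htop)
  obtain ⟨Q, hQ, hQ'⟩ := exists_average hG a
  refine ⟨Q, hQ, fun x hx => hQ' x 0 fun g hg => hspan S a ha _ (hAs g hg x hx),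
    fun x hx => hQ' x 1 fun g hg => ?_⟩
  have h1 := congrArg (eval (g *ᵥ x)) hab
  rw [map_add, hspan T b hb _ (hCs g hg x hx), add_zero, map_one] at h1
  exact h1

end Separation

section StarGroups
open Matrix
open scoped ComplexOrder

variable {n : ℕ}

/-- A Zariski closed matrix group stable under conjugate transposition. -/
structure IsStarGroup (G : Set (Matrix (Fin n) (Fin n) ℂ)) : Prop where
  sub : IsMatSubgroup ℂ n G
  zclosed : IsZClosedInGL ℂ n G
  star_mem : ∀ g ∈ G, gᴴ ∈ G

/-- The exponential of the normal matrix with eigenvectors the columns of `U` and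
eigenvalues `a`. -/
def expDiag (U : Matrix (Fin n) (Fin n) ℂ) (a : Fin n → ℂ) : Matrix (Fin n) (Fin n) ℂ :=
  U * diagonal (fun j => Complex.exp (a j)) * Uᴴ

lemma diag_conj_mul {U : Matrix (Fin n) (Fin n) ℂ} (hU : Uᴴ * U = 1) (x y : Fin n → ℂ) :
    (U * diagonal x * Uᴴ) * (U * diagonal y * Uᴴ) = U * diagonal (fun j => x j * y j) * Uᴴ := by
  rw [← diagonal_mul_diagonal]
  calc (U * diagonal x * Uᴴ) * (U * diagonal y * Uᴴ)
      = U * diagonal x * (Uᴴ * U) * diagonal y * Uᴴ := by simp only [Matrix.mul_assoc]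
    _ = _ := by rw [hU, Matrix.mul_one]; simp only [Matrix.mul_assoc]

lemma expDiag_mul {U : Matrix (Fin n) (Fin n) ℂ} (hU : Uᴴ * U = 1) (a b : Fin n → ℂ) :
    expDiag U a * expDiag U b = expDiag U (a + b) := by
  simp only [expDiag, diag_conj_mul hU, Pi.add_apply, Complex.exp_add]

lemma expDiag_zero {U : Matrix (Fin n) (Fin n) ℂ} (hU : Uᴴ * U = 1) : expDiag U 0 = 1 := by
  simp [expDiag, mul_eq_one_comm.1 hU]

lemma expDiag_mul_neg {U : Matrix (Fin n) (Fin n) ℂ} (hU : Uᴴ * U = 1) (a : Fin n → ℂ) :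
    expDiag U a * expDiag U (-a) = 1 := by
  rw [expDiag_mul hU, add_neg_cancel, expDiag_zero hU]

lemma expDiag_neg_mul {U : Matrix (Fin n) (Fin n) ℂ} (hU : Uᴴ * U = 1) (a : Fin n → ℂ) :
    expDiag U (-a) * expDiag U a = 1 := by
  rw [expDiag_mul hU, neg_add_cancel, expDiag_zero hU]

lemma expDiag_inv {U : Matrix (Fin n) (Fin n) ℂ} (hU : Uᴴ * U = 1) (a : Fin n → ℂ) :
    (expDiag U a)⁻¹ = expDiag U (-a) :=
  Matrix.inv_eq_right_inv (expDiag_mul_neg hU a)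

lemma expDiag_isUnit {U : Matrix (Fin n) (Fin n) ℂ} (hU : Uᴴ * U = 1) (a : Fin n → ℂ) :
    IsUnit (expDiag U a) :=
  IsUnit.of_mul_eq_one _ (expDiag_mul_neg hU a)

lemma expDiag_pow {U : Matrix (Fin n) (Fin n) ℂ} (hU : Uᴴ * U = 1) (a : Fin n → ℂ) (m : ℕ) :
    expDiag U a ^ m = expDiag U ((m : ℂ) • a) := by
  induction m with
  | zero => simp [expDiag_zero hU]
  | succ m ih => rw [pow_succ, ih, expDiag_mul hU]; congr 1; push_cast; module

lemma expDiag_conjTranspose (U : Matrix (Fin n) (Fin n) ℂ) (a : Fin n → ℂ) :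
    (expDiag U a)ᴴ = expDiag U (star a) := by
  simp only [expDiag, conjTranspose_mul, conjTranspose_conjTranspose, diagonal_conjTranspose,
    Matrix.mul_assoc]
  congr 3
  funext j
  simp [← Complex.exp_conj]

lemma expDiag_mulVec (U : Matrix (Fin n) (Fin n) ℂ) (a : Fin n → ℂ) (w : Fin n → ℂ) :
    expDiag U a *ᵥ w = U *ᵥ fun j => Complex.exp (a j) * (Uᴴ *ᵥ w) j := by
  rw [expDiag, ← mulVec_mulVec, ← mulVec_mulVec]
  congr 1
  funext j
  rw [mulVec_diagonal]

lemma IsMatSubgroup.pow_mem {G : Set (Matrix (Fin n) (Fin n) ℂ)} (hG : IsMatSubgroup ℂ n G)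
    {g : Matrix (Fin n) (Fin n) ℂ} (hg : g ∈ G) (m : ℕ) : g ^ m ∈ G := by
  induction m with
  | zero => simpa using hG.1
  | succ m ih => rw [pow_succ]; exact hG.2.1 _ ih _ hg

/-- A relation among the integral points of an exponential sum persists at all points. -/
lemma exp_sum_eq_zero {ι : Type*} (s : Finset ι) (a c : ι → ℂ)
    (hinj : ∀ i ∈ s, ∀ j ∈ s, Complex.exp (a i) = Complex.exp (a j) → a i = a j)
    (h : ∀ m : ℕ, ∑ i ∈ s, c i * Complex.exp (m * a i) = 0) (t : ℂ) :
    ∑ i ∈ s, c i * Complex.exp (t * a i) = 0 := by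
  classical
  let r : ℂ → ℂ := fun z =>
    if hz : ∃ i ∈ s, Complex.exp (a i) = z then Complex.exp (t * a hz.choose) else 0
  have hr : ∀ i ∈ s, r (Complex.exp (a i)) = Complex.exp (t * a i) := by
    intro i hi
    have hz : ∃ j ∈ s, Complex.exp (a j) = Complex.exp (a i) := ⟨i, hi, rfl⟩
    simp only [r, dif_pos hz]
    rw [hinj _ hz.choose_spec.1 i hi hz.choose_spec.2]
  let p := Lagrange.interpolate (s.image fun i => Complex.exp (a i)) id r
  have hp : ∀ i ∈ s, p.eval (Complex.exp (a i)) = Complex.exp (t * a i) := by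
    intro i hi
    rw [← hr i hi]
    exact Lagrange.eval_interpolate_at_node (v := id) r (Function.injective_id.injOn)
      (Finset.mem_image_of_mem _ hi)
  calc ∑ i ∈ s, c i * Complex.exp (t * a i)
      = ∑ i ∈ s, ∑ m ∈ p.support, p.coeff m * (c i * Complex.exp (m * a i)) := by
        refine Finset.sum_congr rfl fun i hi => ?_
        rw [← hp i hi, Polynomial.eval_eq_sum, Polynomial.sum_def, Finset.mul_sum]
        refine Finset.sum_congr rfl fun m _ => ?_
        rw [Complex.exp_nat_mul]
        ring
    _ = 0 := by
        rw [Finset.sum_comm]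
        refine Finset.sum_eq_zero fun m _ => ?_
        rw [← Finset.mul_sum, h, mul_zero]

lemma exists_diag_poly (p : MvPolynomial (Fin n × Fin n) ℂ) :
    ∃ d : ℕ, ∀ A B : Matrix (Fin n) (Fin n) ℂ, ∃ r : MvPolynomial (Fin n) ℂ,
      r.totalDegree ≤ d ∧ ∀ x : Fin n → ℂ,
        eval (fun ij => (A * diagonal x * B) ij.1 ij.2) p = eval x r := by
  induction p using MvPolynomial.induction_on with
  | C a => exact ⟨0, fun A B => ⟨C a, by simp, fun x => by simp⟩⟩
  | add p q hp hq =>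
    obtain ⟨d, hd⟩ := hp
    obtain ⟨e, he⟩ := hq
    refine ⟨max d e, fun A B => ?_⟩
    obtain ⟨r, hr, hr'⟩ := hd A B
    obtain ⟨s, hs, hs'⟩ := he A B
    exact ⟨r + s, (totalDegree_add _ _).trans (max_le_max hr hs), fun x => by
      rw [map_add, map_add, hr', hs']⟩
  | mul_X p i hp =>
    obtain ⟨d, hd⟩ := hp
    refine ⟨d + 1, fun A B => ?_⟩
    obtain ⟨r, hr, hr'⟩ := hd A B
    refine ⟨r * ∑ l, C (A i.1 l * B l i.2) * X l, (totalDegree_mul _ _).trans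
      (add_le_add hr ?_), fun x => ?_⟩
    · refine totalDegree_finsetSum_le fun l _ => ?_
      refine (totalDegree_mul _ _).trans ?_
      rw [totalDegree_C, totalDegree_X]
    · rw [map_mul, map_mul, hr', eval_X]
      congr 1
      rw [Matrix.mul_apply]
      simp only [mul_diagonal, map_sum, map_mul, eval_C, eval_X]
      exact Finset.sum_congr rfl fun l _ => by ring

lemma IsZClosedInGL.exists_finset {G : Set (Matrix (Fin n) (Fin n) ℂ)}
    (hG : IsZClosedInGL ℂ n G) :
    ∃ P : Finset (MvPolynomial (Fin n × Fin n) ℂ),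
      G = {g | IsUnit g ∧ ∀ p ∈ P, eval (fun ij => g ij.1 ij.2) p = 0} := by
  obtain ⟨P, hP⟩ := hG
  obtain ⟨F, hF⟩ : (Ideal.span P).FG := IsNoetherian.noetherian _
  refine ⟨F, ?_⟩
  rw [hP]
  ext g
  have key : ∀ S : Set (MvPolynomial (Fin n × Fin n) ℂ),
      (∀ p ∈ S, eval (fun ij => g ij.1 ij.2) p = 0) ↔
        Ideal.span S ≤ RingHom.ker (eval fun ij : Fin n × Fin n => g ij.1 ij.2) :=
    fun S => ⟨fun h => Ideal.span_le.2 fun p hp => h p hp,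
      fun h p hp => h (Ideal.subset_span hp)⟩
  refine and_congr_right fun _ => ?_
  rw [key, ← hF]
  exact (key F).symm

/-- One-parameter subgroups through an element of a Zariski closed group. -/
lemma exists_degree_expDiag_smul_mem {G : Set (Matrix (Fin n) (Fin n) ℂ)}
    (hG : IsMatSubgroup ℂ n G) (hGc : IsZClosedInGL ℂ n G) :
    ∃ d : ℕ, ∀ (U : Matrix (Fin n) (Fin n) ℂ) (a : Fin n → ℂ), Uᴴ * U = 1 → expDiag U a ∈ G →
      (∀ α β : Fin n →₀ ℕ, (α.sum fun _ e => e) ≤ d → (β.sum fun _ e => e) ≤ d →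
        Complex.exp (∑ j, α j * a j) = Complex.exp (∑ j, β j * a j) →
          ∑ j, α j * a j = ∑ j, β j * a j) →
      ∀ t : ℂ, expDiag U (t • a) ∈ G := by
  obtain ⟨P, hP⟩ := hGc.exists_finset
  choose d hd using fun p => exists_diag_poly (n := n) p
  refine ⟨P.sup d, fun U a hU hmem hinj t => ?_⟩
  rw [hP]
  refine ⟨expDiag_isUnit hU _, fun p hp => ?_⟩
  obtain ⟨r, hr, hr'⟩ := hd p U Uᴴ
  have hrd : ∀ α ∈ r.support, (α.sum fun _ e => e) ≤ P.sup d := fun α hα =>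
    ((le_totalDegree hα).trans hr).trans (Finset.le_sup hp)
  have hev : ∀ t : ℂ, eval (fun ij => (expDiag U (t • a)) ij.1 ij.2) p =
      ∑ α ∈ r.support, coeff α r * Complex.exp (t * ∑ j, α j * a j) := by
    intro t
    rw [expDiag, hr', eval_eq']
    refine Finset.sum_congr rfl fun α _ => ?_
    congr 1
    rw [Finset.mul_sum, Complex.exp_sum]
    refine Finset.prod_congr rfl fun j _ => ?_
    rw [← Complex.exp_nat_mul]
    congr 1
    simp only [Pi.smul_apply, smul_eq_mul]
    ring
  rw [hev]
  refine exp_sum_eq_zero _ _ _ (fun α hα β hβ => hinj α β (hrd α hα) (hrd β hβ)) (fun m => ?_) t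
  rw [← hev, ← expDiag_pow hU]
  have := hG.pow_mem hmem m
  rw [hP] at this
  exact this.2 p hp

lemma expDiag_ofReal_smul_mem {G : Set (Matrix (Fin n) (Fin n) ℂ)}
    (hG : IsMatSubgroup ℂ n G) (hGc : IsZClosedInGL ℂ n G) {U : Matrix (Fin n) (Fin n) ℂ}
    (hU : Uᴴ * U = 1) {s : Fin n → ℝ} (h : expDiag U (fun j => (s j : ℂ)) ∈ G) (t : ℂ) :
    expDiag U (t • fun j => (s j : ℂ)) ∈ G := by
  obtain ⟨d, hd⟩ := exists_degree_expDiag_smul_mem hG hGc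
  refine hd U _ hU h (fun α β _ _ he => ?_) t
  have h1 : ∀ α : Fin n →₀ ℕ, ∑ j, (α j : ℂ) * (s j : ℂ) = ((∑ j, α j * s j : ℝ) : ℂ) := by
    intro α
    push_cast
    rfl
  rw [h1, h1, ← Complex.ofReal_exp, ← Complex.ofReal_exp, Complex.ofReal_inj] at he
  rw [h1, h1, Real.exp_injective he]

lemma isUnit_of_conjTranspose_mul_self_eq_one {k : Matrix (Fin n) (Fin n) ℂ} (hk : kᴴ * k = 1) :
    IsUnit k :=
  IsUnit.of_mul_eq_one _ (mul_eq_one_comm.1 hk)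

/-- Polar decomposition in a group stable under conjugate transposition. -/
lemma IsStarGroup.polar {G : Set (Matrix (Fin n) (Fin n) ℂ)} (hG : IsStarGroup G)
    {g : Matrix (Fin n) (Fin n) ℂ} (hg : g ∈ G) :
    ∃ (k U : Matrix (Fin n) (Fin n) ℂ) (s : Fin n → ℝ), k ∈ G ∧ kᴴ * k = 1 ∧ Uᴴ * U = 1 ∧
      (∀ t : ℂ, expDiag U (t • fun j => (s j : ℂ)) ∈ G) ∧ g = k * expDiag U (fun j => (s j : ℂ)) := by
  have hgu : IsUnit g := (hG.sub.2.2 g hg).1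
  have hH : (gᴴ * g).IsHermitian := isHermitian_conjTranspose_mul_self g
  have hpos : ∀ v : Fin n → ℂ, v ≠ 0 → 0 < (star v ⬝ᵥ ((gᴴ * g) *ᵥ v)).re := by
    intro v hv
    have h3 : g *ᵥ v ≠ 0 := fun h0 => hv (by
      have : g⁻¹ *ᵥ (g *ᵥ v) = 0 := by rw [h0, mulVec_zero]
      rwa [mulVec_mulVec, hG.sub.inv_mul hg, one_mulVec] at this)
    rw [← mulVec_mulVec, dotProduct_mulVec, ← star_mulVec]
    exact (Complex.pos_iff.1 (dotProduct_star_self_pos_iff.2 h3)).1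
  obtain ⟨U, b, hU, hb⟩ := exists_diag_of_isHermitian hH
  rw [hb] at hpos
  have hbpos := posDef_diag_pos hU hpos
  have hb' : gᴴ * g = expDiag U (fun j => ((Real.log (b j) : ℝ) : ℂ)) := by
    rw [hb, expDiag]
    congr 3
    funext j
    rw [← Complex.ofReal_exp, Real.exp_log (hbpos j)]
  have hmem : expDiag U (fun j => ((Real.log (b j) : ℝ) : ℂ)) ∈ G := by
    rw [← hb']
    exact hG.sub.2.1 _ (hG.star_mem g hg) _ hg
  let s : Fin n → ℝ := fun j => Real.log (b j) / 2
  have hs : ∀ t : ℂ, expDiag U (t • fun j => (s j : ℂ)) ∈ G := fun t => by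
    have := expDiag_ofReal_smul_mem hG.sub hG.zclosed hU hmem (t / 2)
    convert this using 2
    funext j
    simp only [s, Pi.smul_apply, smul_eq_mul]
    push_cast
    ring
  have hs1 : expDiag U (-(fun j => (s j : ℂ))) ∈ G := by simpa using hs (-1)
  refine ⟨g * expDiag U (-(fun j => (s j : ℂ))), U, s, hG.sub.2.1 _ hg _ hs1, ?_, hU, hs, ?_⟩
  · rw [conjTranspose_mul, expDiag_conjTranspose]
    have e1 : star (-(fun j => (s j : ℂ))) = -(fun j => (s j : ℂ)) := by
      funext j
      simp
    rw [e1]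
    calc _ = expDiag U (-(fun j => (s j : ℂ))) * (gᴴ * g) * expDiag U (-(fun j => (s j : ℂ))) := by
          simp only [Matrix.mul_assoc]
      _ = 1 := by
          rw [hb', expDiag_mul hU, expDiag_mul hU, ← expDiag_zero hU]
          congr 1
          funext j
          simp only [s, Pi.add_apply, Pi.neg_apply, Pi.zero_apply]
          push_cast
          ring
  · rw [Matrix.mul_assoc, expDiag_neg_mul hU, Matrix.mul_one]

end StarGroups

section MinimalVectors
open Matrix Filter Topology

variable {n : ℕ}

/-- The square of the Hermitian norm. -/
def nsq (v : Fin n → ℂ) : ℝ := ∑ j, Complex.normSq (v j)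

lemma nsq_eq (v : Fin n → ℂ) : ((nsq v : ℝ) : ℂ) = star v ⬝ᵥ v := by
  simp only [nsq, dotProduct, Pi.star_apply, Complex.ofReal_sum, Complex.normSq_eq_conj_mul_self]
  rfl

lemma nsq_nonneg (v : Fin n → ℂ) : 0 ≤ nsq v :=
  Finset.sum_nonneg fun _ _ => Complex.normSq_nonneg _

lemma continuous_nsq : Continuous (nsq : (Fin n → ℂ) → ℝ) :=
  continuous_finsetSum _ fun j _ => Complex.continuous_normSq.comp (continuous_apply j)

lemma norm_sq_le_nsq (v : Fin n → ℂ) (j : Fin n) : ‖v j‖ ^ 2 ≤ nsq v := by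
  rw [← Complex.normSq_eq_norm_sq]
  exact Finset.single_le_sum (f := fun i => Complex.normSq (v i))
    (fun i _ => Complex.normSq_nonneg _) (Finset.mem_univ j)

lemma nsq_mulVec {U : Matrix (Fin n) (Fin n) ℂ} (hU : Uᴴ * U = 1) (v : Fin n → ℂ) :
    nsq (U *ᵥ v) = nsq v := by
  apply Complex.ofReal_injective
  rw [nsq_eq, nsq_eq, star_mulVec, ← dotProduct_mulVec, mulVec_mulVec, hU, one_mulVec]

lemma isCompact_nsq_le (c : ℝ) : IsCompact {v : Fin n → ℂ | nsq v ≤ c} := by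
  refine Metric.isCompact_of_isClosed_isBounded (isClosed_le continuous_nsq continuous_const) ?_
  refine (Metric.isBounded_iff_subset_closedBall 0).2 ⟨Real.sqrt c, fun v hv => ?_⟩
  rw [mem_closedBall_zero_iff, pi_norm_le_iff_of_nonneg (Real.sqrt_nonneg _)]
  exact fun j => Real.le_sqrt_of_sq_le ((norm_sq_le_nsq v j).trans hv)

lemma isClosed_zeroSet (S : Set (MvPolynomial (Fin n) ℂ)) : IsClosed (zeroSet ℂ n S) := by
  have : zeroSet ℂ n S = ⋂ p ∈ S, {v | eval v p = 0} := by
    ext v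
    simp [zeroSet]
  rw [this]
  exact isClosed_biInter fun p _ => isClosed_eq (MvPolynomial.continuous_eval p) continuous_const

lemma subset_zclosure (A : Set (Fin n → ℂ)) : A ⊆ zclosure ℂ n A :=
  fun _ hx _ hp => hp _ hx

lemma HasClosedOrbit.isClosed {G : Set (Matrix (Fin n) (Fin n) ℂ)} {v : Fin n → ℂ}
    (h : HasClosedOrbit ℂ n G v) : IsClosed (orbit ℂ n G v) := by
  rw [Set.Subset.antisymm (subset_zclosure _) h]
  exact isClosed_zeroSet _

/-- A vector of minimal norm in its orbit. -/
def IsMinVec (G : Set (Matrix (Fin n) (Fin n) ℂ)) (w : Fin n → ℂ) : Prop :=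
  ∀ g ∈ G, nsq w ≤ nsq (g *ᵥ w)

lemma exists_isMinVec {G : Set (Matrix (Fin n) (Fin n) ℂ)}
    (hG : IsMatSubgroup ℂ n G) {v : Fin n → ℂ} (h : IsClosed (orbit ℂ n G v)) :
    ∃ g ∈ G, IsMinVec G (g *ᵥ v) := by
  have hv : v ∈ orbit ℂ n G v := ⟨1, hG.1, one_mulVec v⟩
  have hc : IsCompact (orbit ℂ n G v ∩ {u | nsq u ≤ nsq v}) :=
    (isCompact_nsq_le _).inter_left h
  obtain ⟨x, ⟨⟨g, hg, rfl⟩, hx⟩, hmin⟩ := hc.exists_isMinOn ⟨v, hv, (le_refl (nsq v) : _)⟩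
    continuous_nsq.continuousOn
  refine ⟨g, hg, fun a ha => ?_⟩
  by_cases hle : nsq (a *ᵥ (g *ᵥ v)) ≤ nsq v
  · exact hmin ⟨⟨a * g, hG.2.1 a ha g hg, (mulVec_mulVec _ _ _).symm⟩, hle⟩
  · exact le_trans hx (not_le.1 hle).le

lemma IsZClosedInGL.exists_isClosed {G : Set (Matrix (Fin n) (Fin n) ℂ)}
    (hG : IsZClosedInGL ℂ n G) :
    ∃ C : Set (Matrix (Fin n) (Fin n) ℂ), IsClosed C ∧ G = {g | IsUnit g} ∩ C := by
  obtain ⟨P, hP⟩ := hG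
  refine ⟨⋂ p ∈ P, {g | eval (fun ij => g ij.1 ij.2) p = 0}, ?_, ?_⟩
  · exact isClosed_biInter fun p _ => isClosed_eq (matPoly_eval p).continuous continuous_const
  · rw [hP]
    ext g
    simp

lemma IsZClosedInGL.mem_of_tendsto {G : Set (Matrix (Fin n) (Fin n) ℂ)}
    (hG : IsZClosedInGL ℂ n G) {ι : Type*} {l : Filter ι} [l.NeBot]
    {u : ι → Matrix (Fin n) (Fin n) ℂ} {g : Matrix (Fin n) (Fin n) ℂ} (hu : Tendsto u l (𝓝 g))
    (hmem : ∀ i, u i ∈ G) (hg : IsUnit g) : g ∈ G := by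
  obtain ⟨C, hC, rfl⟩ := hG.exists_isClosed
  exact ⟨hg, hC.mem_of_tendsto hu (Eventually.of_forall fun i => (hmem i).2)⟩

lemma nsq_expDiag_ofReal {U : Matrix (Fin n) (Fin n) ℂ} (hU : Uᴴ * U = 1) (s : Fin n → ℝ)
    (w : Fin n → ℂ) :
    nsq (expDiag U (fun j => (s j : ℂ)) *ᵥ w) =
      ∑ j, Real.exp (2 * s j) * Complex.normSq ((Uᴴ *ᵥ w) j) := by
  rw [expDiag_mulVec, nsq_mulVec hU, nsq]
  refine Finset.sum_congr rfl fun j _ => ?_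
  rw [Complex.normSq_mul, ← Complex.ofReal_exp, Complex.normSq_ofReal, ← Real.exp_add]
  ring_nf

lemma nsq_eq_sum {U : Matrix (Fin n) (Fin n) ℂ} (hU : Uᴴ * U = 1) (w : Fin n → ℂ) :
    nsq w = ∑ j, Complex.normSq ((Uᴴ *ᵥ w) j) := by
  rw [← nsq, nsq_mulVec]
  rw [conjTranspose_conjTranspose]
  exact mul_eq_one_comm.1 hU

/-- Convexity of the norm along one-parameter subgroups, at a minimal vector. -/
lemma IsMinVec.eq_zero_of_le {G : Set (Matrix (Fin n) (Fin n) ℂ)} {w : Fin n → ℂ}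
    (hw : IsMinVec G w) {U : Matrix (Fin n) (Fin n) ℂ} (hU : Uᴴ * U = 1) {s : Fin n → ℝ}
    (hs : ∀ t : ℂ, expDiag U (t • fun j => (s j : ℂ)) ∈ G)
    (hle : nsq (expDiag U (fun j => (s j : ℂ)) *ᵥ w) ≤ nsq w) (j : Fin n) :
    s j = 0 ∨ (Uᴴ *ᵥ w) j = 0 := by
  set c : Fin n → ℝ := fun j => Complex.normSq ((Uᴴ *ᵥ w) j) with hc
  have hc0 : ∀ j, 0 ≤ c j := fun j => Complex.normSq_nonneg _
  have hψ : ∀ t : ℝ, ∑ j, c j ≤ ∑ j, Real.exp (2 * (t * s j)) * c j := by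
    intro t
    have h1 := hw _ (hs t)
    have e1 : ((t : ℂ) • fun j => (s j : ℂ)) = fun j => ((t * s j : ℝ) : ℂ) := by
      funext j
      simp
    rw [e1, nsq_expDiag_ofReal hU, nsq_eq_sum hU] at h1
    exact h1
  have hder : HasDerivAt (fun t : ℝ => ∑ j, Real.exp (2 * (t * s j)) * c j)
      (∑ j, 2 * s j * c j) 0 := by
    refine HasDerivAt.fun_sum fun j _ => ?_
    have h1 : HasDerivAt (fun t : ℝ => 2 * (t * s j)) (2 * s j) 0 := by
      simpa using ((hasDerivAt_id (0 : ℝ)).mul_const (s j)).const_mul 2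
    simpa using h1.exp.mul_const (c j)
  have hmin : IsLocalMin (fun t : ℝ => ∑ j, Real.exp (2 * (t * s j)) * c j) 0 :=
    Eventually.of_forall fun t => by simpa using hψ t
  have h0 : ∑ j, 2 * s j * c j = 0 := hmin.hasDerivAt_eq_zero hder
  rw [nsq_expDiag_ofReal hU, nsq_eq_sum hU] at hle
  have hnn : ∀ i ∈ Finset.univ, 0 ≤ (Real.exp (2 * s i) - (2 * s i + 1)) * c i := fun i _ =>
    mul_nonneg (sub_nonneg.2 (Real.add_one_le_exp _)) (hc0 i)
  have hsum : ∑ i, (Real.exp (2 * s i) - (2 * s i + 1)) * c i = 0 := by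
    refine le_antisymm ?_ (Finset.sum_nonneg hnn)
    have : ∑ i, (Real.exp (2 * s i) - (2 * s i + 1)) * c i =
        ∑ i, Real.exp (2 * s i) * c i - ∑ i, 2 * s i * c i - ∑ i, c i := by
      rw [← Finset.sum_sub_distrib, ← Finset.sum_sub_distrib]
      exact Finset.sum_congr rfl fun i _ => by ring
    rw [this, h0]
    linarith
  rcases mul_eq_zero.1 ((Finset.sum_eq_zero_iff_of_nonneg hnn).1 hsum j (Finset.mem_univ j)) with
    h | h
  · left
    by_contra hne
    have := Real.add_one_lt_exp (x := 2 * s j) (by simpa using hne)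
    linarith
  · exact Or.inr (Complex.normSq_eq_zero.1 h)

lemma expDiag_smul_mulVec_eq {U : Matrix (Fin n) (Fin n) ℂ} (hU : Uᴴ * U = 1) {a : Fin n → ℂ}
    {w : Fin n → ℂ} (h : ∀ j, a j = 0 ∨ (Uᴴ *ᵥ w) j = 0) (t : ℂ) : expDiag U (t • a) *ᵥ w = w := by
  rw [expDiag_mulVec]
  have : (fun j => Complex.exp ((t • a) j) * (Uᴴ *ᵥ w) j) = Uᴴ *ᵥ w := by
    funext j
    rcases h j with h | h
    · simp [h]
    · simp [h]
  rw [this, mulVec_mulVec, mul_eq_one_comm.1 hU, one_mulVec]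

lemma expDiag_unitary {U : Matrix (Fin n) (Fin n) ℂ} (hU : Uᴴ * U = 1) {a : Fin n → ℂ}
    (ha : ∀ j, star (a j) = -a j) : (expDiag U a)ᴴ * expDiag U a = 1 := by
  rw [expDiag_conjTranspose, expDiag_mul hU, ← expDiag_zero hU]
  congr 1
  funext j
  simp [ha j]

/-- At minimal vectors, inclusions of the unitary parts of isotropy groups extend to the
isotropy groups. -/
lemma IsStarGroup.isotropy_subset {G : Set (Matrix (Fin n) (Fin n) ℂ)} (hG : IsStarGroup G)
    {x y : Fin n → ℂ} (hx' : IsMinVec G x)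
    (h : ∀ k ∈ G, kᴴ * k = 1 → k *ᵥ x = x → k *ᵥ y = y) :
    isotropy ℂ n G x ⊆ isotropy ℂ n G y := by
  rintro g ⟨hg, hgx⟩
  obtain ⟨k, U, s, hk, hk1, hU, hs, rfl⟩ := hG.polar hg
  have h1 : nsq (expDiag U (fun j => (s j : ℂ)) *ᵥ x) ≤ nsq x := by
    rw [← nsq_mulVec hk1, mulVec_mulVec, hgx]
  have h2 := hx'.eq_zero_of_le hU hs h1
  have h3 : ∀ t : ℂ, expDiag U (t • fun j => (s j : ℂ)) *ᵥ x = x :=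
    expDiag_smul_mulVec_eq hU fun j => (h2 j).imp (fun h => by simp [h]) id
  have h4 : ∀ j, (s j : ℂ) = 0 ∨ (Uᴴ *ᵥ y) j = 0 := by
    intro j
    by_cases hsj : s j = 0
    · simp [hsj]
    right
    have h5 := h _ (hs (((Real.pi / s j : ℝ) : ℂ) * Complex.I)) (expDiag_unitary hU fun i => by
      simp) (h3 _)
    have h6 := congrArg (fun v => (Uᴴ *ᵥ v) j) h5
    simp only [expDiag_mulVec, mulVec_mulVec, hU, one_mulVec] at h6
    have h7 : Complex.exp ((((Real.pi / s j : ℝ) : ℂ) * Complex.I) * (s j : ℂ)) = -1 := by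
      rw [← Complex.exp_pi_mul_I]
      congr 1
      push_cast
      have : (s j : ℂ) ≠ 0 := by exact_mod_cast hsj
      field_simp
    simp only [Pi.smul_apply, smul_eq_mul] at h6
    rw [h7] at h6
    have : 2 * (Uᴴ *ᵥ y) j = 0 := by linear_combination -h6
    simpa using this
  have h5 : ∀ t : ℂ, expDiag U (t • fun j => (s j : ℂ)) *ᵥ y = y := expDiag_smul_mulVec_eq hU h4
  have h3' := h3 1
  have h5' := h5 1
  rw [one_smul] at h3' h5'
  refine ⟨hg, ?_⟩
  rw [← mulVec_mulVec, h5']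
  refine h k hk hk1 ?_
  rw [← mulVec_mulVec, h3'] at hgx
  exact hgx

end MinimalVectors

section SmallUnitary
open Matrix Filter Topology

variable {n : ℕ}

lemma exists_expDiag_of_unitary (ε : ℝ) (hε : 0 < ε) :
    ∀ᶠ k in 𝓝 (1 : Matrix (Fin n) (Fin n) ℂ), kᴴ * k = 1 →
      ∃ (U : Matrix (Fin n) (Fin n) ℂ) (θ : Fin n → ℝ), Uᴴ * U = 1 ∧ (∀ j, |θ j| < ε) ∧
        k = expDiag U (fun j => (θ j : ℂ) * Complex.I) := by
  have hopen : IsOpen {g : Matrix (Fin n) (Fin n) ℂ | IsUnit g} := by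
    have : {g : Matrix (Fin n) (Fin n) ℂ | IsUnit g} = {g | g.det ≠ 0} := by
      ext g
      simp [Matrix.isUnit_iff_isUnit_det]
    rw [this]
    have hd : Continuous fun g : Matrix (Fin n) (Fin n) ℂ => g.det := by fun_prop
    exact isOpen_ne_fun hd continuous_const
  have hc1 : Continuous fun k : Matrix (Fin n) (Fin n) ℂ => k + 1 := by fun_prop
  have hu1 : IsUnit ((1 : Matrix (Fin n) (Fin n) ℂ) + 1) := by
    refine IsUnit.of_mul_eq_one ((2 : ℂ)⁻¹ • 1) ?_
    rw [mul_smul_comm, mul_one, smul_add, ← add_smul]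
    norm_num
  have hnear : ∀ᶠ k in 𝓝 (1 : Matrix (Fin n) (Fin n) ℂ), IsUnit (k + 1) :=
    hc1.continuousAt.eventually (hopen.mem_nhds hu1)
  let S : Matrix (Fin n) (Fin n) ℂ → Matrix (Fin n) (Fin n) ℂ := fun k =>
    (-Complex.I) • ((k - 1) * (k + 1)⁻¹)
  have hSc : ContinuousAt S 1 := by
    have h1 : ContinuousAt (fun k : Matrix (Fin n) (Fin n) ℂ => (k + 1)⁻¹) 1 :=
      ContinuousAt.comp (f := fun k : Matrix (Fin n) (Fin n) ℂ => k + 1) (x := 1)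
        (continuousOn_matrix_inv.continuousAt (hopen.mem_nhds hu1)) hc1.continuousAt
    have h2 : ContinuousAt (fun k : Matrix (Fin n) (Fin n) ℂ => k - 1) 1 := by fun_prop
    exact (h2.mul h1).const_smul (-Complex.I)
  have hS0 : S 1 = 0 := by simp [S]
  have hδ : 0 < (ε / 2) ^ 2 := by positivity
  have htr : ∀ᶠ k in 𝓝 (1 : Matrix (Fin n) (Fin n) ℂ), ((S k)ᴴ * S k).trace.re < (ε / 2) ^ 2 := by
    have h1 : Continuous fun A : Matrix (Fin n) (Fin n) ℂ => (Aᴴ * A).trace.re := by fun_prop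
    have h2 := (h1.continuousAt (x := S 1)).comp hSc
    refine h2.eventually (gt_mem_nhds ?_)
    simpa [hS0] using hδ
  filter_upwards [hnear, htr] with k hk hktr hk1
  have hkdet := (Matrix.isUnit_iff_isUnit_det _).1 hk
  have hSk : S k * (k + 1) = (-Complex.I) • (k - 1) := by
    simp only [S]
    rw [smul_mul_assoc, Matrix.mul_assoc, Matrix.nonsing_inv_mul _ hkdet, Matrix.mul_one]
  have hSk' : (kᴴ + 1) * (S k)ᴴ = Complex.I • (kᴴ - 1) := by
    have := congrArg conjTranspose hSk
    simpa [conjTranspose_mul] using this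
  have hherm : (S k).IsHermitian := by
    have hku : IsUnit (kᴴ + 1) := by
      have := hk.star
      simpa [star_eq_conjTranspose] using this
    have h1 : (kᴴ + 1) * (S k)ᴴ * (k + 1) = (kᴴ + 1) * S k * (k + 1) := by
      rw [hSk', Matrix.mul_assoc, hSk]
      simp only [smul_mul_assoc, mul_smul_comm, mul_add, add_mul, mul_sub, sub_mul, hk1, mul_one,
        one_mul]
      module
    exact hku.mul_left_cancel (hk.mul_right_cancel h1)
  obtain ⟨U, b, hU, hb⟩ := exists_diag_of_isHermitian hherm
  have hU' := mul_eq_one_comm.1 hU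
  have hbsmall : ∀ j, |b j| < ε / 2 := by
    intro j
    have h1 : ((S k)ᴴ * S k).trace.re = ∑ j, b j ^ 2 := by
      rw [hherm.eq, hb, diag_conj_mul hU, Matrix.trace_mul_comm, ← Matrix.mul_assoc, hU,
        Matrix.one_mul, Matrix.trace_diagonal]
      simp [pow_two]
    rw [h1] at hktr
    have h2 := Finset.single_le_sum (f := fun i => b i ^ 2) (fun i _ => sq_nonneg _)
      (Finset.mem_univ j)
    exact abs_lt_of_sq_lt_sq (h2.trans_lt hktr) (by positivity)
  refine ⟨U, fun j => 2 * Real.arctan (b j), hU, fun j => ?_, ?_⟩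
  · have hle : ∀ x : ℝ, 0 ≤ x → Real.arctan x ≤ x := fun x hx => by
      have := Real.le_tan (Real.arctan_nonneg.2 hx) (Real.arctan_lt_pi_div_two x)
      rwa [Real.tan_arctan] at this
    have h1 : |Real.arctan (b j)| ≤ |b j| := by
      rcases le_total 0 (b j) with h | h
      · rw [abs_of_nonneg h, abs_of_nonneg (Real.arctan_nonneg.2 h)]
        exact hle _ h
      · rw [abs_of_nonpos h, abs_of_nonpos (Real.arctan_le_zero.2 h), ← Real.arctan_neg]
        exact hle _ (by linarith)
    rw [abs_mul, abs_two]
    linarith [hbsmall j]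
  · have hne : ∀ j, (1 - Complex.I * (b j : ℂ)) ≠ 0 := fun j h0 => by
      have := congrArg Complex.re h0
      simp at this
    have hexp : ∀ j, Complex.exp (((2 * Real.arctan (b j) : ℝ) : ℂ) * Complex.I) *
        (1 - Complex.I * b j) = 1 + Complex.I * b j := by
      intro j
      set φ := Real.arctan (b j)
      have hcos : Real.cos φ ≠ 0 := (Real.cos_arctan_pos _).ne'
      have hbj : b j = Real.sin φ / Real.cos φ := by
        rw [← Real.tan_eq_sin_div_cos, Real.tan_arctan]
      have hcos' : (Real.cos φ : ℂ) ≠ 0 := by exact_mod_cast hcos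
      have e1 : (((2 * φ : ℝ) : ℂ) * Complex.I) = (φ : ℂ) * Complex.I + (φ : ℂ) * Complex.I := by
        push_cast
        ring
      have e2 : Complex.exp ((φ : ℂ) * Complex.I) = Real.cos φ + Real.sin φ * Complex.I := by
        rw [Complex.exp_mul_I]
        push_cast
        rfl
      have e3 : (Real.cos φ : ℂ) ^ 2 + (Real.sin φ : ℂ) ^ 2 = 1 := by
        exact_mod_cast Real.cos_sq_add_sin_sq φ
      rw [e1, Complex.exp_add, e2, hbj]
      push_cast at hcos' e3 ⊢
      field_simp
      have hI : Complex.I ^ 2 = -1 := Complex.I_sq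
      have hI3 : Complex.I ^ 3 = -Complex.I := by rw [pow_succ, Complex.I_sq]; ring
      ring_nf
      rw [hI3, hI]
      linear_combination (Complex.cos φ + Complex.I * Complex.sin φ) * e3
    have h1 : (1 - Complex.I • S k) * k = 1 + Complex.I • S k := by
      have h2 : S k * k = (-Complex.I) • (k - 1) - S k := by
        rw [← hSk, mul_add, mul_one, add_sub_cancel_right]
      rw [sub_mul, one_mul, smul_mul_assoc, h2, smul_sub, smul_smul]
      simp only [mul_neg, Complex.I_mul_I, neg_neg, one_smul]
      abel
    have hdiag : ∀ c d : ℂ, c • (1 : Matrix (Fin n) (Fin n) ℂ) + d • S k =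
        U * diagonal (fun j => c + d * b j) * Uᴴ := by
      intro c d
      have e1 : diagonal (fun j => c + d * (b j : ℂ)) =
          c • (1 : Matrix (Fin n) (Fin n) ℂ) + d • diagonal (fun j => (b j : ℂ)) := by
        ext i j
        by_cases hij : i = j
        · subst hij
          simp
        · simp [hij]
      rw [e1, hb, mul_add, add_mul, mul_smul_comm, mul_one, smul_mul_assoc, hU', mul_smul_comm,
        smul_mul_assoc]
    have h2 : (1 - Complex.I • S k) = U * diagonal (fun j => 1 - Complex.I * (b j : ℂ)) * Uᴴ := by
      have := hdiag 1 (-Complex.I)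
      rw [one_smul, neg_smul, ← sub_eq_add_neg] at this
      rw [this]
      congr 3
      funext j
      ring
    have h3 : (1 + Complex.I • S k) = U * diagonal (fun j => 1 + Complex.I * (b j : ℂ)) * Uᴴ := by
      have := hdiag 1 Complex.I
      rwa [one_smul] at this
    have h4 : IsUnit (1 - Complex.I • S k) := by
      rw [h2]
      refine IsUnit.of_mul_eq_one (U * diagonal (fun j => (1 - Complex.I * (b j : ℂ))⁻¹) * Uᴴ) ?_
      rw [diag_conj_mul hU]
      simp only [mul_inv_cancel₀ (hne _)]
      simp [hU']
    refine h4.mul_left_cancel ?_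
    rw [h1, h2, h3, expDiag, diag_conj_mul hU]
    congr 3
    funext j
    rw [mul_comm (1 - _)]
    exact (hexp j).symm

/-- Unitary elements near the identity of a Zariski closed group lie on one-parameter
subgroups. -/
lemma exists_expDiag_mem_of_unitary {G : Set (Matrix (Fin n) (Fin n) ℂ)}
    (hG : IsMatSubgroup ℂ n G) (hGc : IsZClosedInGL ℂ n G) (ε : ℝ) (hε : 0 < ε) :
    ∀ᶠ k in 𝓝 (1 : Matrix (Fin n) (Fin n) ℂ), kᴴ * k = 1 → k ∈ G →
      ∃ (U : Matrix (Fin n) (Fin n) ℂ) (θ : Fin n → ℝ), Uᴴ * U = 1 ∧ (∀ j, |θ j| < ε) ∧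
        k = expDiag U (fun j => (θ j : ℂ) * Complex.I) ∧
        ∀ t : ℂ, expDiag U (t • fun j => (θ j : ℂ) * Complex.I) ∈ G := by
  obtain ⟨d, hd⟩ := exists_degree_expDiag_smul_mem hG hGc
  have hδ : 0 < min ε (1 / (d + 1)) := lt_min hε (by positivity)
  filter_upwards [exists_expDiag_of_unitary (n := n) _ hδ] with k hk hk1 hkG
  obtain ⟨U, θ, hU, hθ, rfl⟩ := hk hk1
  refine ⟨U, θ, hU, fun j => (hθ j).trans_le (min_le_left _ _), rfl, ?_⟩
  refine hd U _ hU hkG fun α β hα hβ he => ?_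
  have hre : ∀ α : Fin n →₀ ℕ, ∑ j, (α j : ℂ) * ((θ j : ℂ) * Complex.I) =
      ((∑ j, α j * θ j : ℝ) : ℂ) * Complex.I := by
    intro α
    push_cast
    rw [Finset.sum_mul]
    exact Finset.sum_congr rfl fun j _ => by ring
  have hbd : ∀ α : Fin n →₀ ℕ, (α.sum fun _ e => e) ≤ d → |∑ j, α j * θ j| < Real.pi := by
    intro α hα
    have h1 : |∑ j, α j * θ j| ≤ ∑ j, (α j : ℝ) * (1 / (d + 1)) := by
      refine (Finset.abs_sum_le_sum_abs _ _).trans (Finset.sum_le_sum fun j _ => ?_)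
      rw [abs_mul, Nat.abs_cast]
      exact mul_le_mul_of_nonneg_left ((hθ j).le.trans (min_le_right _ _)) (Nat.cast_nonneg _)
    rw [← Finset.sum_mul] at h1
    have h2 : ∑ j, (α j : ℝ) ≤ d := by
      rw [Finsupp.sum_fintype _ _ (fun _ => rfl)] at hα
      exact_mod_cast hα
    have h3 : (∑ j, (α j : ℝ)) * (1 / (d + 1)) ≤ 1 := by
      rw [mul_one_div, div_le_one (by positivity)]
      linarith
    linarith [Real.pi_gt_three]
  rw [hre, hre] at he ⊢
  have ha := abs_lt.1 (hbd α hα)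
  have hb := abs_lt.1 (hbd β hβ)
  exact Complex.exp_inj_of_neg_pi_lt_of_le_pi (by simpa using ha.1) (by simpa using ha.2.le)
    (by simpa using hb.1) (by simpa using hb.2.le) he

end SmallUnitary

section SliceUnitary
open Matrix Filter Topology

variable {n : ℕ}

lemma exists_tendsto_ultrafilter {ι X : Type*} [TopologicalSpace X] (F : Ultrafilter ι)
    {s : Set X} (hs : IsCompact s) {u : ι → X} (hu : ∀ᶠ i in F, u i ∈ s) :
    ∃ x ∈ s, Tendsto u F (𝓝 x) :=
  hs.ultrafilter_le_nhds (F.map u) (le_principal_iff.2 hu)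

/-- The unitary elements of a matrix group. -/
def unitaryPart (G : Set (Matrix (Fin n) (Fin n) ℂ)) : Set (Matrix (Fin n) (Fin n) ℂ) :=
  {k | k ∈ G ∧ kᴴ * k = 1}

lemma isCompact_unitary : IsCompact {k : Matrix (Fin n) (Fin n) ℂ | kᴴ * k = 1} := by
  have hcl : IsClosed {k : Matrix (Fin n) (Fin n) ℂ | kᴴ * k = 1} := by
    have h : Continuous fun k : Matrix (Fin n) (Fin n) ℂ => kᴴ * k := by fun_prop
    exact isClosed_eq h continuous_const
  have hbox : IsCompact {k : Matrix (Fin n) (Fin n) ℂ | ∀ i, k i ∈ {v : Fin n → ℂ | nsq v ≤ n}} :=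
    isCompact_pi_infinite fun _ => isCompact_nsq_le _
  refine hbox.of_isClosed_subset hcl fun k hk i => ?_
  have h1 : (k * kᴴ) i i = 1 := by
    rw [mul_eq_one_comm.1 hk, one_apply_eq]
  have h2 : ((nsq (k i) : ℝ) : ℂ) = 1 := by
    rw [nsq_eq, ← h1, mul_apply, dotProduct]
    exact Finset.sum_congr rfl fun j _ => by simp [mul_comm]
  have h3 : nsq (k i) = 1 := by exact_mod_cast h2
  have h4 : (1 : ℝ) ≤ n := by
    exact_mod_cast Nat.one_le_iff_ne_zero.2 fun h => by subst h; exact i.elim0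
  exact h3.le.trans h4

lemma IsStarGroup.isCompact_unitaryPart {G : Set (Matrix (Fin n) (Fin n) ℂ)}
    (hG : IsStarGroup G) : IsCompact (unitaryPart G) := by
  obtain ⟨C, hC, hGC⟩ := hG.zclosed.exists_isClosed
  have : unitaryPart G = {k | kᴴ * k = 1} ∩ C := by
    ext k
    rw [unitaryPart, hGC]
    exact ⟨fun h => ⟨h.2, h.1.2⟩, fun h => ⟨⟨isUnit_of_conjTranspose_mul_self_eq_one h.1, h.2⟩,
      h.1⟩⟩
  rw [this]
  exact isCompact_unitary.inter_right hC

lemma IsStarGroup.mul_mem_unitaryPart {G : Set (Matrix (Fin n) (Fin n) ℂ)}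
    (hG : IsStarGroup G) {a b : Matrix (Fin n) (Fin n) ℂ} (ha : a ∈ unitaryPart G)
    (hb : b ∈ unitaryPart G) : a * b ∈ unitaryPart G := by
  refine ⟨hG.sub.2.1 a ha.1 b hb.1, ?_⟩
  rw [conjTranspose_mul, Matrix.mul_assoc, ← Matrix.mul_assoc aᴴ, ha.2, Matrix.one_mul, hb.2]

lemma IsStarGroup.conjTranspose_mem_unitaryPart {G : Set (Matrix (Fin n) (Fin n) ℂ)}
    (hG : IsStarGroup G) {a : Matrix (Fin n) (Fin n) ℂ} (ha : a ∈ unitaryPart G) :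
    aᴴ ∈ unitaryPart G := by
  refine ⟨hG.star_mem a ha.1, ?_⟩
  rw [conjTranspose_conjTranspose]
  exact mul_eq_one_comm.1 ha.2

lemma re_hasDerivAt {F : ℝ → ℂ} {F' : ℂ} {t : ℝ} (h : HasDerivAt F F' t) :
    HasDerivAt (fun t => (F t).re) F'.re t := by
  exact Complex.reCLM.hasFDerivAt.comp_hasDerivAt t h

lemma hasDerivAt_sum_exp (c d : Fin n → ℂ) (t : ℝ) :
    HasDerivAt (fun t : ℝ => ∑ j, c j * Complex.exp ((t : ℂ) * d j))
      (∑ j, c j * d j * Complex.exp ((t : ℂ) * d j)) t := by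
  refine HasDerivAt.fun_sum fun j _ => ?_
  have h1 : HasDerivAt (fun t : ℝ => (t : ℂ) * d j) (d j) t := by
    simpa using (Complex.ofRealCLM.hasDerivAt (x := t)).mul_const (d j)
  have := (h1.cexp).const_mul (c j)
  rw [mul_assoc, mul_comm (d j)]
  exact this

lemma exists_re_sum_eq_zero (c : Fin n → ℂ) (θ : Fin n → ℝ)
    (h0 : ∀ t : ℝ, (∑ j, c j * Complex.exp ((t : ℂ) * ((θ j : ℂ) * Complex.I))).re ≤
      (∑ j, c j).re)
    (h1 : (∑ j, c j * Complex.exp ((θ j : ℂ) * Complex.I)).re = (∑ j, c j).re) :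
    ∃ t ∈ Set.Ioo (0 : ℝ) 1,
      (∑ j, c j * (θ j : ℂ) ^ 2 * Complex.exp ((t : ℂ) * ((θ j : ℂ) * Complex.I))).re = 0 := by
  set d : Fin n → ℂ := fun j => (θ j : ℂ) * Complex.I with hd
  have hder := fun t => re_hasDerivAt (hasDerivAt_sum_exp c d t)
  have hder2 := fun t => re_hasDerivAt (hasDerivAt_sum_exp (fun j => c j * d j) d t)
  have hmax0 : IsLocalMax (fun t : ℝ => (∑ j, c j * Complex.exp ((t : ℂ) * d j)).re) 0 :=
    Eventually.of_forall fun t => by simpa using h0 t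
  have hmax1 : IsLocalMax (fun t : ℝ => (∑ j, c j * Complex.exp ((t : ℂ) * d j)).re) 1 :=
    Eventually.of_forall fun t => by
      have e : (∑ j, c j * Complex.exp (((1 : ℝ) : ℂ) * d j)).re = (∑ j, c j).re := by
        simpa only [Complex.ofReal_one, one_mul] using h1
      exact (h0 t).trans e.symm.le
  have z0 := hmax0.hasDerivAt_eq_zero (hder 0)
  have z1 := hmax1.hasDerivAt_eq_zero (hder 1)
  obtain ⟨t, ht, hz⟩ := exists_hasDerivAt_eq_zero (f := fun t : ℝ =>
    (∑ j, c j * d j * Complex.exp ((t : ℂ) * d j)).re) zero_lt_one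
    (fun t _ => (hder2 t).continuousAt.continuousWithinAt) (z0.trans z1.symm)
    (fun t _ => hder2 t)
  refine ⟨t, ht, ?_⟩
  rw [← neg_eq_zero, ← Complex.neg_re, ← Finset.sum_neg_distrib, ← hz]
  congr 1
  refine Finset.sum_congr rfl fun j _ => ?_
  have : d j * d j = - (θ j : ℂ) ^ 2 := by
    rw [hd]
    linear_combination (θ j : ℂ) ^ 2 * Complex.I_mul_I
  linear_combination -(c j * Complex.exp ((t : ℂ) * d j)) * this

lemma half_sq_le_mul_sin {x : ℝ} (hx : |x| ≤ 1) : x ^ 2 / 2 ≤ x * Real.sin x := by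
  have key : ∀ y : ℝ, 0 ≤ y → y ≤ 1 → y ^ 2 / 2 ≤ y * Real.sin y := by
    intro y h0 h1
    have h2 := Real.mul_le_sin h0 (by linarith [Real.pi_gt_three])
    have h3 : (1 : ℝ) / 2 ≤ 2 / Real.pi := by
      rw [div_le_div_iff₀ two_pos Real.pi_pos]
      linarith [Real.pi_le_four]
    nlinarith
  rcases le_total 0 x with h | h
  · exact key x h (by rwa [abs_of_nonneg h] at hx)
  · have := key (-x) (by linarith) (by rwa [abs_of_nonpos h] at hx)
    simpa using this

lemma sum_diag_expDiag {U U' : Matrix (Fin n) (Fin n) ℂ} (b : Fin n → ℂ) (j : Fin n) :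
    (Uᴴ * expDiag U' b * U) j j =
      ∑ l, (Complex.normSq ((Uᴴ * U') j l) : ℂ) * Complex.exp (b l) := by
  have h : Uᴴ * expDiag U' b * U =
      (Uᴴ * U') * diagonal (fun l => Complex.exp (b l)) * (Uᴴ * U')ᴴ := by
    simp only [expDiag, conjTranspose_mul, conjTranspose_conjTranspose, Matrix.mul_assoc]
  rw [h, mul_apply]
  refine Finset.sum_congr rfl fun l _ => ?_
  rw [mul_diagonal, conjTranspose_apply, Complex.normSq_eq_conj_mul_self]
  simp only [RCLike.star_def]
  ring

lemma trace_mul_expDiag {k U : Matrix (Fin n) (Fin n) ℂ} (b : Fin n → ℂ) :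
    (k * expDiag U b).trace = ∑ j, (Uᴴ * k * U) j j * Complex.exp (b j) := by
  have : (k * expDiag U b).trace = ((Uᴴ * k * U) * diagonal (fun l => Complex.exp (b l))).trace := by
    rw [expDiag, ← Matrix.mul_assoc, ← Matrix.mul_assoc, Matrix.trace_mul_comm]
    simp only [Matrix.mul_assoc]
  rw [this, trace]
  exact Finset.sum_congr rfl fun j _ => by rw [diag_apply, mul_diagonal]

end SliceUnitary

section SliceUnitaryCore
open Matrix Filter Topology

variable {n : ℕ}

lemma nsq_sub (x y : Fin n → ℂ) :
    nsq (x - y) = nsq x + nsq y - 2 * (star x ⬝ᵥ y).re := by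
  simp only [nsq, dotProduct, Complex.re_sum, Finset.mul_sum, ← Finset.sum_add_distrib,
    ← Finset.sum_sub_distrib]
  refine Finset.sum_congr rfl fun j _ => ?_
  simp only [Pi.sub_apply, Pi.star_apply, RCLike.star_def, Complex.normSq_apply, Complex.sub_re,
    Complex.sub_im, Complex.mul_re, Complex.conj_re, Complex.conj_im]
  ring

lemma eq_one_of_trace {k : Matrix (Fin n) (Fin n) ℂ} (hk : kᴴ * k = 1)
    (h : (n : ℝ) ≤ k.trace.re) : k = 1 := by
  have h1 : ∀ i j, ‖(k - 1) i j‖ ^ 2 ≤ ((k - 1)ᴴ * (k - 1)).trace.re := by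
    intro i j
    have : ((k - 1)ᴴ * (k - 1)).trace.re = ∑ j, ∑ i, ‖(k - 1) i j‖ ^ 2 := by
      simp only [trace, diag_apply, mul_apply, conjTranspose_apply, Complex.re_sum]
      refine Finset.sum_congr rfl fun j _ => Finset.sum_congr rfl fun i _ => ?_
      rw [← Complex.normSq_eq_norm_sq, RCLike.star_def, ← Complex.normSq_eq_conj_mul_self,
        Complex.ofReal_re]
    rw [this]
    exact (Finset.single_le_sum (f := fun i => ‖(k - 1) i j‖ ^ 2) (fun _ _ => sq_nonneg _)
      (Finset.mem_univ i)).trans (Finset.single_le_sum (f := fun j => ∑ i, ‖(k - 1) i j‖ ^ 2)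
      (fun _ _ => Finset.sum_nonneg fun _ _ => sq_nonneg _) (Finset.mem_univ j))
  have h2 : ((k - 1)ᴴ * (k - 1)).trace.re = 2 * n - 2 * k.trace.re := by
    rw [conjTranspose_sub, conjTranspose_one, mul_sub, sub_mul, hk]
    simp only [mul_one, one_mul, trace_sub, trace_one, trace_conjTranspose, Fintype.card_fin,
      Complex.sub_re, Complex.natCast_re, RCLike.star_def, Complex.conj_re]
    ring
  ext i j
  have h3 := h1 i j
  rw [h2] at h3
  have h4 : ‖(k - 1) i j‖ ^ 2 = 0 := le_antisymm (by linarith) (sq_nonneg _)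
  have h5 : (k - 1) i j = 0 := by simpa using h4
  simpa [sub_eq_zero] using h5

lemma star_dotProduct_expDiag (U : Matrix (Fin n) (Fin n) ℂ) (a : Fin n → ℂ) (x w : Fin n → ℂ) :
    star x ⬝ᵥ (expDiag U a *ᵥ w) =
      ∑ j, (star ((Uᴴ *ᵥ x) j) * (Uᴴ *ᵥ w) j) * Complex.exp (a j) := by
  have : star x ᵥ* U = star (Uᴴ *ᵥ x) := by
    rw [star_mulVec, conjTranspose_conjTranspose]
  rw [expDiag_mulVec, dotProduct_mulVec, this, dotProduct]
  exact Finset.sum_congr rfl fun j _ => by simp only [Pi.star_apply]; ring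

lemma tendsto_expDiag {ι : Type*} {F : Filter ι} {V : ι → Matrix (Fin n) (Fin n) ℂ}
    {U : Matrix (Fin n) (Fin n) ℂ} {b : ι → Fin n → ℂ} {c : Fin n → ℂ} (hV : Tendsto V F (𝓝 U))
    (hb : ∀ j, Tendsto (fun i => b i j) F (𝓝 (c j))) :
    Tendsto (fun i => expDiag (V i) (b i)) F (𝓝 (expDiag U c)) := by
  have h1 : Tendsto (fun i => diagonal fun j => Complex.exp (b i j)) F
      (𝓝 (diagonal fun j => Complex.exp (c j))) :=
    (Continuous.tendsto (f := fun v : Fin n → ℂ => diagonal v)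
      (Continuous.matrix_diagonal continuous_id) _).comp
      (tendsto_pi_nhds.2 fun j => (Complex.continuous_exp.tendsto _).comp (hb j))
  have h2 : Tendsto (fun i => (V i)ᴴ) F (𝓝 Uᴴ) :=
    (Continuous.tendsto (f := fun A : Matrix (Fin n) (Fin n) ℂ => Aᴴ) (by fun_prop) U).comp hV
  exact (hV.mul h1).mul h2

lemma IsStarGroup.mulVec_eq_of_tendsto {G : Set (Matrix (Fin n) (Fin n) ℂ)} (hG : IsStarGroup G)
    {w : Fin n → ℂ} {x : ℕ → Fin n → ℂ} {h : ℕ → Matrix (Fin n) (Fin n) ℂ}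
    (hx' : Tendsto x atTop (𝓝 w)) (hh : ∀ i, h i ∈ unitaryPart G) (hhx : ∀ i, h i *ᵥ x i = x i)
    (hhw : ∀ i, h i *ᵥ w ≠ w)
    (hmax : ∀ i, ∀ k ∈ unitaryPart G, (star (x i) ⬝ᵥ (k *ᵥ w)).re ≤ (star (x i) ⬝ᵥ w).re) :
    False := by
  set F : Ultrafilter ℕ := hyperfilter ℕ with hF
  have hFle : (F : Filter ℕ) ≤ atTop := by
    rw [← Nat.cofinite_eq_atTop]
    exact hyperfilter_le_cofinite
  replace hx' := hx'.mono_left hFle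
  have hmv : Continuous fun p : Matrix (Fin n) (Fin n) ℂ × (Fin n → ℂ) => p.1 *ᵥ p.2 := by
    fun_prop
  have htends : ∀ {A : ℕ → Matrix (Fin n) (Fin n) ℂ} {B : Matrix (Fin n) (Fin n) ℂ}
      {u : ℕ → Fin n → ℂ} {v : Fin n → ℂ}, Tendsto A F (𝓝 B) → Tendsto u F (𝓝 v) →
      Tendsto (fun i => A i *ᵥ u i) F (𝓝 (B *ᵥ v)) := fun h1 h2 =>
    (hmv.tendsto _).comp (h1.prodMk_nhds h2)
  have htr : Continuous fun A : Matrix (Fin n) (Fin n) ℂ => A.trace.re := by fun_prop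
  -- the element of maximal trace
  have hk : ∀ i, ∃ k ∈ unitaryPart G, k *ᵥ w = h i *ᵥ w ∧
      ∀ k' ∈ unitaryPart G, k' *ᵥ w = h i *ᵥ w → k'.trace.re ≤ k.trace.re := by
    intro i
    have hc : IsCompact (unitaryPart G ∩ {k | k *ᵥ w = h i *ᵥ w}) := by
      refine hG.isCompact_unitaryPart.inter_right (isClosed_eq ?_ continuous_const)
      fun_prop
    obtain ⟨k, hk, hm⟩ := hc.exists_isMaxOn ⟨h i, hh i, rfl⟩ htr.continuousOn
    exact ⟨k, hk.1, hk.2, fun k' h1 h2 => hm ⟨h1, h2⟩⟩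
  choose k hkK hkw hkmax using hk
  obtain ⟨h', -, hh'⟩ := exists_tendsto_ultrafilter F hG.isCompact_unitaryPart
    (Eventually.of_forall hh)
  obtain ⟨k', hk'K, hk'⟩ := exists_tendsto_ultrafilter F hG.isCompact_unitaryPart
    (Eventually.of_forall hkK)
  have hh'w : h' *ᵥ w = w :=
    tendsto_nhds_unique (htends hh' hx') (by simpa only [hhx] using hx')
  have hk'w : k' *ᵥ w = w := by
    have h1 := htends hk' (tendsto_const_nhds (x := w))
    simp only [hkw] at h1
    exact (tendsto_nhds_unique h1 (htends hh' tendsto_const_nhds)).trans hh'w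
  have hk'1 : k' = 1 := by
    refine eq_one_of_trace hk'K.2 ?_
    have hst := hG.conjTranspose_mem_unitaryPart hk'K
    have hk's : k'ᴴ *ᵥ w = w := by
      conv_lhs => rw [← hk'w]
      rw [mulVec_mulVec, hk'K.2, one_mulVec]
    have h1 : ∀ i, (k i * k'ᴴ).trace.re ≤ (k i).trace.re := fun i =>
      hkmax i _ (hG.mul_mem_unitaryPart (hkK i) hst) (by rw [← mulVec_mulVec, hk's, hkw])
    have h2 : Tendsto (fun i => (k i * k'ᴴ).trace.re) F (𝓝 (k' * k'ᴴ).trace.re) :=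
      (htr.tendsto _).comp (hk'.mul_const _)
    have h3 := le_of_tendsto_of_tendsto' h2 ((htr.tendsto _).comp hk') h1
    rw [mul_eq_one_comm.1 hk'K.2, trace_one, Fintype.card_fin] at h3
    simpa using h3
  subst hk'1
  obtain ⟨p, hp⟩ := (hk'.eventually (exists_expDiag_mem_of_unitary hG.sub hG.zclosed 1 one_pos)).mono
    (fun i hi => by
      obtain ⟨U, θ, h1⟩ := hi (hkK i).2 (hkK i).1
      exact ⟨(U, θ), h1⟩ : ∀ i, _ → ∃ p : Matrix (Fin n) (Fin n) ℂ × (Fin n → ℝ),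
        (p.1)ᴴ * p.1 = 1 ∧ (∀ j, |p.2 j| < 1) ∧ k i = expDiag p.1 (fun j => (p.2 j : ℂ) * Complex.I) ∧
        ∀ t : ℂ, expDiag p.1 (t • fun j => (p.2 j : ℂ) * Complex.I) ∈ G) |>.choice
  obtain ⟨U, hU, hUt⟩ := exists_tendsto_ultrafilter F isCompact_unitary
    (hp.mono fun i hi => hi.1)
  have hU' := mul_eq_one_comm.1 hU
  have hθ0 : ∀ᶠ i in F, 0 < ‖(p i).2‖ := by
    filter_upwards [hp] with i hi
    rw [norm_pos_iff]
    intro h0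
    apply hhw i
    rw [← hkw, hi.2.2.1, h0]
    have : (fun j => (((0 : Fin n → ℝ) j : ℝ) : ℂ) * Complex.I) = 0 := by
      funext j
      simp
    rw [this, expDiag_zero hi.1, one_mulVec]
  have hθ1 : ∀ᶠ i in F, ∀ j, |(p i).2 j| ≤ 1 := hp.mono fun i hi j => (hi.2.1 j).le
  have hθn : ∀ i j, |(p i).2 j| ≤ ‖(p i).2‖ := fun i j => norm_le_pi_norm (p i).2 j
  obtain ⟨a, ha, hat⟩ := exists_tendsto_ultrafilter F (isCompact_sphere (0 : Fin n → ℝ) 1)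
    (u := fun i => (‖(p i).2‖)⁻¹ • (p i).2) (by
      filter_upwards [hθ0] with i hi
      rw [mem_sphere_zero_iff_norm, norm_smul, norm_inv, norm_norm, inv_mul_cancel₀ hi.ne'])
  have hat' : ∀ j, Tendsto (fun i => (‖(p i).2‖)⁻¹ * (p i).2 j) F (𝓝 (a j)) :=
    fun j => (tendsto_pi_nhds.1 hat) j
  obtain ⟨u, -, hut⟩ := exists_tendsto_ultrafilter F (isCompact_closedBall (0 : Fin n → ℝ) 1)
    (u := fun i j => (‖(p i).2‖)⁻¹ * Real.sin ((p i).2 j)) (by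
      filter_upwards [hθ0] with i hi
      rw [mem_closedBall_zero_iff, pi_norm_le_iff_of_nonneg zero_le_one]
      intro j
      rw [Real.norm_eq_abs, abs_mul, abs_inv, abs_norm, inv_mul_le_iff₀ hi, mul_one]
      exact (Real.abs_sin_le_abs).trans (hθn i j))
  have hut' : ∀ j, Tendsto (fun i => (‖(p i).2‖)⁻¹ * Real.sin ((p i).2 j)) F (𝓝 (u j)) :=
    fun j => (tendsto_pi_nhds.1 hut) j
  have hua : ∀ j, a j ^ 2 / 2 ≤ a j * u j := by
    intro j
    refine le_of_tendsto_of_tendsto (((hat' j).pow 2).div_const 2) ((hat' j).mul (hut' j)) ?_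
    filter_upwards [hθ1] with i hi
    have := mul_le_mul_of_nonneg_left (half_sq_le_mul_sin (hi j)) (sq_nonneg (‖(p i).2‖)⁻¹)
    linarith
  -- the second-order condition
  have hroll : ∀ᶠ i in F, ∃ t ∈ Set.Ioo (0 : ℝ) 1,
      (∑ j, (star ((((p i).1)ᴴ *ᵥ x i) j) * (((p i).1)ᴴ *ᵥ w) j) * ((p i).2 j : ℂ) ^ 2 *
        Complex.exp ((t : ℂ) * (((p i).2 j : ℂ) * Complex.I))).re = 0 := by
    filter_upwards [hp] with i hi
    have hz : (∑ j, star ((((p i).1)ᴴ *ᵥ x i) j) * (((p i).1)ᴴ *ᵥ w) j) = star (x i) ⬝ᵥ w := by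
      have := star_dotProduct_expDiag (p i).1 0 (x i) w
      rw [expDiag_zero hi.1, one_mulVec] at this
      rw [this]
      simp
    refine exists_re_sum_eq_zero _ _ (fun t => ?_) ?_
    · rw [hz]
      refine le_trans (le_of_eq ?_) (hmax i (expDiag (p i).1 ((t : ℂ) • fun j => ((p i).2 j : ℂ) *
        Complex.I)) ⟨hi.2.2.2 t, expDiag_unitary hi.1 fun j => by simp⟩)
      rw [star_dotProduct_expDiag]
      rfl
    · rw [hz]
      have h1 := star_dotProduct_expDiag (p i).1 (fun j => ((p i).2 j : ℂ) * Complex.I) (x i) w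
      rw [← hi.2.2.1, hkw] at h1
      rw [← h1]
      have h2 : star (x i) = star (x i) ᵥ* h i := by
        have := congrArg (fun v => (h i)ᴴ *ᵥ v) (hhx i)
        simp only [mulVec_mulVec, (hh i).2, one_mulVec] at this
        conv_lhs => rw [this, star_mulVec, conjTranspose_conjTranspose]
      have h3 : star (x i) ᵥ* (h i) = star (x i) := h2.symm
      rw [dotProduct_mulVec, h3]
  obtain ⟨t, ht⟩ := hroll.choice
  obtain ⟨τ, hτ, hτt⟩ := exists_tendsto_ultrafilter F (isCompact_closedBall (0 : Fin n → ℝ) 1)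
    (u := fun i j => t i * (p i).2 j) (by
      filter_upwards [hθ1, ht] with i hi hti
      rw [mem_closedBall_zero_iff, pi_norm_le_iff_of_nonneg zero_le_one]
      intro j
      rw [Real.norm_eq_abs, abs_mul, abs_of_pos hti.1.1]
      exact mul_le_one₀ hti.1.2.le (abs_nonneg _) (hi j))
  have hτt' : ∀ j, Tendsto (fun i => t i * (p i).2 j) F (𝓝 (τ j)) :=
    fun j => (tendsto_pi_nhds.1 hτt) j
  have hUst : Tendsto (fun i => ((p i).1)ᴴ) F (𝓝 Uᴴ) :=
    (Continuous.tendsto (f := fun A : Matrix (Fin n) (Fin n) ℂ => Aᴴ) (by fun_prop) U).comp hUt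
  have hq : ∀ j, a j = 0 ∨ (Uᴴ *ᵥ w) j = 0 := by
    have hlim : Tendsto (fun i => (∑ j, (star ((((p i).1)ᴴ *ᵥ x i) j) * (((p i).1)ᴴ *ᵥ w) j) *
        ((((‖(p i).2‖)⁻¹ * (p i).2 j : ℝ) : ℂ)) ^ 2 *
        Complex.exp (((t i * (p i).2 j : ℝ) : ℂ) * Complex.I)).re) F
        (𝓝 (∑ j, (star ((Uᴴ *ᵥ w) j) * (Uᴴ *ᵥ w) j) * (a j : ℂ) ^ 2 *
          Complex.exp ((τ j : ℂ) * Complex.I)).re) := by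
      refine (Complex.continuous_re.tendsto _).comp (tendsto_finsetSum _ fun j _ => ?_)
      have e1 := (tendsto_pi_nhds.1 (htends hUst hx')) j
      have e2 := (tendsto_pi_nhds.1 (htends hUst (tendsto_const_nhds (x := w)))) j
      have e3 := (Complex.continuous_ofReal.tendsto _).comp (hat' j)
      have e4 := (Complex.continuous_ofReal.tendsto _).comp (hτt' j)
      exact (((continuous_star.tendsto _).comp e1).mul e2).mul (e3.pow 2) |>.mul
        ((Complex.continuous_exp.tendsto _).comp (e4.mul_const _))
    have hzero : (∑ j, (star ((Uᴴ *ᵥ w) j) * (Uᴴ *ᵥ w) j) * (a j : ℂ) ^ 2 *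
          Complex.exp ((τ j : ℂ) * Complex.I)).re = 0 := by
      refine tendsto_nhds_unique (hlim.congr' ?_) tendsto_const_nhds
      filter_upwards [ht] with i hi
      have : (∑ j, (star ((((p i).1)ᴴ *ᵥ x i) j) * (((p i).1)ᴴ *ᵥ w) j) *
        ((((‖(p i).2‖)⁻¹ * (p i).2 j : ℝ) : ℂ)) ^ 2 *
        Complex.exp (((t i * (p i).2 j : ℝ) : ℂ) * Complex.I)) = (((‖(p i).2‖)⁻¹ ^ 2 : ℝ) : ℂ) *
        (∑ j, (star ((((p i).1)ᴴ *ᵥ x i) j) * (((p i).1)ᴴ *ᵥ w) j) * ((p i).2 j : ℂ) ^ 2 *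
        Complex.exp ((t i : ℂ) * (((p i).2 j : ℂ) * Complex.I))) := by
        rw [Finset.mul_sum]
        refine Finset.sum_congr rfl fun j _ => ?_
        push_cast
        rw [mul_assoc (t i : ℂ)]
        ring
      rw [this, Complex.re_ofReal_mul, hi.2, mul_zero]
    have hterm : ∀ j, ((star ((Uᴴ *ᵥ w) j) * (Uᴴ *ᵥ w) j) * (a j : ℂ) ^ 2 *
          Complex.exp ((τ j : ℂ) * Complex.I)).re =
          Complex.normSq ((Uᴴ *ᵥ w) j) * a j ^ 2 * Real.cos (τ j) := by
      intro j
      have : (star ((Uᴴ *ᵥ w) j) * (Uᴴ *ᵥ w) j) * (a j : ℂ) ^ 2 =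
          ((Complex.normSq ((Uᴴ *ᵥ w) j) * a j ^ 2 : ℝ) : ℂ) := by
        push_cast
        rw [Complex.normSq_eq_conj_mul_self]
        rfl
      rw [this, Complex.re_ofReal_mul, Complex.exp_ofReal_mul_I_re]
    rw [Complex.re_sum] at hzero
    simp only [hterm] at hzero
    have hcos : ∀ j, 0 < Real.cos (τ j) := fun j => by
      refine Real.cos_pos_of_le_one ?_
      rw [← Real.norm_eq_abs]
      exact (norm_le_pi_norm τ j).trans (mem_closedBall_zero_iff.1 hτ)
    intro j
    have := (Finset.sum_eq_zero_iff_of_nonneg (fun i _ => mul_nonneg (mul_nonneg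
      (Complex.normSq_nonneg _) (sq_nonneg _)) (hcos i).le)).1 hzero j (Finset.mem_univ j)
    rcases mul_eq_zero.1 this with h1 | h1
    · rcases mul_eq_zero.1 h1 with h2 | h2
      · exact Or.inr (Complex.normSq_eq_zero.1 h2)
      · exact Or.inl (by simpa using h2)
    · exact absurd h1 (hcos j).ne'
  have hmem : ∀ s : ℝ, expDiag U ((s : ℂ) • fun j => (a j : ℂ) * Complex.I) ∈ unitaryPart G := by
    intro s
    have h1 : Tendsto (fun i => expDiag (p i).1 ((((s * (‖(p i).2‖)⁻¹ : ℝ)) : ℂ) •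
        fun j => ((p i).2 j : ℂ) * Complex.I)) F
        (𝓝 (expDiag U ((s : ℂ) • fun j => (a j : ℂ) * Complex.I))) := by
      refine tendsto_expDiag hUt fun j => ?_
      have e3 : Tendsto (fun i => (s : ℂ) * ((((‖(p i).2‖)⁻¹ * (p i).2 j : ℝ) : ℂ) * Complex.I)) F
          (𝓝 ((s : ℂ) * ((a j : ℂ) * Complex.I))) :=
        (((Complex.continuous_ofReal.tendsto _).comp (hat' j)).mul_const
          Complex.I).const_mul (s : ℂ)
      refine e3.congr fun i => ?_
      simp only [Pi.smul_apply, smul_eq_mul]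
      push_cast
      ring
    refine hG.isCompact_unitaryPart.isClosed.mem_of_tendsto h1 ?_
    filter_upwards [hp] with i hi
    exact ⟨hi.2.2.2 _, expDiag_unitary hi.1 fun j => by simp⟩
  have hfix : ∀ s : ℝ, expDiag U ((s : ℂ) • fun j => (a j : ℂ) * Complex.I) *ᵥ w = w := fun s =>
    expDiag_smul_mulVec_eq hU (fun j => (hq j).imp (fun h => by simp [h]) id) _
  have hcrit : ∀ i, (∑ j, (Uᴴ * k i * U) j j * ((a j : ℂ) * Complex.I)).re = 0 := by
    intro i
    have hder := re_hasDerivAt (hasDerivAt_sum_exp (fun j => (Uᴴ * k i * U) j j)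
      (fun j => (a j : ℂ) * Complex.I) 0)
    have hm : IsLocalMax (fun s : ℝ => (∑ j, (Uᴴ * k i * U) j j *
        Complex.exp ((s : ℂ) * ((a j : ℂ) * Complex.I))).re) 0 := by
      refine Eventually.of_forall fun s => ?_
      have h1 := hkmax i _ (hG.mul_mem_unitaryPart (hkK i) (hmem s))
        (by rw [← mulVec_mulVec, hfix, hkw])
      have h0 := trace_mul_expDiag (k := k i) (U := U) 0
      rw [expDiag_zero hU, Matrix.mul_one] at h0
      rw [trace_mul_expDiag, h0] at h1
      simpa using h1
    simpa using hm.hasDerivAt_eq_zero hder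
  have hcrit' : ∀ᶠ i in F, ∑ j, (∑ l, Complex.normSq ((Uᴴ * (p i).1) j l) *
      ((‖(p i).2‖)⁻¹ * Real.sin ((p i).2 l))) * a j = 0 := by
    filter_upwards [hp] with i hi
    have h1 := hcrit i
    rw [hi.2.2.1] at h1
    simp only [sum_diag_expDiag] at h1
    have h2 : ∀ j, ((∑ l, (Complex.normSq ((Uᴴ * (p i).1) j l) : ℂ) *
        Complex.exp (((p i).2 l : ℂ) * Complex.I)) * ((a j : ℂ) * Complex.I)).re =
        -((∑ l, Complex.normSq ((Uᴴ * (p i).1) j l) * Real.sin ((p i).2 l)) * a j) := by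
      intro j
      rw [← mul_assoc, Complex.mul_I_re, Complex.im_mul_ofReal, Complex.im_sum]
      congr 2
      refine Finset.sum_congr rfl fun l _ => ?_
      rw [Complex.im_ofReal_mul, Complex.exp_ofReal_mul_I_im]
    rw [Complex.re_sum] at h1
    simp only [h2, Finset.sum_neg_distrib, neg_eq_zero] at h1
    have h3 : ∑ j, (∑ l, Complex.normSq ((Uᴴ * (p i).1) j l) *
      ((‖(p i).2‖)⁻¹ * Real.sin ((p i).2 l))) * a j = (‖(p i).2‖)⁻¹ *
      ∑ j, (∑ l, Complex.normSq ((Uᴴ * (p i).1) j l) * Real.sin ((p i).2 l)) * a j := by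
      simp only [Finset.mul_sum, Finset.sum_mul]
      exact Finset.sum_congr rfl fun j _ => Finset.sum_congr rfl fun l _ => by ring
    rw [h3, h1, mul_zero]
  have hlim : Tendsto (fun i => ∑ j, (∑ l, Complex.normSq ((Uᴴ * (p i).1) j l) *
      ((‖(p i).2‖)⁻¹ * Real.sin ((p i).2 l))) * a j) F
      (𝓝 (∑ j, (∑ l, Complex.normSq ((Uᴴ * U) j l) * u l) * a j)) := by
    refine tendsto_finsetSum _ fun j _ => (tendsto_finsetSum _ fun l _ => ?_).mul_const _
    have e1 := (tendsto_pi_nhds.1 ((tendsto_pi_nhds.1 (hUt.const_mul Uᴴ)) j)) l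
    exact ((Complex.continuous_normSq.tendsto _).comp e1).mul (hut' l)
  have hfin : ∑ j, u j * a j = 0 := by
    have h1 := tendsto_nhds_unique (hlim.congr' hcrit') tendsto_const_nhds
    rw [hU] at h1
    rw [← h1]
    refine Finset.sum_congr rfl fun j _ => ?_
    rw [Finset.sum_eq_single j (fun l _ hl => by simp [one_apply_ne hl.symm]) (by simp)]
    simp
  have ha0 : a = 0 := by
    funext j
    have := (Finset.sum_eq_zero_iff_of_nonneg (f := fun j => u j * a j) (fun i _ => by
      have := hua i
      nlinarith [sq_nonneg (a i)])).1 hfin j (Finset.mem_univ j)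
    have h2 := hua j
    have h3 : a j ^ 2 = 0 := by nlinarith [sq_nonneg (a j)]
    simpa using h3
  rw [ha0] at ha
  simp at ha

end SliceUnitaryCore

section Countability
open Matrix Filter Topology

variable {n : ℕ}

lemma IsStarGroup.eventually_unitary_isotropy {G : Set (Matrix (Fin n) (Fin n) ℂ)}
    (hG : IsStarGroup G) (w : Fin n → ℂ) :
    ∀ᶠ x in 𝓝 w, ∃ k ∈ unitaryPart G, ∀ h ∈ unitaryPart G, h *ᵥ x = x →
      h *ᵥ (k *ᵥ w) = k *ᵥ w := by
  by_contra hcon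
  obtain ⟨x, hxw, hx'⟩ := exists_seq_forall_of_frequently (not_eventually.1 hcon)
  push Not at hx'
  have hne : (unitaryPart G).Nonempty := ⟨1, hG.sub.1, by simp⟩
  have hmax : ∀ i, ∃ k ∈ unitaryPart G, ∀ k' ∈ unitaryPart G,
      (star (x i) ⬝ᵥ (k' *ᵥ w)).re ≤ (star (x i) ⬝ᵥ (k *ᵥ w)).re := by
    intro i
    have hc : Continuous fun k : Matrix (Fin n) (Fin n) ℂ => (star (x i) ⬝ᵥ (k *ᵥ w)).re := by
      fun_prop
    obtain ⟨k, hk, hm⟩ := hG.isCompact_unitaryPart.exists_isMaxOn hne hc.continuousOn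
    exact ⟨k, hk, fun k' hk' => hm hk'⟩
  choose κ hκ hκmax using hmax
  choose h hh hhx hhw using fun i => hx' i (κ i) (hκ i)
  have hκ1 : ∀ i, κ i * (κ i)ᴴ = 1 := fun i => mul_eq_one_comm.1 (hκ i).2
  have hst : ∀ i (v : Fin n → ℂ), star ((κ i)ᴴ *ᵥ x i) ⬝ᵥ v = star (x i) ⬝ᵥ (κ i *ᵥ v) := by
    intro i v
    rw [star_mulVec, conjTranspose_conjTranspose, dotProduct_mulVec]
  refine hG.mulVec_eq_of_tendsto (w := w) (x := fun i => (κ i)ᴴ *ᵥ x i)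
    (h := fun i => (κ i)ᴴ * (h i * κ i)) ?_ ?_ ?_ ?_ ?_
  · have h1 : ∀ i, nsq ((κ i)ᴴ *ᵥ x i - w) ≤ nsq (x i - w) := by
      intro i
      have h2 := hκmax i 1 ⟨hG.sub.1, by simp⟩
      rw [one_mulVec] at h2
      rw [nsq_sub, nsq_sub, hst, nsq_mulVec (by rw [conjTranspose_conjTranspose, hκ1])]
      linarith
    have h2 : Tendsto (fun i => nsq (x i - w)) atTop (𝓝 0) := by
      have := (continuous_nsq.tendsto (w - w)).comp (hxw.sub_const w)
      have h0 : nsq (w - w) = 0 := by simp [nsq]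
      rwa [h0] at this
    have h3 : Tendsto (fun i => nsq ((κ i)ᴴ *ᵥ x i - w)) atTop (𝓝 0) :=
      squeeze_zero (fun i => nsq_nonneg _) h1 h2
    rw [tendsto_pi_nhds]
    intro j
    rw [tendsto_iff_norm_sub_tendsto_zero]
    have h4 := h3.sqrt
    rw [Real.sqrt_zero] at h4
    exact squeeze_zero (fun i => norm_nonneg _)
      (fun i => Real.le_sqrt_of_sq_le (norm_sq_le_nsq ((κ i)ᴴ *ᵥ x i - w) j)) h4
  · exact fun i => hG.mul_mem_unitaryPart (hG.conjTranspose_mem_unitaryPart (hκ i))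
      (hG.mul_mem_unitaryPart (hh i) (hκ i))
  · intro i
    simp only [mulVec_mulVec]
    rw [Matrix.mul_assoc, Matrix.mul_assoc, hκ1, Matrix.mul_one, ← mulVec_mulVec, hhx]
  · intro i hcon
    apply hhw i
    have := congrArg (fun v => κ i *ᵥ v) hcon
    simp only [mulVec_mulVec, ← Matrix.mul_assoc, hκ1, Matrix.one_mul] at this
    simpa [mulVec_mulVec] using this
  · intro i k hk
    rw [hst, hst, mulVec_mulVec]
    exact hκmax i _ (hG.mul_mem_unitaryPart (hκ i) hk)

lemma mem_isotropy_mulVec {G : Set (Matrix (Fin n) (Fin n) ℂ)} (hG : IsMatSubgroup ℂ n G)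
    {g h : Matrix (Fin n) (Fin n) ℂ} (hg : g ∈ G) (v : Fin n → ℂ) :
    h ∈ isotropy ℂ n G (g *ᵥ v) ↔ g⁻¹ * h * g ∈ isotropy ℂ n G v := by
  have h1 := hG.inv_mul hg
  have h2 := hG.mul_inv hg
  constructor
  · rintro ⟨hh, he⟩
    refine ⟨hG.2.1 _ (hG.2.1 _ (hG.2.2 g hg).2 _ hh) _ hg, ?_⟩
    rw [← mulVec_mulVec, ← mulVec_mulVec, he, mulVec_mulVec, h1, one_mulVec]
  · rintro ⟨hh, he⟩
    have h3 : h = g * (g⁻¹ * h * g) * g⁻¹ := by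
      simp only [Matrix.mul_assoc, h2, Matrix.mul_one]
      rw [← Matrix.mul_assoc, h2, Matrix.one_mul]
    constructor
    · rw [h3]
      exact hG.2.1 _ (hG.2.1 _ hg _ hh) _ (hG.2.2 g hg).2
    · rw [h3, mulVec_mulVec, Matrix.mul_assoc, h1, Matrix.mul_one, ← mulVec_mulVec, he]

lemma isotropy_mulVec_eq_image {G : Set (Matrix (Fin n) (Fin n) ℂ)} (hG : IsMatSubgroup ℂ n G)
    {g : Matrix (Fin n) (Fin n) ℂ} (hg : g ∈ G) (v : Fin n → ℂ) :
    isotropy ℂ n G (g *ᵥ v) = (fun h => g * h * g⁻¹) '' isotropy ℂ n G v := by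
  have h1 := hG.inv_mul hg
  have h2 := hG.mul_inv hg
  ext h
  rw [mem_isotropy_mulVec hG hg]
  constructor
  · intro hh
    refine ⟨_, hh, ?_⟩
    simp only [Matrix.mul_assoc, h2, Matrix.mul_one]
    rw [← Matrix.mul_assoc, h2, Matrix.one_mul]
  · rintro ⟨k, hk, rfl⟩
    have : g⁻¹ * (g * k * g⁻¹) * g = k := by
      simp only [Matrix.mul_assoc, h1, Matrix.mul_one]
      rw [← Matrix.mul_assoc, h1, Matrix.one_mul]
    simpa only [this] using hk

lemma conjIsotropy_iff {G : Set (Matrix (Fin n) (Fin n) ℂ)} (hG : IsMatSubgroup ℂ n G)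
    {v w : Fin n → ℂ} :
    ConjIsotropy ℂ n G v w ↔ ∃ g ∈ G, isotropy ℂ n G w = isotropy ℂ n G (g *ᵥ v) := by
  refine exists_congr fun g => and_congr_right fun hg => ?_
  rw [isotropy_mulVec_eq_image hG hg]

lemma isotropy_mulVec_subset {G : Set (Matrix (Fin n) (Fin n) ℂ)} (hG : IsMatSubgroup ℂ n G)
    {g : Matrix (Fin n) (Fin n) ℂ} (hg : g ∈ G) {v w : Fin n → ℂ}
    (h : isotropy ℂ n G v ⊆ isotropy ℂ n G w) :
    isotropy ℂ n G (g *ᵥ v) ⊆ isotropy ℂ n G (g *ᵥ w) := fun _ hk =>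
  (mem_isotropy_mulVec hG hg w).2 (h ((mem_isotropy_mulVec hG hg v).1 hk))

lemma ConjIsotropy.symm {G : Set (Matrix (Fin n) (Fin n) ℂ)} (hG : IsMatSubgroup ℂ n G)
    {v w : Fin n → ℂ} (h : ConjIsotropy ℂ n G v w) : ConjIsotropy ℂ n G w v := by
  obtain ⟨g, hg, h⟩ := (conjIsotropy_iff hG).1 h
  have hg' := (hG.2.2 g hg).2
  refine (conjIsotropy_iff hG).2 ⟨g⁻¹, hg', ?_⟩
  have h1 := (isotropy_mulVec_subset hG hg' h.le).antisymm (isotropy_mulVec_subset hG hg' h.ge)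
  rw [mulVec_mulVec, hG.inv_mul hg, one_mulVec] at h1
  exact h1.symm

lemma ConjIsotropy.trans {G : Set (Matrix (Fin n) (Fin n) ℂ)} (hG : IsMatSubgroup ℂ n G)
    {u v w : Fin n → ℂ} (h : ConjIsotropy ℂ n G u v) (h' : ConjIsotropy ℂ n G v w) :
    ConjIsotropy ℂ n G u w := by
  obtain ⟨g, hg, h⟩ := (conjIsotropy_iff hG).1 h
  obtain ⟨g', hg', h'⟩ := (conjIsotropy_iff hG).1 h'
  refine (conjIsotropy_iff hG).2 ⟨g' * g, hG.2.1 _ hg' _ hg, ?_⟩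
  rw [h', ← mulVec_mulVec]
  exact (isotropy_mulVec_subset hG hg' h.le).antisymm (isotropy_mulVec_subset hG hg' h.ge)

/-- The vanishing ideal of a set of matrices. -/
def matIdeal (S : Set (Matrix (Fin n) (Fin n) ℂ)) : Ideal (MvPolynomial (Fin n × Fin n) ℂ) where
  carrier := {p | ∀ g ∈ S, eval (fun ij => g ij.1 ij.2) p = 0}
  zero_mem' := by intro x _; simp
  add_mem' := by intro a b ha hb x hx; simp [ha x hx, hb x hx]
  smul_mem' := by intro c p hp x hx; simp [smul_eq_mul, hp x hx]

lemma matIdeal_lt {G : Set (Matrix (Fin n) (Fin n) ℂ)} {v w : Fin n → ℂ}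
    (h : isotropy ℂ n G v ⊂ isotropy ℂ n G w) :
    matIdeal (isotropy ℂ n G w) < matIdeal (isotropy ℂ n G v) := by
  refine lt_of_le_not_ge (fun p hp g hg => hp g (h.1 hg)) fun hle => h.2 fun g hg => ⟨hg.1, ?_⟩
  funext i
  obtain ⟨p, hp⟩ := (matPoly_mulVec v i).sub (matPoly_const (v i))
  have h1 : p ∈ matIdeal (isotropy ℂ n G v) := fun k hk => by
    refine (hp k).trans ?_
    change (k *ᵥ v) i - v i = 0
    rw [hk.2, sub_self]
  have h2 := (hp g).symm.trans (hle h1 g hg)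
  exact sub_eq_zero.1 h2

lemma IsStarGroup.exists_countable_of_isotropy_subset {G : Set (Matrix (Fin n) (Fin n) ℂ)}
    (hG : IsStarGroup G) (I : Ideal (MvPolynomial (Fin n × Fin n) ℂ)) :
    ∀ w : Fin n → ℂ, matIdeal (isotropy ℂ n G w) = I → ∃ T : Set (Fin n → ℂ), T.Countable ∧
      ∀ x, IsMinVec G x → (∃ g ∈ G, isotropy ℂ n G (g *ᵥ x) ⊆ isotropy ℂ n G w) →
        ∃ t ∈ T, ConjIsotropy ℂ n G t x := by
  induction I using WellFoundedGT.induction with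
  | _ I ih =>
  rintro w rfl
  set S : Set (Fin n → ℂ) := {x | ∃ g ∈ G, isotropy ℂ n G (g *ᵥ x) ⊂ isotropy ℂ n G w} with hS
  obtain ⟨t, htS, htc, hcov⟩ := TopologicalSpace.countable_cover_nhdsWithin (s := S)
    fun x _ => mem_nhdsWithin_of_mem_nhds (hG.eventually_unitary_isotropy x)
  have hT : ∀ y : S, ∃ T : Set (Fin n → ℂ), T.Countable ∧
      ∀ x, IsMinVec G x → (∃ g ∈ G, isotropy ℂ n G (g *ᵥ x) ⊆ isotropy ℂ n G (y : Fin n → ℂ)) →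
        ∃ t ∈ T, ConjIsotropy ℂ n G t x := by
    rintro ⟨y, g, hg, hy⟩
    obtain ⟨T, hTc, hT⟩ := ih _ (matIdeal_lt hy) _ rfl
    refine ⟨T, hTc, fun x hx ⟨g', hg', hgx⟩ => hT x hx ⟨g * g', hG.sub.2.1 _ hg _ hg', ?_⟩⟩
    rw [← mulVec_mulVec]
    exact isotropy_mulVec_subset hG.sub hg hgx
  choose T hTc hT using hT
  have : Countable t := htc
  refine ⟨insert w (⋃ y : t, T ⟨y, htS y.2⟩),
    (Set.countable_iUnion fun y => hTc _).insert w, ?_⟩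
  rintro x hx ⟨g, hg, hgx⟩
  by_cases heq : isotropy ℂ n G w ⊆ isotropy ℂ n G (g *ᵥ x)
  · refine ⟨w, Set.mem_insert _ _, ConjIsotropy.symm hG.sub ?_⟩
    exact (conjIsotropy_iff hG.sub).2 ⟨g, hg, heq.antisymm hgx⟩
  · obtain ⟨y, hy, hxy⟩ := Set.mem_iUnion₂.1 (hcov ⟨g, hg, hgx, heq⟩)
    obtain ⟨k, hk, hkx⟩ := hxy
    have h1 := hG.isotropy_subset hx (y := k *ᵥ y)
      fun h hhG hh1 hhx => hkx h ⟨hhG, hh1⟩ hhx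
    have hk' := (hG.sub.2.2 k hk.1).2
    obtain ⟨s, hs, hc⟩ := hT ⟨y, htS hy⟩ x hx ⟨k⁻¹, hk', by
      have := isotropy_mulVec_subset hG.sub hk' h1
      rwa [mulVec_mulVec, hG.sub.inv_mul hk.1, one_mulVec] at this⟩
    exact ⟨s, Set.mem_insert_of_mem _ (Set.mem_iUnion.2 ⟨⟨y, hy⟩, hs⟩), hc⟩

/-- There are countably many conjugacy classes of isotropy groups of minimal vectors. -/
lemma IsStarGroup.exists_countable_conjIsotropy {G : Set (Matrix (Fin n) (Fin n) ℂ)}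
    (hG : IsStarGroup G) : ∃ T : Set (Fin n → ℂ), T.Countable ∧
      ∀ x, IsMinVec G x → ∃ t ∈ T, ConjIsotropy ℂ n G t x := by
  obtain ⟨T, hTc, hT⟩ := hG.exists_countable_of_isotropy_subset _ 0 rfl
  exact ⟨T, hTc, fun x hx => hT x hx ⟨1, hG.sub.1, fun g hg => ⟨hg.1, mulVec_zero g⟩⟩⟩

end Countability

section Escape
open Matrix Filter Topology

variable {n : ℕ}

/-- The sum of the squared Frobenius norms of two matrices. -/
def energy (q : Matrix (Fin n) (Fin n) ℂ × Matrix (Fin n) (Fin n) ℂ) : ℝ :=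
  ((q.1)ᴴ * q.1).trace.re + (q.2 * (q.2)ᴴ).trace.re

lemma continuous_energy : Continuous
    (energy : Matrix (Fin n) (Fin n) ℂ × Matrix (Fin n) (Fin n) ℂ → ℝ) := by
  unfold energy
  fun_prop

lemma trace_mul_conjTranspose_re (A : Matrix (Fin n) (Fin n) ℂ) :
    (A * Aᴴ).trace.re = ∑ i, nsq (A i) := by
  rw [trace, Complex.re_sum]
  refine Finset.sum_congr rfl fun i _ => ?_
  rw [← Complex.ofReal_re (nsq (A i)), nsq_eq, diag_apply, mul_apply, dotProduct]
  congr 1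
  exact Finset.sum_congr rfl fun j _ => by simp [mul_comm]

lemma nsq_row_le (A : Matrix (Fin n) (Fin n) ℂ) (i : Fin n) :
    nsq (A i) ≤ (A * Aᴴ).trace.re := by
  rw [trace_mul_conjTranspose_re]
  exact Finset.single_le_sum (f := fun i => nsq (A i)) (fun _ _ => nsq_nonneg _)
    (Finset.mem_univ i)

lemma IsStarGroup.isCompact_energy_le {G : Set (Matrix (Fin n) (Fin n) ℂ)}
    (hG : IsStarGroup G) (R : ℝ) :
    IsCompact {q : Matrix (Fin n) (Fin n) ℂ × Matrix (Fin n) (Fin n) ℂ |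
      q.1 ∈ G ∧ q.1 * q.2 = 1 ∧ energy q ≤ R} := by
  obtain ⟨C, hC, hGC⟩ := hG.zclosed.exists_isClosed
  have heq : {q : Matrix (Fin n) (Fin n) ℂ × Matrix (Fin n) (Fin n) ℂ |
      q.1 ∈ G ∧ q.1 * q.2 = 1 ∧ energy q ≤ R} = {q | q.1 ∈ C ∧ q.1 * q.2 = 1 ∧ energy q ≤ R} := by
    ext q
    rw [hGC]
    exact ⟨fun h => ⟨h.1.2, h.2⟩, fun h => ⟨⟨IsUnit.of_mul_eq_one _ h.2.1, h.1⟩, h.2⟩⟩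
  have hcl : IsClosed {q : Matrix (Fin n) (Fin n) ℂ × Matrix (Fin n) (Fin n) ℂ |
      q.1 ∈ C ∧ q.1 * q.2 = 1 ∧ energy q ≤ R} := by
    have h1 : IsClosed {q : Matrix (Fin n) (Fin n) ℂ × Matrix (Fin n) (Fin n) ℂ | q.1 ∈ C} :=
      hC.preimage continuous_fst
    have h2 : IsClosed {q : Matrix (Fin n) (Fin n) ℂ × Matrix (Fin n) (Fin n) ℂ |
        q.1 * q.2 = 1} := isClosed_eq (by fun_prop) continuous_const
    exact h1.inter (h2.inter (isClosed_le continuous_energy continuous_const))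
  have hbox : IsCompact ({k : Matrix (Fin n) (Fin n) ℂ | ∀ i, k i ∈ {v : Fin n → ℂ | nsq v ≤ R}}) :=
    isCompact_pi_infinite fun _ => isCompact_nsq_le _
  rw [heq]
  have hnn : ∀ A : Matrix (Fin n) (Fin n) ℂ, 0 ≤ (A * Aᴴ).trace.re := fun A => by
    rw [trace_mul_conjTranspose_re]
    exact Finset.sum_nonneg fun _ _ => nsq_nonneg _
  refine (hbox.prod hbox).of_isClosed_subset hcl fun q hq => ?_
  have hq3 := hq.2.2
  rw [energy, Matrix.trace_mul_comm] at hq3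
  exact ⟨fun i => (nsq_row_le q.1 i).trans (by linarith [hnn q.2]),
    fun i => (nsq_row_le q.2 i).trans (by linarith [hnn q.1])⟩

lemma IsStarGroup.exists_min_energy {G : Set (Matrix (Fin n) (Fin n) ℂ)}
    (hG : IsStarGroup G) {x y : Fin n → ℂ} (h : ∃ g ∈ G, g *ᵥ x = y) :
    ∃ g ∈ G, g *ᵥ x = y ∧ ∀ g' ∈ G, g' *ᵥ x = y → energy (g, g⁻¹) ≤ energy (g', g'⁻¹) := by
  obtain ⟨g₀, hg₀, hgx⟩ := h
  have hc : IsCompact ({q : Matrix (Fin n) (Fin n) ℂ × Matrix (Fin n) (Fin n) ℂ |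
      q.1 ∈ G ∧ q.1 * q.2 = 1 ∧ energy q ≤ energy (g₀, g₀⁻¹)} ∩ {q | q.1 *ᵥ x = y}) := by
    refine (hG.isCompact_energy_le _).inter_right (isClosed_eq ?_ continuous_const)
    fun_prop
  obtain ⟨⟨g, g'⟩, ⟨⟨h1, h2, h3⟩, h4⟩, hm⟩ := hc.exists_isMinOn
    ⟨(g₀, g₀⁻¹), ⟨hg₀, hG.sub.mul_inv hg₀, le_rfl⟩, hgx⟩ continuous_energy.continuousOn
  have hg' : g' = g⁻¹ := (Matrix.inv_eq_right_inv h2).symm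
  subst hg'
  refine ⟨g, h1, h4, fun k hk hkx => ?_⟩
  by_cases hle : energy (k, k⁻¹) ≤ energy (g₀, g₀⁻¹)
  · exact hm ⟨⟨hk, hG.sub.mul_inv hk, hle⟩, hkx⟩
  · exact h3.trans (not_le.1 hle).le

lemma IsStarGroup.eventually_energy {G : Set (Matrix (Fin n) (Fin n) ℂ)}
    (hG : IsStarGroup G) {x w : Fin n → ℂ} {y : ℕ → Fin n → ℂ} (hy : Tendsto y atTop (𝓝 w))
    (hxw : ∀ g ∈ G, g *ᵥ x ≠ w) (R : ℝ) :
    ∀ᶠ m in atTop, ∀ g ∈ G, g *ᵥ x = y m → R < energy (g, g⁻¹) := by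
  by_contra hcon
  have hfr := not_eventually.1 hcon
  push Not at hfr
  have hne : (atTop ⊓ 𝓟 {m | ∃ g ∈ G, g *ᵥ x = y m ∧ energy (g, g⁻¹) ≤ R}).NeBot :=
    frequently_mem_iff_neBot.1 hfr
  set F := Ultrafilter.of (atTop ⊓ 𝓟 {m | ∃ g ∈ G, g *ᵥ x = y m ∧ energy (g, g⁻¹) ≤ R})
  have hF := Ultrafilter.of_le (atTop ⊓ 𝓟 {m | ∃ g ∈ G, g *ᵥ x = y m ∧ energy (g, g⁻¹) ≤ R})
  have h1 : ∀ᶠ m in F, ∃ g, g ∈ G ∧ g *ᵥ x = y m ∧ energy (g, g⁻¹) ≤ R :=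
    le_principal_iff.1 (hF.trans inf_le_right)
  obtain ⟨g, hg⟩ := h1.choice
  obtain ⟨⟨a, b⟩, ⟨ha, -, -⟩, hab⟩ := exists_tendsto_ultrafilter F (hG.isCompact_energy_le R)
    (u := fun m => (g m, (g m)⁻¹)) (hg.mono fun m hm => ⟨hm.1, hG.sub.mul_inv hm.1, hm.2.2⟩)
  apply hxw a ha
  have h2 : Tendsto (fun m => g m) F (𝓝 a) := (continuous_fst.tendsto _).comp hab
  have h3 : Tendsto (fun m => g m *ᵥ x) F (𝓝 (a *ᵥ x)) :=
    (Continuous.tendsto (f := fun A : Matrix (Fin n) (Fin n) ℂ => A *ᵥ x) (by fun_prop) a).comp h2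
  exact tendsto_nhds_unique (h3.congr' (hg.mono fun m hm => hm.2.1))
    (hy.mono_left (hF.trans inf_le_left))

lemma energy_mul_expDiag {g : Matrix (Fin n) (Fin n) ℂ} {U V : Matrix (Fin n) (Fin n) ℂ}
    (hU : Uᴴ * U = 1) (hV : Vᴴ * V = 1) {k : Matrix (Fin n) (Fin n) ℂ} (hk : kᴴ * k = 1)
    {s : Fin n → ℝ} (hg : g = k * expDiag V (fun j => (s j : ℂ))) (b : Fin n → ℝ) :
    energy (g * expDiag U (fun j => (b j : ℂ)), (g * expDiag U (fun j => (b j : ℂ)))⁻¹) =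
      ∑ j, (∑ l, Complex.normSq ((Uᴴ * V) j l) * Real.exp (2 * s l)) * Real.exp (2 * b j) +
      ∑ j, (∑ l, Complex.normSq ((Uᴴ * V) j l) * Real.exp (-(2 * s l))) *
        Real.exp (-(2 * b j)) := by
  have hkinv : k⁻¹ = kᴴ := Matrix.inv_eq_left_inv hk
  have hst : ∀ (W : Matrix (Fin n) (Fin n) ℂ) (c : Fin n → ℝ),
      (expDiag W (fun j => (c j : ℂ)))ᴴ = expDiag W (fun j => (c j : ℂ)) := fun W c => by
    rw [expDiag_conjTranspose]
    congr 1
    funext j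
    simp
  have hmul : ∀ {W : Matrix (Fin n) (Fin n) ℂ}, Wᴴ * W = 1 → ∀ c : Fin n → ℂ,
      expDiag W c * expDiag W c = expDiag W (fun j => 2 * c j) := fun hW c => by
    rw [expDiag_mul hW]
    congr 1
    funext j
    simp [two_mul]
  have hgen : ∀ c d : Fin n → ℂ, (expDiag U c * (expDiag V d * expDiag V d) * expDiag U c).trace =
      ∑ j, (∑ l, (Complex.normSq ((Uᴴ * V) j l) : ℂ) * Complex.exp (2 * d l)) *
        Complex.exp (2 * c j) := by
    intro c d
    rw [Matrix.trace_mul_comm, ← Matrix.mul_assoc, hmul hU, Matrix.trace_mul_comm, hmul hV,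
      trace_mul_expDiag]
    simp only [sum_diag_expDiag]
  have hre : ∀ c d : Fin n → ℝ, (∑ j, (∑ l, (Complex.normSq ((Uᴴ * V) j l) : ℂ) *
      Complex.exp (2 * (d l : ℂ))) * Complex.exp (2 * (c j : ℂ))).re =
      ∑ j, (∑ l, Complex.normSq ((Uᴴ * V) j l) * Real.exp (2 * d l)) * Real.exp (2 * c j) := by
    intro c d
    rw [← Complex.ofReal_re (∑ j, (∑ l, Complex.normSq ((Uᴴ * V) j l) * Real.exp (2 * d l)) *
      Real.exp (2 * c j))]
    push_cast
    rfl
  have e1 : (g * expDiag U (fun j => (b j : ℂ)))ᴴ * (g * expDiag U (fun j => (b j : ℂ))) =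
      expDiag U (fun j => (b j : ℂ)) * (expDiag V (fun j => (s j : ℂ)) * expDiag V (fun j => (s j : ℂ))) *
        expDiag U (fun j => (b j : ℂ)) := by
    rw [conjTranspose_mul, hst, hg, conjTranspose_mul, hst]
    calc _ = expDiag U (fun j => (b j : ℂ)) * (expDiag V (fun j => (s j : ℂ)) * (kᴴ * k) *
          expDiag V (fun j => (s j : ℂ))) * expDiag U (fun j => (b j : ℂ)) := by
          simp only [Matrix.mul_assoc]
      _ = _ := by rw [hk, Matrix.mul_one]
  have hneg : ∀ {W : Matrix (Fin n) (Fin n) ℂ}, Wᴴ * W = 1 → ∀ c : Fin n → ℝ,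
      (expDiag W (fun j => (c j : ℂ)))⁻¹ = expDiag W (fun j => ((-c j : ℝ) : ℂ)) := fun hW c => by
    rw [expDiag_inv hW]
    congr 1
    funext j
    simp
  have e2 : (g * expDiag U (fun j => (b j : ℂ)))⁻¹ * ((g * expDiag U (fun j => (b j : ℂ)))⁻¹)ᴴ =
      expDiag U (fun j => ((-b j : ℝ) : ℂ)) * (expDiag V (fun j => ((-s j : ℝ) : ℂ)) *
        expDiag V (fun j => ((-s j : ℝ) : ℂ))) * expDiag U (fun j => ((-b j : ℝ) : ℂ)) := by
    rw [Matrix.mul_inv_rev, hneg hU, hg, Matrix.mul_inv_rev, hneg hV, hkinv, conjTranspose_mul,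
      hst, conjTranspose_mul, hst, conjTranspose_conjTranspose]
    calc _ = expDiag U (fun j => ((-b j : ℝ) : ℂ)) * (expDiag V (fun j => ((-s j : ℝ) : ℂ)) * (kᴴ * k) *
          expDiag V (fun j => ((-s j : ℝ) : ℂ))) * expDiag U (fun j => ((-b j : ℝ) : ℂ)) := by
          simp only [Matrix.mul_assoc]
      _ = _ := by rw [hk, Matrix.mul_one]
  rw [energy, e1, e2, hgen, hgen, hre, hre]
  simp only [mul_neg]

end Escape

section Core
open Matrix Filter Topology

variable {n : ℕ}

lemma tendsto_nsq_mulVec {ι : Type*} {F : Filter ι} {A : ι → Matrix (Fin n) (Fin n) ℂ}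
    {B : Matrix (Fin n) (Fin n) ℂ} {x : ι → Fin n → ℂ} {w : Fin n → ℂ}
    (hA : Tendsto A F (𝓝 B)) (hx : Tendsto x F (𝓝 w)) :
    Tendsto (fun i => nsq (A i *ᵥ x i)) F (𝓝 (nsq (B *ᵥ w))) := by
  refine (continuous_nsq.tendsto (B *ᵥ w)).comp (tendsto_pi_nhds.2 fun k => ?_)
  simp only [mulVec, dotProduct]
  exact tendsto_finsetSum _ fun j _ =>
    (tendsto_pi_nhds.1 (tendsto_pi_nhds.1 hA k) j).mul (tendsto_pi_nhds.1 hx j)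

lemma nsq_expDiag_smul_le {U : Matrix (Fin n) (Fin n) ℂ} (hU : Uᴴ * U = 1) (s : Fin n → ℝ)
    (x : Fin n → ℂ) {τ : ℝ} (h0 : 0 ≤ τ) (h1 : τ ≤ 1) :
    nsq (expDiag U (fun j => ((τ * s j : ℝ) : ℂ)) *ᵥ x) ≤
      max (nsq x) (nsq (expDiag U (fun j => (s j : ℂ)) *ᵥ x)) := by
  have hx0 : nsq x = ∑ j, Real.exp (2 * 0) * Complex.normSq ((Uᴴ *ᵥ x) j) := by
    rw [← nsq_mulVec (U := Uᴴ) (by rw [conjTranspose_conjTranspose]; exact mul_eq_one_comm.1 hU)]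
    simp [nsq]
  have hle : nsq (expDiag U (fun j => ((τ * s j : ℝ) : ℂ)) *ᵥ x) ≤
      (1 - τ) * nsq x + τ * nsq (expDiag U (fun j => (s j : ℂ)) *ᵥ x) := by
    rw [hx0, nsq_expDiag_ofReal hU (fun j => τ * s j), nsq_expDiag_ofReal hU, Finset.mul_sum,
      Finset.mul_sum, ← Finset.sum_add_distrib]
    refine Finset.sum_le_sum fun j _ => ?_
    have h2 := convexOn_exp.2 (Set.mem_univ 0) (Set.mem_univ (2 * s j)) (sub_nonneg.2 h1) h0
      (by ring)
    simp only [smul_eq_mul, mul_zero, zero_add] at h2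
    rw [show 2 * (τ * s j) = τ * (2 * s j) by ring]
    calc _ ≤ ((1 - τ) * Real.exp 0 + τ * Real.exp (2 * s j)) * Complex.normSq ((Uᴴ *ᵥ x) j) :=
          mul_le_mul_of_nonneg_right h2 (Complex.normSq_nonneg _)
      _ = _ := by simp only [mul_zero]; ring
  refine hle.trans ?_
  have h3 := mul_le_mul_of_nonneg_left (le_max_left (nsq x)
    (nsq (expDiag U (fun j => (s j : ℂ)) *ᵥ x))) (sub_nonneg.2 h1)
  have h4 := mul_le_mul_of_nonneg_left (le_max_right (nsq x)
    (nsq (expDiag U (fun j => (s j : ℂ)) *ᵥ x))) h0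
  linarith

lemma sum_sinh_eq_zero_of_le {A B a : Fin n → ℝ}
    (h : ∀ t : ℝ, ∑ j, A j + ∑ j, B j ≤
      ∑ j, A j * Real.exp (2 * (t * a j)) + ∑ j, B j * Real.exp (-(2 * (t * a j)))) :
    ∑ j, (A j - B j) * a j = 0 := by
  have h1 : ∀ j, HasDerivAt (fun t : ℝ => A j * Real.exp (2 * (t * a j)) +
      B j * Real.exp (-(2 * (t * a j)))) (2 * ((A j - B j) * a j)) 0 := by
    intro j
    have e1 : HasDerivAt (fun t : ℝ => 2 * (t * a j)) (2 * a j) 0 := by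
      simpa using ((hasDerivAt_id (0 : ℝ)).mul_const (a j)).const_mul 2
    refine ((e1.exp.const_mul (A j)).add (e1.neg.exp.const_mul (B j))).congr_deriv ?_
    simp
    ring
  have h2 := HasDerivAt.fun_sum fun j (_ : j ∈ Finset.univ) => h1 j
  have h3 : IsLocalMin (fun t : ℝ => ∑ j, (A j * Real.exp (2 * (t * a j)) +
      B j * Real.exp (-(2 * (t * a j))))) 0 := by
    refine Eventually.of_forall fun t => ?_
    simpa [Finset.sum_add_distrib] using h t
  have h4 := h3.hasDerivAt_eq_zero h2
  rw [← Finset.mul_sum] at h4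
  linarith

/-- Far-away points of an orbit are joined by a group element of minimal energy, which is
critical with respect to one-parameter subgroups fixing the source. -/
lemma IsStarGroup.exists_critical {G : Set (Matrix (Fin n) (Fin n) ℂ)}
    (hG : IsStarGroup G) {x y : Fin n → ℂ} (h : ∃ g ∈ G, g *ᵥ x = y) {r : ℝ}
    (hr : ∀ g ∈ G, g *ᵥ x = y → 2 * n * Real.exp (2 * r) < energy (g, g⁻¹)) :
    ∃ (U : Matrix (Fin n) (Fin n) ℂ) (s : Fin n → ℝ), Uᴴ * U = 1 ∧ r < ‖s‖ ∧
      (∀ t : ℂ, expDiag U (t • fun j => (s j : ℂ)) ∈ G) ∧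
      nsq (expDiag U (fun j => (s j : ℂ)) *ᵥ x) = nsq y ∧
      ∀ (V : Matrix (Fin n) (Fin n) ℂ) (a : Fin n → ℝ), Vᴴ * V = 1 →
        (∀ t : ℝ, expDiag V (fun j => ((t * a j : ℝ) : ℂ)) ∈ G ∧
          expDiag V (fun j => ((t * a j : ℝ) : ℂ)) *ᵥ x = x) →
        ∑ j, (∑ l, Complex.normSq ((Vᴴ * U) j l) * Real.sinh (2 * s l)) * a j = 0 := by
  obtain ⟨g, hg, hgx, hmin⟩ := hG.exists_min_energy h
  obtain ⟨k, U, s, hkG, hk, hU, hs, hgk⟩ := hG.polar hg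
  have hen : ∀ {V : Matrix (Fin n) (Fin n) ℂ} (_ : Vᴴ * V = 1), energy (g, g⁻¹) =
      ∑ j, (∑ l, Complex.normSq ((Vᴴ * U) j l) * Real.exp (2 * s l)) +
      ∑ j, (∑ l, Complex.normSq ((Vᴴ * U) j l) * Real.exp (-(2 * s l))) := by
    intro V hV
    have h1 := energy_mul_expDiag hV hU hk hgk (fun _ => 0)
    have h0 : expDiag V (fun _ => ((0 : ℝ) : ℂ)) = 1 := by
      rw [← expDiag_zero hV]
      congr 1
    rw [h0, Matrix.mul_one] at h1
    simpa using h1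
  refine ⟨U, s, hU, ?_, hs, ?_, fun V a hV hVa => ?_⟩
  · by_contra hle
    rw [not_lt] at hle
    refine absurd (hr g hg hgx) (not_lt.2 ?_)
    have h2 : ∀ j, |s j| ≤ r := fun j => (norm_le_pi_norm s j).trans hle
    rw [hen hU, hU, ← Finset.sum_add_distrib]
    calc _ ≤ ∑ j : Fin n, 2 * Real.exp (2 * r) := by
          refine Finset.sum_le_sum fun j _ => ?_
          rw [Finset.sum_eq_single j (by intro b _ hb; simp [Matrix.one_apply_ne' hb]) (by simp),
            Finset.sum_eq_single j (by intro b _ hb; simp [Matrix.one_apply_ne' hb]) (by simp)]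
          have e1 : Real.exp (2 * s j) ≤ Real.exp (2 * r) :=
            Real.exp_le_exp.2 (by linarith [(abs_le.1 (h2 j)).2])
          have e2 : Real.exp (-(2 * s j)) ≤ Real.exp (2 * r) :=
            Real.exp_le_exp.2 (by linarith [(abs_le.1 (h2 j)).1])
          simp only [Matrix.one_apply_eq, Complex.normSq_one, one_mul]
          linarith
      _ = _ := by simp; ring
  · rw [← hgx, hgk, ← mulVec_mulVec, nsq_mulVec hk]
  · have h3 := sum_sinh_eq_zero_of_le (a := a)
      (A := fun j => ∑ l, Complex.normSq ((Vᴴ * U) j l) * Real.exp (2 * s l))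
      (B := fun j => ∑ l, Complex.normSq ((Vᴴ * U) j l) * Real.exp (-(2 * s l))) fun t => by
        rw [← hen hV, ← energy_mul_expDiag hV hU hk hgk (fun j => t * a j)]
        refine hmin _ (hG.sub.2.1 _ hg _ (hVa t).1) ?_
        rw [← mulVec_mulVec, (hVa t).2, hgx]
    have h4 : ∀ j, (∑ l, Complex.normSq ((Vᴴ * U) j l) * Real.exp (2 * s l)) -
        ∑ l, Complex.normSq ((Vᴴ * U) j l) * Real.exp (-(2 * s l)) =
        2 * ∑ l, Complex.normSq ((Vᴴ * U) j l) * Real.sinh (2 * s l) := by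
      intro j
      rw [← Finset.sum_sub_distrib, Finset.mul_sum]
      refine Finset.sum_congr rfl fun l _ => ?_
      rw [Real.sinh_eq]
      ring
    simp only [h4, mul_assoc] at h3
    rw [← Finset.mul_sum] at h3
    simpa using h3

lemma IsStarGroup.false_of_escape {G : Set (Matrix (Fin n) (Fin n) ℂ)}
    (hG : IsStarGroup G) {w : Fin n → ℂ} (hw : IsMinVec G w) {x : ℕ → Fin n → ℂ} {m : ℕ → ℕ}
    (hm : Tendsto m atTop atTop) (hxw : Tendsto x atTop (𝓝 w))
    (hfix : ∀ (i : ℕ) (V : Matrix (Fin n) (Fin n) ℂ) (a : Fin n → ℝ), Vᴴ * V = 1 →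
      (∀ t : ℝ, expDiag V (fun j => ((t * a j : ℝ) : ℂ)) ∈ G ∧
          expDiag V (fun j => ((t * a j : ℝ) : ℂ)) *ᵥ w = w) → ∀ t : ℝ,
      expDiag V (fun j => ((t * a j : ℝ) : ℂ)) *ᵥ x i = x i)
    (horb : ∀ i, ∃ g ∈ G, g *ᵥ x i = x (m i))
    (hesc : ∀ i, ∀ g ∈ G, g *ᵥ x i = x (m i) →
      2 * n * Real.exp (2 * (i + 1 : ℝ)) < energy (g, g⁻¹)) : False := by
  choose U s hU hr hs hns hcr using fun i : ℕ => hG.exists_critical (horb i) (hesc i)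
  have hrp : ∀ i, 1 < ‖s i‖ := fun i => lt_of_le_of_lt (by simp) (hr i)
  have hr0 : ∀ i, 0 < ‖s i‖ := fun i => one_pos.trans (hrp i)
  have hsh : ∀ i, 0 < Real.sinh (2 * ‖s i‖) := fun i => Real.sinh_pos_iff.2 (by linarith [hr0 i])
  have hsl : ∀ i l, |s i l| ≤ ‖s i‖ := fun i l => norm_le_pi_norm (s i) l
  set F : Ultrafilter ℕ := hyperfilter ℕ
  have hF : (F : Filter ℕ) ≤ atTop := Nat.hyperfilter_le_atTop
  obtain ⟨V, hV, hUV⟩ := exists_tendsto_ultrafilter F isCompact_unitary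
    (u := U) (Eventually.of_forall hU)
  obtain ⟨a, -, ha⟩ := exists_tendsto_ultrafilter F (isCompact_closedBall (0 : Fin n → ℝ) 1)
    (u := fun i l => ‖s i‖⁻¹ * s i l) (Eventually.of_forall fun i => by
      rw [mem_closedBall_zero_iff, pi_norm_le_iff_of_nonneg zero_le_one]
      intro l
      rw [norm_mul, norm_inv, norm_norm, inv_mul_le_iff₀ (hr0 i), mul_one]
      exact hsl i l)
  obtain ⟨u, -, hu⟩ := exists_tendsto_ultrafilter F (isCompact_closedBall (0 : Fin n → ℝ) 1)
    (u := fun i l => (Real.sinh (2 * ‖s i‖))⁻¹ * Real.sinh (2 * s i l))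
    (Eventually.of_forall fun i => by
      rw [mem_closedBall_zero_iff, pi_norm_le_iff_of_nonneg zero_le_one]
      intro l
      rw [norm_mul, norm_inv, Real.norm_of_nonneg (hsh i).le, inv_mul_le_iff₀ (hsh i), mul_one,
        Real.norm_eq_abs, Real.abs_sinh, Real.sinh_le_sinh, abs_mul, abs_two]
      linarith [hsl i l])
  have ha' := tendsto_pi_nhds.1 ha
  have hu' := tendsto_pi_nhds.1 hu
  have hV1 : V * Vᴴ = 1 := mul_eq_one_comm.1 hV
  have hlim : ∀ t : ℂ, Tendsto (fun i => expDiag (U i) ((t / ‖s i‖) • fun j => (s i j : ℂ))) F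
      (𝓝 (expDiag V (t • fun j => (a j : ℂ)))) := by
    intro t
    refine tendsto_expDiag hUV fun j => ?_
    have h1 : Tendsto (fun i => t * ((‖s i‖⁻¹ * s i j : ℝ) : ℂ)) F (𝓝 (t * (a j : ℂ))) :=
      ((Complex.continuous_ofReal.tendsto _).comp (ha' j)).const_mul t
    refine h1.congr fun i => ?_
    simp only [Pi.smul_apply, smul_eq_mul]
    push_cast
    rw [div_eq_mul_inv, mul_assoc]
  have hVG : ∀ t : ℂ, expDiag V (t • fun j => (a j : ℂ)) ∈ G := fun t =>
    hG.zclosed.mem_of_tendsto (hlim t) (fun i => hs i _) (expDiag_isUnit hV _)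
  have hle : nsq (expDiag V (fun j => (a j : ℂ)) *ᵥ w) ≤ nsq w := by
    have h1 : Tendsto (fun i => nsq (expDiag (U i) (fun j => ((‖s i‖⁻¹ * s i j : ℝ) : ℂ)) *ᵥ x i)) F
        (𝓝 (nsq (expDiag V (fun j => (a j : ℂ)) *ᵥ w))) := by
      refine tendsto_nsq_mulVec (tendsto_expDiag hUV fun j => ?_) (hxw.mono_left hF)
      exact (Complex.continuous_ofReal.tendsto _).comp (ha' j)
    have h3 : Tendsto (fun i => max (nsq (x i)) (nsq (x (m i)))) F (𝓝 (max (nsq w) (nsq w))) :=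
      ((continuous_nsq.tendsto w).comp (hxw.mono_left hF)).max
        ((continuous_nsq.tendsto w).comp (hxw.comp (hm.mono_left hF)))
    rw [max_self] at h3
    refine le_of_tendsto_of_tendsto' h1 h3 fun i => ?_
    have h4 := nsq_expDiag_smul_le (hU i) (s i) (x i) (τ := ‖s i‖⁻¹) (inv_nonneg.2 (hr0 i).le)
      (inv_le_one_of_one_le₀ (hrp i).le)
    rwa [hns i] at h4
  have hz := hw.eq_zero_of_le hV hVG hle
  have hfixw : ∀ t : ℝ, expDiag V (fun j => ((t * a j : ℝ) : ℂ)) ∈ G ∧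
      expDiag V (fun j => ((t * a j : ℝ) : ℂ)) *ᵥ w = w := by
    intro t
    have he : (fun j => ((t * a j : ℝ) : ℂ)) = (t : ℂ) • fun j => (a j : ℂ) :=
      funext fun j => Complex.ofReal_mul t (a j)
    have hz' : ∀ j, (fun j => (a j : ℂ)) j = 0 ∨ (Vᴴ *ᵥ w) j = 0 := fun j =>
      (hz j).imp (fun h => Complex.ofReal_eq_zero.2 h) id
    have h1 := expDiag_smul_mulVec_eq hV hz' t
    have h2 := hVG t
    rw [← he] at h1 h2
    exact ⟨h2, h1⟩
  have hsum : ∀ i, ∑ j, (∑ l, Complex.normSq ((Vᴴ * U i) j l) *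
      ((Real.sinh (2 * ‖s i‖))⁻¹ * Real.sinh (2 * s i l))) * a j = 0 := by
    intro i
    have h1 := hcr i V a hV fun t => ⟨(hfixw t).1, hfix i V a hV hfixw t⟩
    have h2 := congrArg (fun z => (Real.sinh (2 * ‖s i‖))⁻¹ * z) h1
    simp only [mul_zero, Finset.mul_sum, Finset.sum_mul] at h2
    rw [← h2]
    refine Finset.sum_congr rfl fun j _ => ?_
    rw [Finset.sum_mul]
    exact Finset.sum_congr rfl fun l _ => by ring
  have hW : Tendsto (fun i => Vᴴ * U i) F (𝓝 1) := by
    have h1 := (Continuous.tendsto (f := fun A : Matrix (Fin n) (Fin n) ℂ => Vᴴ * A)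
      (by fun_prop) V).comp hUV
    rwa [hV] at h1
  have hlim0 : ∑ j, u j * a j = 0 := by
    have h1 : Tendsto (fun i => ∑ j, (∑ l, Complex.normSq ((Vᴴ * U i) j l) *
        ((Real.sinh (2 * ‖s i‖))⁻¹ * Real.sinh (2 * s i l))) * a j) F
        (𝓝 (∑ j, (∑ l, Complex.normSq ((1 : Matrix (Fin n) (Fin n) ℂ) j l) * u l) * a j)) := by
      refine tendsto_finsetSum _ fun j _ => Tendsto.mul_const _ (tendsto_finsetSum _ fun l _ =>
        Tendsto.mul ?_ (hu' l))
      exact (Complex.continuous_normSq.tendsto _).comp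
        (tendsto_pi_nhds.1 (tendsto_pi_nhds.1 hW j) l)
    simp only [hsum] at h1
    have h2 := tendsto_nhds_unique h1 tendsto_const_nhds
    rw [← h2]
    refine Finset.sum_congr rfl fun j _ => ?_
    rw [Finset.sum_eq_single j (by intro b _ hb; simp [Matrix.one_apply_ne' hb]) (by simp)]
    simp
  have hge : 1 ≤ ∑ j, u j * a j := by
    have h1 : Tendsto (fun i => ∑ j, ((Real.sinh (2 * ‖s i‖))⁻¹ * Real.sinh (2 * s i j)) *
        (‖s i‖⁻¹ * s i j)) F (𝓝 (∑ j, u j * a j)) :=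
      tendsto_finsetSum _ fun j _ => (hu' j).mul (ha' j)
    refine ge_of_tendsto' h1 fun i => ?_
    have hnn : ∀ b : ℝ, 0 ≤ Real.sinh (2 * b) * b := by
      intro b
      rcases le_total 0 b with hb | hb
      · exact mul_nonneg (Real.sinh_nonneg_iff.2 (by linarith)) hb
      · exact mul_nonneg_of_nonpos_of_nonpos (Real.sinh_nonpos_iff.2 (by linarith)) hb
    have hpos : ∀ j, 0 ≤ ((Real.sinh (2 * ‖s i‖))⁻¹ * Real.sinh (2 * s i j)) *
        (‖s i‖⁻¹ * s i j) := fun j => by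
      rw [mul_mul_mul_comm]
      exact mul_nonneg (mul_nonneg (inv_nonneg.2 (hsh i).le) (inv_nonneg.2 (hr0 i).le)) (hnn _)
    obtain ⟨l, hl⟩ : ∃ l, |s i l| = ‖s i‖ := by
      by_contra hcon
      push Not at hcon
      have := (pi_norm_lt_iff (hr0 i)).2 fun l => lt_of_le_of_ne (norm_le_pi_norm (s i) l) (hcon l)
      exact lt_irrefl _ this
    refine le_trans (le_of_eq ?_) (Finset.single_le_sum (fun j _ => hpos j) (Finset.mem_univ l))
    have h2 : Real.sinh (2 * s i l) * s i l = Real.sinh (2 * ‖s i‖) * ‖s i‖ := by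
      rw [← hl]
      rcases abs_choice (s i l) with h | h
      · rw [h]
      · rw [h, mul_neg, mul_neg, Real.sinh_neg, neg_mul, neg_neg]
    rw [mul_mul_mul_comm, h2, mul_mul_mul_comm, inv_mul_cancel₀ (hsh i).ne',
      inv_mul_cancel₀ (hr0 i).ne', one_mul]
  linarith

/-- A point `w` is quietly approached by the orbit of `u` if it is a limit of points of that
orbit which are fixed by every continuous path from `1` in the isotropy group of `w`. -/
def QuietLimit (G : Set (Matrix (Fin n) (Fin n) ℂ)) (w u : Fin n → ℂ) : Prop :=
  ∃ x : ℕ → Fin n → ℂ, (∀ i, x i ∈ orbit ℂ n G u) ∧ Tendsto x atTop (𝓝 w) ∧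
    ∀ γ : ℝ → Matrix (Fin n) (Fin n) ℂ, Continuous γ → γ 0 = 1 →
      (∀ t, γ t ∈ isotropy ℂ n G w) → ∀ t i, γ t *ᵥ x i = x i

lemma IsStarGroup.mem_orbit_of_quietLimit {G : Set (Matrix (Fin n) (Fin n) ℂ)}
    (hG : IsStarGroup G) {w u : Fin n → ℂ} (hw : IsMinVec G w) (h : QuietLimit G w u) :
    w ∈ orbit ℂ n G u := by
  obtain ⟨x, hxu, hxw, hfix⟩ := h
  by_contra hcon
  have hnot : ∀ i, ∀ g ∈ G, g *ᵥ x i ≠ w := by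
    intro i g hg hgw
    obtain ⟨g', hg', hgx⟩ := hxu i
    refine hcon ⟨g * g', hG.sub.2.1 _ hg _ hg', ?_⟩
    rw [← hgw, ← hgx]
    simp
  have hex : ∀ i : ℕ, ∃ m ≥ i, ∀ g ∈ G, g *ᵥ x i = x m →
      2 * n * Real.exp (2 * (i + 1 : ℝ)) < energy (g, g⁻¹) := fun i =>
    let ⟨m, h1, h2⟩ := ((hG.eventually_energy hxw (hnot i)
      (2 * n * Real.exp (2 * (i + 1 : ℝ)))).and (eventually_ge_atTop i)).exists
    ⟨m, h2, h1⟩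
  choose m hmi hm using hex
  refine hG.false_of_escape hw (tendsto_atTop_mono hmi tendsto_id) hxw
    (fun i V a hV hVa t => ?_) (fun i => ?_) hm
  · refine hfix (fun t => expDiag V (fun j => ((t * a j : ℝ) : ℂ))) ?_ ?_ hVa t i
    · rw [continuous_iff_continuousAt]
      intro t₀
      refine tendsto_expDiag tendsto_const_nhds fun j => ?_
      exact Continuous.tendsto (f := fun t : ℝ => ((t * a j : ℝ) : ℂ)) (by fun_prop) t₀
    · rw [← expDiag_zero hV]
      congr 1
      ext
      simp
  · obtain ⟨g, hg, hgx⟩ := hxu i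
    obtain ⟨g', hg', hgx'⟩ := hxu (m i)
    refine ⟨g' * g⁻¹, hG.sub.2.1 _ hg' _ (hG.sub.2.2 _ hg).2, ?_⟩
    rw [← hgx, ← hgx']
    simp only [mulVec_mulVec, Matrix.mul_assoc, hG.sub.inv_mul hg, Matrix.mul_one]

end Core

section Transport
open Matrix Filter Topology

variable {n : ℕ}

/-- The group `B G B⁻¹`. -/
def conjSet (B : Matrix (Fin n) (Fin n) ℂ) (G : Set (Matrix (Fin n) (Fin n) ℂ)) :
    Set (Matrix (Fin n) (Fin n) ℂ) :=
  (fun g => B * g * B⁻¹) '' G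

lemma inv_mul_of_isUnit {B : Matrix (Fin n) (Fin n) ℂ} (hB : IsUnit B) : B⁻¹ * B = 1 :=
  nonsing_inv_mul B ((isUnit_iff_isUnit_det B).1 hB)

lemma mul_inv_of_isUnit {B : Matrix (Fin n) (Fin n) ℂ} (hB : IsUnit B) : B * B⁻¹ = 1 :=
  mul_nonsing_inv B ((isUnit_iff_isUnit_det B).1 hB)

lemma mem_conjSet {B : Matrix (Fin n) (Fin n) ℂ} (hB : IsUnit B)
    {G : Set (Matrix (Fin n) (Fin n) ℂ)} {h : Matrix (Fin n) (Fin n) ℂ} :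
    h ∈ conjSet B G ↔ B⁻¹ * h * B ∈ G := by
  have h1 := inv_mul_of_isUnit hB
  have h2 := mul_inv_of_isUnit hB
  constructor
  · rintro ⟨g, hg, rfl⟩
    simpa only [Matrix.mul_assoc, h1, Matrix.mul_one, ← Matrix.mul_assoc B⁻¹ B, Matrix.one_mul]
      using hg
  · intro h
    refine ⟨_, h, ?_⟩
    simp only [Matrix.mul_assoc, h2, Matrix.mul_one]
    rw [← Matrix.mul_assoc, h2, Matrix.one_mul]

lemma IsMatSubgroup.conjSet {B : Matrix (Fin n) (Fin n) ℂ} (hB : IsUnit B)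
    {G : Set (Matrix (Fin n) (Fin n) ℂ)} (hG : IsMatSubgroup ℂ n G) :
    IsMatSubgroup ℂ n (conjSet B G) := by
  have h1 := inv_mul_of_isUnit hB
  have h2 := mul_inv_of_isUnit hB
  have hB' : IsUnit B⁻¹ := IsUnit.of_mul_eq_one _ h1
  refine ⟨(mem_conjSet hB).2 ?_, ?_, ?_⟩
  · rw [Matrix.mul_one, h1]
    exact hG.1
  · rintro _ ⟨a, ha, rfl⟩ _ ⟨b, hb, rfl⟩
    refine ⟨a * b, hG.2.1 _ ha _ hb, ?_⟩
    simp only [Matrix.mul_assoc]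
    rw [← Matrix.mul_assoc B⁻¹ B, h1, Matrix.one_mul]
  · rintro _ ⟨a, ha, rfl⟩
    refine ⟨(hB.mul (hG.2.2 a ha).1).mul hB', a⁻¹, (hG.2.2 a ha).2, ?_⟩
    simp only [Matrix.mul_inv_rev, Matrix.mul_assoc]
    rw [nonsing_inv_nonsing_inv _ ((isUnit_iff_isUnit_det B).1 hB)]

lemma IsZClosedInGL.conjSet {B : Matrix (Fin n) (Fin n) ℂ} (hB : IsUnit B)
    {G : Set (Matrix (Fin n) (Fin n) ℂ)} (hG : IsZClosedInGL ℂ n G) :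
    IsZClosedInGL ℂ n (conjSet B G) := by
  have h1 := inv_mul_of_isUnit hB
  have h2 := mul_inv_of_isUnit hB
  have hB' : IsUnit B⁻¹ := IsUnit.of_mul_eq_one _ h1
  obtain ⟨P, hP⟩ := hG
  choose q hq using fun p : MvPolynomial (Fin n × Fin n) ℂ =>
    (matPoly_eval p).comp (fun i j => matPoly_mul_mul B⁻¹ B i j)
  refine ⟨q '' P, ?_⟩
  ext h
  rw [mem_conjSet hB, hP]
  refine and_congr ⟨fun hu => ?_, fun hu => (hB'.mul hu).mul hB⟩ ?_
  · have := (hB.mul hu).mul hB'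
    simp only [Matrix.mul_assoc, h2, Matrix.mul_one] at this
    rwa [← Matrix.mul_assoc, h2, Matrix.one_mul] at this
  · rw [Set.forall_mem_image]
    refine forall₂_congr fun p _ => ?_
    rw [hq p h]

lemma exists_isStarGroup_conjSet {G : Set (Matrix (Fin n) (Fin n) ℂ)}
    (hG : IsReductiveGroup ℂ n G) :
    ∃ B : Matrix (Fin n) (Fin n) ℂ, IsUnit B ∧ IsStarGroup (conjSet B G) := by
  obtain ⟨B, hB, h⟩ := exists_conj_star_stable hG
  refine ⟨B, hB, hG.1.conjSet hB, hG.2.1.conjSet hB, ?_⟩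
  rintro _ ⟨g, hg, rfl⟩
  obtain ⟨g', hg', he⟩ := h g hg
  exact ⟨g', hg', he.symm⟩

lemma orbit_conjSet {B : Matrix (Fin n) (Fin n) ℂ} (hB : IsUnit B)
    (G : Set (Matrix (Fin n) (Fin n) ℂ)) (v : Fin n → ℂ) :
    orbit ℂ n (conjSet B G) (B *ᵥ v) = (fun x => B *ᵥ x) '' orbit ℂ n G v := by
  rw [orbit, conjSet, orbit, Set.image_image, Set.image_image]
  refine Set.image_congr fun g _ => ?_
  rw [mulVec_mulVec, Matrix.mul_assoc, inv_mul_of_isUnit hB, Matrix.mul_one, mulVec_mulVec]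

lemma isClosed_orbit_conjSet {B : Matrix (Fin n) (Fin n) ℂ} (hB : IsUnit B)
    {G : Set (Matrix (Fin n) (Fin n) ℂ)} {w : Fin n → ℂ} (hw : IsClosed (orbit ℂ n G w)) :
    IsClosed (orbit ℂ n (conjSet B G) (B *ᵥ w)) := by
  have h : orbit ℂ n (conjSet B G) (B *ᵥ w) = (fun x => B⁻¹ *ᵥ x) ⁻¹' orbit ℂ n G w := by
    rw [orbit_conjSet hB]
    refine congrFun (Set.image_eq_preimage_of_inverse (fun x => ?_) (fun x => ?_)) _
    · simp only [mulVec_mulVec, inv_mul_of_isUnit hB, one_mulVec]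
    · simp only [mulVec_mulVec, mul_inv_of_isUnit hB, one_mulVec]
  rw [h]
  exact hw.preimage (by fun_prop)

lemma mem_isotropy_conjSet {B : Matrix (Fin n) (Fin n) ℂ} (hB : IsUnit B)
    {G : Set (Matrix (Fin n) (Fin n) ℂ)} {v : Fin n → ℂ} {h : Matrix (Fin n) (Fin n) ℂ} :
    h ∈ isotropy ℂ n (conjSet B G) (B *ᵥ v) ↔ B⁻¹ * h * B ∈ isotropy ℂ n G v := by
  refine and_congr (mem_conjSet hB) ?_
  rw [← mulVec_mulVec, ← mulVec_mulVec]
  constructor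
  · intro he
    rw [he, mulVec_mulVec, inv_mul_of_isUnit hB, one_mulVec]
  · intro he
    have := congrArg (fun x => B *ᵥ x) he
    simpa only [mulVec_mulVec, ← Matrix.mul_assoc, mul_inv_of_isUnit hB, Matrix.one_mul] using this

lemma QuietLimit.conjSet {B : Matrix (Fin n) (Fin n) ℂ} (hB : IsUnit B)
    {G : Set (Matrix (Fin n) (Fin n) ℂ)} {w u : Fin n → ℂ} (h : QuietLimit G w u) :
    QuietLimit (conjSet B G) (B *ᵥ w) (B *ᵥ u) := by
  obtain ⟨x, hxu, hxw, hfix⟩ := h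
  refine ⟨fun i => B *ᵥ x i, fun i => ?_, ?_, fun γ hγ h0 hmem t i => ?_⟩
  · rw [orbit_conjSet hB]
    exact ⟨_, hxu i, rfl⟩
  · exact (Continuous.tendsto (f := fun v : Fin n → ℂ => B *ᵥ v) (by fun_prop) w).comp hxw
  · have h1 := hfix (fun t => B⁻¹ * γ t * B) (by fun_prop)
      (by simp only [h0, Matrix.mul_one, inv_mul_of_isUnit hB])
      (fun t => (mem_isotropy_conjSet hB).1 (hmem t)) t i
    have := congrArg (fun x => B *ᵥ x) h1
    simpa only [mulVec_mulVec, ← Matrix.mul_assoc, mul_inv_of_isUnit hB, Matrix.one_mul] using this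

lemma conjSet_self {G : Set (Matrix (Fin n) (Fin n) ℂ)} (hG : IsMatSubgroup ℂ n G)
    {g : Matrix (Fin n) (Fin n) ℂ} (hg : g ∈ G) : conjSet g G = G := by
  ext h
  rw [mem_conjSet (hG.2.2 g hg).1]
  constructor
  · intro hh
    have := hG.2.1 _ (hG.2.1 _ hg _ hh) _ (hG.2.2 g hg).2
    simp only [Matrix.mul_assoc, hG.mul_inv hg, Matrix.mul_one] at this
    rwa [← Matrix.mul_assoc, hG.mul_inv hg, Matrix.one_mul] at this
  · exact fun hh => hG.2.1 _ (hG.2.1 _ (hG.2.2 g hg).2 _ hh) _ hg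

lemma orbit_mulVec {G : Set (Matrix (Fin n) (Fin n) ℂ)} (hG : IsMatSubgroup ℂ n G)
    {g : Matrix (Fin n) (Fin n) ℂ} (hg : g ∈ G) (v : Fin n → ℂ) :
    orbit ℂ n G (g *ᵥ v) = orbit ℂ n G v := by
  ext x
  constructor
  · rintro ⟨h, hh, rfl⟩
    exact ⟨h * g, hG.2.1 _ hh _ hg, (mulVec_mulVec _ _ _).symm⟩
  · rintro ⟨h, hh, rfl⟩
    refine ⟨h * g⁻¹, hG.2.1 _ hh _ (hG.2.2 g hg).2, ?_⟩
    simp only [mulVec_mulVec, Matrix.mul_assoc, hG.inv_mul hg, Matrix.mul_one]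

/-- In a reductive group, an orbit quietly approaching a point with closed orbit contains it. -/
lemma mem_orbit_of_quietLimit {G : Set (Matrix (Fin n) (Fin n) ℂ)}
    (hG : IsReductiveGroup ℂ n G) {w u : Fin n → ℂ} (hw : HasClosedOrbit ℂ n G w)
    (h : QuietLimit G w u) : w ∈ orbit ℂ n G u := by
  obtain ⟨B, hB, hS⟩ := exists_isStarGroup_conjSet hG
  have hcl := isClosed_orbit_conjSet hB hw.isClosed
  obtain ⟨g, hg, hmin⟩ := exists_isMinVec hS.sub hcl
  have h1 := (h.conjSet hB).conjSet (hS.sub.2.2 g hg).1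
  rw [conjSet_self hS.sub hg] at h1
  obtain ⟨k, hk, he⟩ := hS.mem_orbit_of_quietLimit hmin h1
  have h2 : B *ᵥ w ∈ orbit ℂ n (conjSet B G) (B *ᵥ u) := by
    refine ⟨g⁻¹ * (k * g), hS.sub.2.1 _ (hS.sub.2.2 g hg).2 _ (hS.sub.2.1 _ hk _ hg), ?_⟩
    have := congrArg (fun x => g⁻¹ *ᵥ x) he
    simp only [mulVec_mulVec, ← Matrix.mul_assoc, hS.sub.inv_mul hg, Matrix.one_mul] at this ⊢
    exact this
  rw [orbit_conjSet hB] at h2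
  obtain ⟨x, hx, he⟩ := h2
  have := congrArg (fun x => B⁻¹ *ᵥ x) he
  simp only [mulVec_mulVec, inv_mul_of_isUnit hB, one_mulVec] at this
  exact this ▸ hx

/-- A reductive group has countably many conjugacy classes of isotropy groups of closed
orbits. -/
lemma exists_countable_conjIsotropy {G : Set (Matrix (Fin n) (Fin n) ℂ)}
    (hG : IsReductiveGroup ℂ n G) :
    ∃ T : Set (Fin n → ℂ), T.Countable ∧
      ∀ w, HasClosedOrbit ℂ n G w → ∃ t ∈ T, ConjIsotropy ℂ n G t w := by
  obtain ⟨B, hB, hS⟩ := exists_isStarGroup_conjSet hG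
  obtain ⟨T, hT, h⟩ := hS.exists_countable_conjIsotropy
  refine ⟨(fun x => B⁻¹ *ᵥ x) '' T, hT.image _, fun w hw => ?_⟩
  have hcl := isClosed_orbit_conjSet hB hw.isClosed
  obtain ⟨g, hg, hmin⟩ := exists_isMinVec hS.sub hcl
  obtain ⟨t, ht, hc⟩ := h _ hmin
  refine ⟨_, ⟨t, ht, rfl⟩, ?_⟩
  have hc' : ConjIsotropy ℂ n (conjSet B G) t (B *ᵥ w) :=
    hc.trans hS.sub (((conjIsotropy_iff hS.sub).2 ⟨g, hg, rfl⟩).symm hS.sub)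
  obtain ⟨k, hk, he⟩ := (conjIsotropy_iff hS.sub).1 hc'
  refine (conjIsotropy_iff hG.1).2 ⟨_, (mem_conjSet hB).1 hk, ?_⟩
  have hkt : k *ᵥ t = B *ᵥ ((B⁻¹ * k * B) *ᵥ (B⁻¹ *ᵥ t)) := by
    simp only [mulVec_mulVec, ← Matrix.mul_assoc, mul_inv_of_isUnit hB, Matrix.one_mul]
    rw [Matrix.mul_assoc k, mul_inv_of_isUnit hB, Matrix.mul_one]
  rw [hkt] at he
  ext r
  have h3 : B⁻¹ * (B * r * B⁻¹) * B = r := by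
    simp only [Matrix.mul_assoc, inv_mul_of_isUnit hB, Matrix.mul_one]
    rw [← Matrix.mul_assoc, inv_mul_of_isUnit hB, Matrix.one_mul]
  have h4 := Set.ext_iff.1 he (B * r * B⁻¹)
  rwa [mem_isotropy_conjSet hB, mem_isotropy_conjSet hB, h3] at h4

end Transport

section Slice
open Matrix Filter Topology
variable {n : ℕ}

section
attribute [local instance] Matrix.linftyOpNormedRing Matrix.linftyOpNormedAlgebra

lemma mexp_eq (A : Matrix (Fin n) (Fin n) ℂ) : mexp ℂ n A = NormedSpace.exp A := by
  rw [NormedSpace.exp_eq_tsum ℂ]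
  rfl

lemma hasStrictDerivAt_mexp_apply (A : Matrix (Fin n) (Fin n) ℂ) (i j : Fin n) :
    HasStrictDerivAt (fun t : ℂ => mexp ℂ n (t • A) i j) (A i j) 0 := by
  have h := hasStrictDerivAt_exp_smul_const A (0 : ℂ)
  rw [zero_smul, NormedSpace.exp_zero, one_mul] at h
  have h2 := (LinearMap.toContinuousLinearMap
    (Matrix.entryLinearMap ℂ ℂ i j)).hasStrictFDerivAt.comp_hasStrictDerivAt (0 : ℂ) h
  simp only [mexp_eq]
  exact h2

lemma mexp_zero : mexp ℂ n 0 = 1 := by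
  rw [mexp_eq, NormedSpace.exp_zero]

end

lemma hasStrictFDerivAt_mexp_mulVec {E : Type} [NormedAddCommGroup E] [NormedSpace ℂ E]
    {f : E → Fin n → ℂ} {f' : E →L[ℂ] Fin n → ℂ} (hf : HasStrictFDerivAt f f' 0)
    (A : Matrix (Fin n) (Fin n) ℂ) :
    ∃ F' : ℂ × E →L[ℂ] Fin n → ℂ,
      HasStrictFDerivAt (fun p : ℂ × E => mexp ℂ n (p.1 • A) *ᵥ f p.2) F' 0 ∧
      ∀ p, F' p = f' p.2 + p.1 • (A *ᵥ f 0) := by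
  have hA : ∀ i j, HasStrictFDerivAt (fun p : ℂ × E => mexp ℂ n (p.1 • A) i j)
      ((ContinuousLinearMap.toSpanSingleton ℂ (A i j)).comp
        (ContinuousLinearMap.fst ℂ ℂ E)) 0 := fun i j =>
    HasStrictFDerivAt.comp (f := Prod.fst) (0 : ℂ × E)
      (hasStrictDerivAt_mexp_apply A i j).hasStrictFDerivAt hasStrictFDerivAt_fst
  have hf2 : ∀ j, HasStrictFDerivAt (fun p : ℂ × E => f p.2 j)
      ((ContinuousLinearMap.proj j).comp (f'.comp (ContinuousLinearMap.snd ℂ ℂ E))) 0 := fun j =>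
    (hasStrictFDerivAt_pi'.1
      (HasStrictFDerivAt.comp (f := Prod.snd) (0 : ℂ × E) hf hasStrictFDerivAt_snd)) j
  have hsum := fun i => HasStrictFDerivAt.fun_sum (u := Finset.univ)
    fun j _ => (hA i j).fun_mul (hf2 j)
  have hpi := hasStrictFDerivAt_pi.2 hsum
  refine ⟨_, hpi, ?_⟩
  intro p
  ext i
  simp only [mexp_zero, Matrix.one_apply, Finset.sum_add_distrib, mulVec, dotProduct,
    ContinuousLinearMap.pi_apply, _root_.sum_apply, _root_.add_apply,
    _root_.smul_apply, ContinuousLinearMap.comp_apply, Prod.fst_zero, Prod.snd_zero,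
    zero_smul, ContinuousLinearMap.proj_apply, ContinuousLinearMap.toSpanSingleton_apply,
    ContinuousLinearMap.coe_fst', ContinuousLinearMap.coe_snd', Pi.add_apply, Pi.smul_apply,
    smul_eq_mul, Finset.mul_sum]
  congr 1
  · simp
  · exact Finset.sum_congr rfl fun j _ => by ring

/-- The map `(t, x) ↦ exp(t₁ A₁) ⋯ exp(tᵣ Aᵣ) (w + x)`, with its derivative at the origin. -/
lemma exists_chart {G : Set (Matrix (Fin n) (Fin n) ℂ)} (hG : IsMatSubgroup ℂ n G)
    (w : Fin n → ℂ) (N : Submodule ℂ (Fin n → ℂ)) (l : List (Matrix (Fin n) (Fin n) ℂ))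
    (hl : ∀ A ∈ l, A ∈ lieAlgebra ℂ n G) :
    ∃ (E : Type) (_ : NormedAddCommGroup E) (_ : NormedSpace ℂ E) (_ : CompleteSpace E)
      (f : E → Fin n → ℂ) (f' : E →L[ℂ] Fin n → ℂ) (ν : E → Fin n → ℂ),
      HasStrictFDerivAt f f' 0 ∧ f 0 = w ∧ (N : Set (Fin n → ℂ)) ⊆ Set.range f' ∧
      (∀ A ∈ l, A *ᵥ w ∈ Set.range f') ∧ Continuous ν ∧ ν 0 = 0 ∧
      ∀ e, ν e ∈ N ∧ ∃ g ∈ G, f e = g *ᵥ (w + ν e) := by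
  induction l with
  | nil =>
    refine ⟨N, inferInstance, inferInstance, inferInstance, fun e => w + e, N.subtypeL,
      fun e => e, ?_, by simp, ?_, by simp, by fun_prop, by simp, ?_⟩
    · exact N.subtypeL.hasStrictFDerivAt.const_add w
    · intro x hxN
      exact ⟨⟨x, hxN⟩, rfl⟩
    · intro e
      exact ⟨e.2, 1, hG.1, by simp⟩
  | cons A l ih =>
    obtain ⟨E, _, _, _, f, f', ν, hf, hf0, hN, hl', hν, hν0, hfe⟩ :=
      ih fun B hB => hl B (List.mem_cons_of_mem _ hB)
    obtain ⟨F', hF, hF'⟩ := hasStrictFDerivAt_mexp_mulVec hf A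
    have hsub : Set.range f' ⊆ Set.range F' := by
      rintro _ ⟨e, rfl⟩
      exact ⟨(0, e), by simp [hF']⟩
    refine ⟨ℂ × E, inferInstance, inferInstance, inferInstance, _, F', fun p => ν p.2, hF, ?_,
      hN.trans hsub, ?_, by fun_prop, by simpa using hν0, ?_⟩
    · simp [hf0, mexp_zero]
    · intro B hB
      rcases List.mem_cons.1 hB with rfl | hB
      · exact ⟨(1, 0), by simp [hF', hf0]⟩
      · exact hsub (hl' B hB)
    · intro p
      obtain ⟨hp, g, hg, hgp⟩ := hfe p.2
      refine ⟨hp, mexp ℂ n (p.1 • A) * g, hG.2.1 _ (hl A List.mem_cons_self p.1) _ hg, ?_⟩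
      rw [← mulVec_mulVec, hgp]

lemma mem_closure_inter_slice {G : Set (Matrix (Fin n) (Fin n) ℂ)} (hG : IsMatSubgroup ℂ n G)
    {w u : Fin n → ℂ} {N : Submodule ℂ (Fin n → ℂ)} (hN : IsCompl (orbitTangent ℂ n G w) N)
    (hu : w ∈ closure (orbit ℂ n G u)) :
    w ∈ closure {x | x ∈ orbit ℂ n G u ∧ x - w ∈ N} := by
  classical
  obtain ⟨s, hs, hspan⟩ := Submodule.fg_span_iff_fg_span_finset_subset _ |>.1
    (IsNoetherian.noetherian (orbitTangent ℂ n G w))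
  have hs' : ∀ x ∈ s, ∃ A ∈ lieAlgebra ℂ n G, A *ᵥ w = x := fun x hxs => hs hxs
  choose! a ha haw using hs'
  obtain ⟨E, _, _, _, f, f', ν, hf, hf0, hN', hl', hν, hν0, hfe⟩ :=
    exists_chart hG w N (s.toList.map a) (by
      intro A hA
      obtain ⟨x, hxs, rfl⟩ := List.mem_map.1 hA
      exact ha x (Finset.mem_toList.1 hxs))
  have htop : (f' : E →ₗ[ℂ] Fin n → ℂ).range = ⊤ := by
    rw [eq_top_iff, ← hN.sup_eq_top, sup_le_iff]
    refine ⟨?_, fun x hxN => hN' hxN⟩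
    change Submodule.span ℂ _ ≤ _
    rw [hspan, Submodule.span_le]
    intro x hxs
    have := hl' (a x) (List.mem_map.2 ⟨x, Finset.mem_toList.2 hxs, rfl⟩)
    rw [haw x hxs] at this
    exact this
  have hmap := hf.map_nhds_eq_of_surj htop
  rw [hf0] at hmap
  rw [mem_closure_iff_frequently, ← hmap, frequently_map] at hu
  have hcont : Tendsto (fun e => w + ν e) (𝓝 0) (𝓝 w) := by
    have : Continuous fun e => w + ν e := by fun_prop
    have h2 := this.tendsto 0
    simpa only [hν0, add_zero] using h2
  rw [mem_closure_iff_frequently]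
  refine hcont.frequently (hu.mono fun e he => ?_)
  obtain ⟨hνe, g, hg, hge⟩ := hfe e
  obtain ⟨k, hk, hke⟩ := he
  refine ⟨⟨g⁻¹ * k, hG.2.1 _ (hG.2.2 g hg).2 _ hk, ?_⟩, by simpa using hνe⟩
  change (g⁻¹ * k) *ᵥ u = _
  change k *ᵥ u = _ at hke
  rw [← mulVec_mulVec, hke, hge, mulVec_mulVec, inv_mul_of_isUnit (hG.2.2 g hg).1, one_mulVec]

lemma mulVec_eq_of_hasFiniteImageOn {H : Set (Matrix (Fin n) (Fin n) ℂ)}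
    {N : Submodule ℂ (Fin n → ℂ)} (hfin : HasFiniteImageOn ℂ n H N)
    {γ : ℝ → Matrix (Fin n) (Fin n) ℂ} (hγ : Continuous γ) (hγ0 : γ 0 = 1) (hγH : ∀ t, γ t ∈ H)
    {x : Fin n → ℂ} (hxN : x ∈ N) (t : ℝ) : γ t *ᵥ x = x := by
  have hrange : (Set.range fun t => γ t *ᵥ x).Finite := by
    refine (hfin.image fun φ => φ ⟨x, hxN⟩).subset ?_
    rintro _ ⟨t, rfl⟩
    exact ⟨_, ⟨γ t, hγH t, rfl⟩, rfl⟩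
  have hconn : IsPreconnected (Set.range fun t => γ t *ᵥ x) :=
    isPreconnected_range (by fun_prop)
  have hsub : (Set.range fun t => γ t *ᵥ x).Subsingleton := by
    by_contra h
    exact hconn.infinite_of_nontrivial (Set.not_subsingleton_iff.1 h) hrange
  have := hsub ⟨t, rfl⟩ ⟨0, rfl⟩
  simpa [hγ0] using this

lemma IsAlmostPrincipalPt.mem_orbit_of_mem_closure {G : Set (Matrix (Fin n) (Fin n) ℂ)}
    (hG : IsReductiveGroup ℂ n G) {w u : Fin n → ℂ} (hw : IsAlmostPrincipalPt ℂ n G w)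
    (hu : w ∈ closure (orbit ℂ n G u)) : w ∈ orbit ℂ n G u := by
  obtain ⟨hwc, N, ⟨hN, hNs⟩, hfin⟩ := hw
  refine mem_orbit_of_quietLimit hG hwc ?_
  obtain ⟨x, hxm, hxt⟩ := mem_closure_iff_seq_limit.1 (mem_closure_inter_slice hG.1 hN hu)
  refine ⟨x, fun i => (hxm i).1, hxt, fun γ hγ hγ0 hγw t i => ?_⟩
  have h1 := mulVec_eq_of_hasFiniteImageOn hfin hγ hγ0 hγw (hxm i).2 t
  rw [mulVec_sub, (hγw t).2] at h1
  exact sub_left_injective h1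

end Slice

section Chevalley
open Matrix
variable {n : ℕ}

lemma mem_of_forall_eval_eq_zero {σ : Type} [Finite σ] {P : Ideal (MvPolynomial σ ℂ)}
    [hP : P.IsPrime] {q : MvPolynomial σ ℂ}
    (h : ∀ x, (∀ p ∈ P, eval x p = 0) → eval x q = 0) : q ∈ P := by
  rw [← MvPolynomial.IsPrime.vanishingIdeal_zeroLocus (K := ℂ) P]
  intro x hxP
  simp only [MvPolynomial.mem_zeroLocus_iff, MvPolynomial.aeval_eq_eval] at hxP ⊢
  exact h x hxP

/-- The image of a polynomial map between affine varieties contains a nonempty open subset of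
each component of its closure. -/
lemma exists_notMem_forall_exists_eval {σ τ : Type} [Finite σ] [Finite τ]
    (φ : MvPolynomial σ ℂ →ₐ[ℂ] MvPolynomial τ ℂ) (J : Ideal (MvPolynomial τ ℂ))
    {P : Ideal (MvPolynomial σ ℂ)} (hP : P ∈ (J.comap φ).minimalPrimes) :
    ∃ a ∉ P, ∀ x : σ → ℂ, (∀ p ∈ P, eval x p = 0) → eval x a ≠ 0 →
      ∃ z : τ → ℂ, (∀ p ∈ J, eval z p = 0) ∧ ∀ p, eval z (φ p) = eval x p := by
  obtain ⟨Q, hQ, hJQ, hQP⟩ := Ideal.exists_comap_eq_of_mem_minimalPrimes φ.toRingHom P hP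
  let f : MvPolynomial σ ℂ →+* MvPolynomial τ ℂ ⧸ J :=
    (Ideal.Quotient.mkₐ ℂ J).toRingHom.comp φ.toRingHom
  have hf : f.FinitePresentation := by
    refine RingHom.FinitePresentation.of_finiteType.1 ?_
    refine RingHom.FiniteType.of_comp_finiteType (f := algebraMap ℂ (MvPolynomial σ ℂ)) ?_
    have : f.comp (algebraMap ℂ (MvPolynomial σ ℂ)) = algebraMap ℂ (MvPolynomial τ ℂ ⧸ J) :=
      ((Ideal.Quotient.mkₐ ℂ J).comp φ).comp_algebraMap
    rw [this, RingHom.finiteType_algebraMap]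
    infer_instance
  obtain ⟨S, hS⟩ := PrimeSpectrum.exists_constructibleSetData_iff.2
    (PrimeSpectrum.isConstructible_range_comap hf)
  have hPmem : (⟨P, hP.isPrime⟩ : PrimeSpectrum (MvPolynomial σ ℂ)) ∈ S.toSet := by
    rw [hS]
    have hQ' : (Q.map (Ideal.Quotient.mk J)).IsPrime :=
      Ideal.map_isPrime_of_surjective Ideal.Quotient.mk_surjective (by rwa [Ideal.mk_ker])
    refine ⟨⟨Q.map (Ideal.Quotient.mk J), hQ'⟩, ?_⟩
    ext1
    change (Q.map (Ideal.Quotient.mk J)).comap f = P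
    change Ideal.comap ((Ideal.Quotient.mk J).comp φ.toRingHom) _ = P
    rw [← Ideal.comap_comap, Ideal.comap_map_of_surjective _ Ideal.Quotient.mk_surjective,
      ← RingHom.ker_eq_comap_bot, Ideal.mk_ker, sup_eq_left.2 hJQ, hQP]
  simp only [PrimeSpectrum.ConstructibleSetData.toSet, Set.mem_iUnion] at hPmem
  obtain ⟨D, hDS, hD⟩ := hPmem
  refine ⟨D.f, fun h => hD.2 (by simpa [PrimeSpectrum.mem_zeroLocus] using h), fun x hxP hxa => ?_⟩
  let m : Ideal (MvPolynomial σ ℂ) := RingHom.ker (eval x)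
  have hm : m.IsPrime := RingHom.ker_isPrime _
  have hmem : (⟨m, hm⟩ : PrimeSpectrum (MvPolynomial σ ℂ)) ∈ S.toSet := by
    simp only [PrimeSpectrum.ConstructibleSetData.toSet, Set.mem_iUnion]
    refine ⟨D, hDS, ?_, ?_⟩
    · exact fun p hp => hxP p (hD.1 hp)
    · simpa [PrimeSpectrum.mem_zeroLocus, m] using hxa
  rw [hS] at hmem
  obtain ⟨q, hq⟩ := hmem
  have hq' : q.asIdeal.comap f = m := congrArg PrimeSpectrum.asIdeal hq
  have hne : q.asIdeal.comap (Ideal.Quotient.mk J) ≠ ⊤ :=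
    (Ideal.comap_isPrime (Ideal.Quotient.mk J) q.asIdeal).ne_top
  obtain ⟨z, hz⟩ := exists_eval_eq_zero_of_ne_top hne
  refine ⟨z, fun p hp => hz p ?_, fun p => ?_⟩
  · rw [Ideal.mem_comap, Ideal.Quotient.eq_zero_iff_mem.2 hp]
    exact zero_mem _
  · have hp : p - C (eval x p) ∈ m := by simp [m]
    rw [← hq'] at hp
    have := hz (φ (p - MvPolynomial.C (eval x p))) hp
    rw [map_sub, map_sub, sub_eq_zero] at this
    rw [this, ← MvPolynomial.algebraMap_eq, AlgHom.commutes, MvPolynomial.algebraMap_eq, eval_C]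

lemma mem_vanishingIdeal {A : Set (Fin n → ℂ)} {p : MvPolynomial (Fin n) ℂ} :
    p ∈ vanishingIdeal ℂ n A ↔ ∀ x ∈ A, eval x p = 0 := Iff.rfl

lemma exists_notMem_forall_mem_orbit {G : Set (Matrix (Fin n) (Fin n) ℂ)}
    (hG : IsZClosedInGL ℂ n G) {u : Fin n → ℂ} {P : Ideal (MvPolynomial (Fin n) ℂ)}
    (hP : P ∈ (vanishingIdeal ℂ n (orbit ℂ n G u)).minimalPrimes) :
    ∃ a ∉ P, ∀ x ∈ zeroSet ℂ n (P : Set (MvPolynomial (Fin n) ℂ)), eval x a ≠ 0 →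
      x ∈ orbit ℂ n G u := by
  obtain ⟨S, rfl⟩ := hG
  set G := {g : Matrix (Fin n) (Fin n) ℂ | IsUnit g ∧ ∀ p ∈ S, eval (fun ij => g ij.1 ij.2) p = 0}
    with hGdef
  let pt : Matrix (Fin n) (Fin n) ℂ → Option (Fin n × Fin n) → ℂ :=
    fun g o => o.elim (g.det)⁻¹ fun ij => g ij.1 ij.2
  let J : Ideal (MvPolynomial (Option (Fin n × Fin n)) ℂ) :=
    MvPolynomial.vanishingIdeal ℂ (pt '' G)
  let φ : MvPolynomial (Fin n) ℂ →ₐ[ℂ] MvPolynomial (Option (Fin n × Fin n)) ℂ :=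
    aeval fun i => ∑ j, X (some (i, j)) * MvPolynomial.C (u j)
  have hφ : ∀ z p, eval z (φ p) = eval ((Matrix.of fun i j => z (some (i, j))) *ᵥ u) p := by
    intro z p
    induction p using MvPolynomial.induction_on with
    | C c => simp only [← algebraMap_eq, AlgHom.commutes]; simp only [algebraMap_eq, eval_C]
    | add p q hp hq => simp only [map_add, hp, hq]
    | mul_X p i hp =>
      simp only [map_mul, hp, eval_X]
      congr 1
      simp [φ, mulVec, dotProduct]
  have hJφ : J.comap φ = vanishingIdeal ℂ n (orbit ℂ n G u) := by
    ext p
    simp only [J, Ideal.mem_comap, MvPolynomial.mem_vanishingIdeal_iff, Set.forall_mem_image,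
      aeval_eq_eval, mem_vanishingIdeal, orbit]
    refine forall₂_congr fun g _ => ?_
    rw [hφ]
    rfl
  rw [← hJφ] at hP
  obtain ⟨a, ha, H⟩ := exists_notMem_forall_exists_eval φ J hP
  refine ⟨a, ha, fun x hxP hxa => ?_⟩
  obtain ⟨z, hzJ, hz⟩ := H x hxP hxa
  let g : Matrix (Fin n) (Fin n) ℂ := Matrix.of fun i j => z (some (i, j))
  refine ⟨g, ⟨?_, fun p hp => ?_⟩, ?_⟩
  · rw [isUnit_iff_isUnit_det, isUnit_iff_ne_zero]
    obtain ⟨p, hp⟩ := matPoly_det (n := n)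
    have hmem : X none * rename some p - 1 ∈ J := by
      rintro _ ⟨g, hg, rfl⟩
      have h1 : g.det ≠ 0 := isUnit_iff_ne_zero.1 ((isUnit_iff_isUnit_det g).1 hg.1)
      simp only [aeval_eq_eval, map_sub, map_mul, eval_X, eval_rename, map_one]
      have h2 := hp g
      change (g.det)⁻¹ * eval (fun ij => g ij.1 ij.2) p - 1 = 0
      rw [h2, inv_mul_cancel₀ h1, sub_self]
    have h := hzJ _ hmem
    simp only [map_sub, map_mul, eval_X, eval_rename, map_one] at h
    have h2 : eval (fun ij => g ij.1 ij.2) p = g.det := hp g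
    intro h0
    rw [h0] at h2
    rw [show z ∘ some = fun ij : Fin n × Fin n => g ij.1 ij.2 from rfl, h2, mul_zero] at h
    norm_num at h
  · have hmem : rename some p ∈ J := by
      rintro _ ⟨g, hg, rfl⟩
      rw [aeval_eq_eval, eval_rename]
      exact hg.2 p hp
    have h := hzJ _ hmem
    rwa [eval_rename] at h
  · funext i
    have h := hz (X i)
    rwa [hφ, eval_X, eval_X] at h

end Chevalley

section Density
open Filter Topology

lemma mem_closure_eval_ne_zero {σ : Type} [Finite σ] {h : MvPolynomial σ ℂ} (hh : h ≠ 0)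
    (y : σ → ℂ) : y ∈ closure {y' | eval y' h ≠ 0} := by
  obtain ⟨z, hz⟩ : ∃ z, eval z h ≠ 0 := by
    by_contra! H
    exact hh (MvPolynomial.funext fun z => by simpa using H z)
  let q : Polynomial ℂ := aeval (fun i => Polynomial.C (y i) + Polynomial.X * Polynomial.C (z i - y i)) h
  have hq : ∀ t : ℂ, q.eval t = eval (fun i => y i + t * (z i - y i)) h := by
    intro t
    have : (Polynomial.evalRingHom t).comp (aeval (R := ℂ) fun i =>
        Polynomial.C (y i) + Polynomial.X * Polynomial.C (z i - y i)).toRingHom =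
        (eval fun i => y i + t * (z i - y i)) := by
      ext i <;> simp
    exact congrArg (fun f : MvPolynomial σ ℂ →+* ℂ => f h) this
  have hq0 : q ≠ 0 := by
    intro h0
    have := hq 1
    rw [h0] at this
    simp at this
    exact hz this.symm
  have hfin : {t : ℂ | q.eval t = 0}.Finite := by
    have := q.roots.toFinset.finite_toSet
    refine this.subset fun t ht => ?_
    simpa [hq0] using ht
  have hdense : (0 : ℂ) ∈ closure {t : ℂ | q.eval t ≠ 0} :=
    hfin.countable.dense_compl ℂ 0
  have hcont : Continuous fun t : ℂ => fun i => y i + t * (z i - y i) := by fun_prop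
  have := map_mem_closure hcont hdense (t := {y' | eval y' h ≠ 0}) fun t ht => by
    simpa only [Set.mem_ofPred_eq, hq] using ht
  simpa using this

lemma exists_root_norm_lt {F : Polynomial ℂ} (hF : F.Monic) {ε : ℝ} (hε : 0 < ε)
    (h : ‖F.coeff 0‖ < ε ^ F.natDegree) : ∃ τ, F.eval τ = 0 ∧ ‖τ‖ < ε := by
  by_contra! H
  have hs : F.Splits := IsAlgClosed.splits F
  rw [hs.coeff_zero_eq_prod_roots_of_monic hF] at h
  have h2 : ε ^ F.natDegree ≤ ‖F.roots.prod‖ := by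
    rw [hs.natDegree_eq_card_roots]
    have : ∀ m : Multiset ℂ, (∀ r ∈ m, ε ≤ ‖r‖) → ε ^ m.card ≤ ‖m.prod‖ := by
      intro m
      induction m using Multiset.induction_on with
      | empty => simp
      | cons r m ih =>
        intro hm
        rw [Multiset.card_cons, Multiset.prod_cons, norm_mul, pow_succ']
        exact mul_le_mul (hm r (Multiset.mem_cons_self r m))
          (ih fun r' hr' => hm r' (Multiset.mem_cons_of_mem hr')) (by positivity) (norm_nonneg _)
    exact this _ fun r hr => H r ((Polynomial.mem_roots hF.ne_zero).1 hr)
  rw [norm_mul, norm_pow, norm_neg, norm_one, one_pow, one_mul] at h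
  linarith

lemma exists_norm_root_le {σ : Type} [Finite σ] {F : Polynomial (MvPolynomial σ ℂ)} (hF : F.Monic)
    {K : Set (σ → ℂ)} (hK : IsCompact K) :
    ∃ M, ∀ y ∈ K, ∀ τ, F.eval₂ (eval y) τ = 0 → ‖τ‖ ≤ M := by
  have hb : ∀ j, ∃ B : ℝ, ∀ y ∈ K, ‖eval y (F.coeff j)‖ ≤ B := fun j =>
    hK.exists_bound_of_continuousOn (f := fun y => eval y (F.coeff j))
      (MvPolynomial.continuous_eval _).continuousOn
  choose B hB using hb
  refine ⟨1 + ∑ j ∈ Finset.range F.natDegree, |B j|, fun y hy τ hτ => ?_⟩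
  have hm : (F.map (eval y)).Monic := hF.map _
  have hdeg : (F.map (eval y)).natDegree = F.natDegree := hF.natDegree_map _
  have hroot : (F.map (eval y)).IsRoot τ := by rwa [Polynomial.IsRoot, Polynomial.eval_map]
  have h1 := hroot.norm_lt_cauchyBound hm.ne_zero
  have h2 : ((F.map (eval y)).cauchyBound : ℝ) ≤ 1 + ∑ j ∈ Finset.range F.natDegree, |B j| := by
    rw [Polynomial.cauchyBound, hm.leadingCoeff, hdeg]
    simp only [nnnorm_one, div_one, NNReal.coe_add, NNReal.coe_one]
    rw [add_comm]
    gcongr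
    have : (Finset.range F.natDegree).sup (fun j => ‖(F.map (eval y)).coeff j‖₊) ≤
        ∑ j ∈ Finset.range F.natDegree, ‖(F.map (eval y)).coeff j‖₊ :=
      Finset.sup_le fun j hj => Finset.single_le_sum
        (f := fun j => ‖(F.map (eval y)).coeff j‖₊) (fun _ _ => zero_le) hj
    refine (NNReal.coe_le_coe.2 this).trans ?_
    rw [NNReal.coe_sum]
    refine Finset.sum_le_sum fun j _ => ?_
    rw [coe_nnnorm, Polynomial.coeff_map]
    exact (hB j y hy).trans (le_abs_self _)
  exact (NNReal.coe_le_coe.2 h1.le).trans h2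

lemma exists_maximal_of_minpoly_root {S A : Type} [CommRing S] [IsDomain S] [IsIntegrallyClosed S]
    [CommRing A] [IsDomain A] [Algebra S A] [Algebra.IsIntegral S A]
    [FaithfulSMul S A] (θ : A) (χ : S →+* ℂ)
    (hχ : Function.Surjective χ) (τ : ℂ) (hτ : (minpoly S θ).eval₂ χ τ = 0) :
    ∃ Q : Ideal A, Q.IsMaximal ∧
      ∀ F : Polynomial S, F.eval₂ χ τ = 0 → Polynomial.aeval θ F ∈ Q := by
  let _ : Algebra (Polynomial S) A := (Polynomial.aeval θ).toRingHom.toAlgebra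
  have : IsScalarTower S (Polynomial S) A := IsScalarTower.of_algebraMap_eq fun s =>
    ((Polynomial.aeval θ).commutes s).symm
  have : Algebra.IsIntegral (Polynomial S) A := Algebra.IsIntegral.tower_top S
  let N := RingHom.ker (Polynomial.eval₂RingHom χ τ)
  have hN : N.IsMaximal := RingHom.ker_isMaximal_of_surjective _ fun c => by
    obtain ⟨s, rfl⟩ := hχ c
    exact ⟨Polynomial.C s, by simp⟩
  obtain ⟨Q, hQ, hQN⟩ := Ideal.exists_ideal_over_maximal_of_isIntegral (S := A) N (by
    intro F hF
    obtain ⟨E, rfl⟩ := minpoly.isIntegrallyClosed_dvd (Algebra.IsIntegral.isIntegral θ) (p := F) hF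
    change Polynomial.eval₂ χ τ _ = 0
    rw [Polynomial.eval₂_mul, hτ, zero_mul])
  refine ⟨Q, hQ, fun F hF => ?_⟩
  have : F ∈ Q.comap (algebraMap (Polynomial S) A) := by rw [hQN]; exact hF
  exact this

/-- The value at a point `x` of the affine variety of `P` of an element of its coordinate ring. -/
def evalQuot {σ : Type} {P : Ideal (MvPolynomial σ ℂ)} {x : σ → ℂ}
    (hP : ∀ p ∈ P, eval x p = 0) : MvPolynomial σ ℂ ⧸ P →+* ℂ :=
  Ideal.Quotient.lift P (eval x) hP

/-- In an irreducible affine variety, the complement of a hypersurface is dense for the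
Euclidean topology. -/
lemma mem_closure_zeroSet_eval_ne_zero {n : ℕ} {P : Ideal (MvPolynomial (Fin n) ℂ)} [hP : P.IsPrime]
    {x : Fin n → ℂ} (hxP : ∀ p ∈ P, eval x p = 0) {g : MvPolynomial (Fin n) ℂ} (hg : g ∉ P) :
    x ∈ closure {x' | (∀ p ∈ P, eval x' p = 0) ∧ eval x' g ≠ 0} := by
  obtain ⟨s, ψ, hψ, hInt⟩ := exists_integral_inj_algHom_of_fg ℂ (MvPolynomial (Fin n) ℂ ⧸ P)
  let _ : Algebra (MvPolynomial (Fin s) ℂ) (MvPolynomial (Fin n) ℂ ⧸ P) := ψ.toRingHom.toAlgebra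
  have : Algebra.IsIntegral (MvPolynomial (Fin s) ℂ) (MvPolynomial (Fin n) ℂ ⧸ P) := ⟨hInt⟩
  have : FaithfulSMul (MvPolynomial (Fin s) ℂ) (MvPolynomial (Fin n) ℂ ⧸ P) :=
    (faithfulSMul_iff_algebraMap_injective _ _).2 hψ
  choose h hh using fun j => Ideal.Quotient.mk_surjective (ψ (X j))
  let π : (Fin n → ℂ) → Fin s → ℂ := fun x' j => eval x' (h j)
  have hπ : Continuous π := continuous_pi fun j => MvPolynomial.continuous_eval _
  have hev : ∀ x' (hx' : ∀ p ∈ P, eval x' p = 0),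
      (evalQuot hx').comp (algebraMap (MvPolynomial (Fin s) ℂ) _) = eval (π x') := by
    intro x' hx'
    ext j
    · change evalQuot hx' (ψ (C j)) = _
      rw [← algebraMap_eq, AlgHom.commutes]
      change eval x' (C j) = eval (π x') (C j)
      rw [eval_C, eval_C]
    · change evalQuot hx' (ψ (X j)) = _
      rw [← hh j, eval_X]
      rfl
  have hev2 : ∀ x' (hx' : ∀ p ∈ P, eval x' p = 0) θ (F : Polynomial (MvPolynomial (Fin s) ℂ)),
      evalQuot hx' (Polynomial.aeval (Ideal.Quotient.mk P θ) F) =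
        F.eval₂ (eval (π x')) (eval x' θ) := by
    intro x' hx' θ F
    rw [Polynomial.aeval_def, Polynomial.hom_eval₂, hev x' hx']
    rfl
  have hlift : ∀ θ y τ, (minpoly (MvPolynomial (Fin s) ℂ) (Ideal.Quotient.mk P θ)).eval₂ (eval y) τ = 0 →
      ∃ x', (∀ p ∈ P, eval x' p = 0) ∧ π x' = y ∧ eval x' θ = τ := by
    intro θ y τ hτ
    obtain ⟨Q, hQ, hQF⟩ := exists_maximal_of_minpoly_root (Ideal.Quotient.mk P θ) (eval y)
      (fun c => ⟨C c, eval_C c⟩) τ hτ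
    obtain ⟨x', hx'⟩ := exists_eval_eq_zero_of_ne_top
      (Ideal.comap_isPrime (Ideal.Quotient.mk P) Q).ne_top
    have hx'P : ∀ p ∈ P, eval x' p = 0 := fun p hp => hx' p (by
      rw [Ideal.mem_comap, Ideal.Quotient.eq_zero_iff_mem.2 hp]
      exact zero_mem _)
    have hQ0 : ∀ a ∈ Q, evalQuot hx'P a = 0 := by
      intro a ha
      obtain ⟨p, rfl⟩ := Ideal.Quotient.mk_surjective a
      exact hx' p ha
    refine ⟨x', hx'P, ?_, ?_⟩
    · funext j
      have h1 := hQ0 _ (hQF (Polynomial.C (X j - C (y j))) (by simp))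
      rw [hev2, Polynomial.eval₂_C] at h1
      simpa [sub_eq_zero] using h1
    · have h1 := hQ0 _ (hQF (Polynomial.X - Polynomial.C (C τ)) (by simp))
      rw [hev2] at h1
      simpa [sub_eq_zero] using h1
  have hroot : ∀ x' (hx' : ∀ p ∈ P, eval x' p = 0) θ,
      (minpoly (MvPolynomial (Fin s) ℂ) (Ideal.Quotient.mk P θ)).eval₂ (eval (π x')) (eval x' θ) = 0 := by
    intro x' hx' θ
    rw [← hev2 x' hx', minpoly.aeval, map_zero]
  have hmonic : ∀ θ, (minpoly (MvPolynomial (Fin s) ℂ) (Ideal.Quotient.mk P θ)).Monic :=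
    fun θ => minpoly.monic (Algebra.IsIntegral.isIntegral _)
  -- an element of the base whose nonvanishing forces that of `g`
  obtain ⟨b, hb, a, hab⟩ := IsAlgebraic.exists_nonzero_dvd (R := MvPolynomial (Fin s) ℂ)
    (s := Ideal.Quotient.mk P g) (Algebra.IsIntegral.isIntegral _).isAlgebraic
    (mem_nonZeroDivisors_of_ne_zero fun h0 => hg (Ideal.Quotient.eq_zero_iff_mem.1 h0))
  have hbg : ∀ x' (hx' : ∀ p ∈ P, eval x' p = 0), eval (π x') b ≠ 0 → eval x' g ≠ 0 := by
    intro x' hx' hne h0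
    refine hne ?_
    rw [← hev x' hx', RingHom.comp_apply, hab, map_mul]
    change eval x' g * _ = 0
    rw [h0, zero_mul]
  -- a function vanishing at `x` and at no other point of its fibre
  obtain ⟨θ, hθx, hθ⟩ : ∃ θ : MvPolynomial (Fin n) ℂ, eval x θ = 0 ∧
      ∀ x', (∀ p ∈ P, eval x' p = 0) → π x' = π x → eval x' θ = 0 → x' = x := by
    have hfin : {x' : Fin n → ℂ | (∀ p ∈ P, eval x' p = 0) ∧ π x' = π x}.Finite := by
      refine (Set.Finite.pi' (t := fun i => {τ | ((minpoly (MvPolynomial (Fin s) ℂ)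
        (Ideal.Quotient.mk P (X i))).map (eval (π x))).IsRoot τ}) fun i => ?_).subset ?_
      · exact Polynomial.finite_setOfPred_isRoot ((hmonic _).map _).ne_zero
      · rintro x' ⟨hx', hx'π⟩ i
        have := hroot x' hx' (X i)
        rw [hx'π, eval_X] at this
        simpa [Polynomial.eval_map] using this
    have hsep : ∀ x' : Fin n → ℂ, ∃ q : MvPolynomial (Fin n) ℂ, x' ≠ x → eval x' q = 0 ∧ eval x q ≠ 0 := by
      intro x'
      by_cases hne : x' = x
      · exact ⟨0, fun h => absurd hne h⟩
      · obtain ⟨i, hi⟩ := Function.ne_iff.1 hne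
        exact ⟨X i - C (x' i), fun _ => ⟨by simp, by simpa [sub_eq_zero] using Ne.symm hi⟩⟩
    choose q hq using hsep
    let r := ∏ x' ∈ hfin.toFinset.erase x, q x'
    have hr : eval x r ≠ 0 := by
      simp only [r, map_prod]
      exact Finset.prod_ne_zero_iff.2 fun x' hx' => (hq x' (Finset.ne_of_mem_erase hx')).2
    refine ⟨C (eval x r) - r, by simp, fun x' hx' hx'π h0 => ?_⟩
    by_contra hne
    have : eval x' r = 0 := by
      simp only [r, map_prod]
      exact Finset.prod_eq_zero (Finset.mem_erase.2 ⟨hne, hfin.mem_toFinset.2 ⟨hx', hx'π⟩⟩)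
        (hq x' hne).1
    simp [this] at h0
    exact hr h0
  have happrox : ∀ ε > 0, ∃ x', (∀ p ∈ P, eval x' p = 0) ∧ eval x' g ≠ 0 ∧
      dist (π x') (π x) < ε ∧ ‖eval x' θ‖ < ε := by
    intro ε hε
    set F := minpoly (MvPolynomial (Fin s) ℂ) (Ideal.Quotient.mk P θ) with hF
    have h0 : eval (π x) (F.coeff 0) = 0 := by
      have := hroot x hxP θ
      rw [hθx, Polynomial.eval₂_at_zero] at this
      exact this
    have hopen : IsOpen {y | ‖eval y (F.coeff 0)‖ < ε ^ F.natDegree} :=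
      isOpen_lt (MvPolynomial.continuous_eval _).norm continuous_const
    have hnhds : {y | ‖eval y (F.coeff 0)‖ < ε ^ F.natDegree} ∩ Metric.ball (π x) ε ∈ 𝓝 (π x) :=
      inter_mem (hopen.mem_nhds (by
        change ‖_‖ < _
        rw [h0, norm_zero]
        positivity)) (Metric.ball_mem_nhds _ hε)
    obtain ⟨y, ⟨hy1, hy2⟩, hyb⟩ := mem_closure_iff_nhds.1 (mem_closure_eval_ne_zero hb (π x)) _ hnhds
    have hdeg : (F.map (eval y)).natDegree = F.natDegree := (hmonic θ).natDegree_map _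
    obtain ⟨τ, hτ, hτε⟩ := exists_root_norm_lt ((hmonic θ).map (eval y)) hε (by
      rw [hdeg, Polynomial.coeff_map]
      exact hy1)
    rw [Polynomial.eval_map] at hτ
    obtain ⟨x', hx', hx'π, hx'θ⟩ := hlift θ y τ hτ
    exact ⟨x', hx', hbg x' hx' (by rwa [hx'π]), by rw [hx'π]; exact hy2, by rwa [hx'θ]⟩
  choose z hzP hzg hzπ hzθ using fun k : ℕ => happrox (1 / ((k : ℝ) + 1)) (by positivity)
  have hlim : Tendsto (fun k : ℕ => 1 / ((k : ℝ) + 1)) (hyperfilter ℕ) (𝓝 0) :=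
    tendsto_one_div_add_atTop_nhds_zero_nat.mono_left Nat.hyperfilter_le_atTop
  have hK := isCompact_closedBall (π x) 1
  choose M hM using fun i => exists_norm_root_le (hmonic (X i)) hK
  have hzK : ∀ k i, ‖z k i‖ ≤ M i := fun k i => hM i (π (z k)) ((hzπ k).le.trans (by
    rw [div_le_one (by positivity)]
    have : (0 : ℝ) ≤ k := k.cast_nonneg
    linarith)) _ (by simpa using hroot (z k) (hzP k) (X i))
  have hcomp : IsCompact (Set.univ.pi fun i => Metric.closedBall (0 : ℂ) (M i)) :=
    isCompact_univ_pi fun i => isCompact_closedBall _ _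
  obtain ⟨x', -, hx'⟩ := hcomp.ultrafilter_le_nhds ((hyperfilter ℕ).map z) (by
    refine le_principal_iff.2 (Filter.mem_map.2 (Filter.univ_mem' fun k i _ => ?_))
    simpa using hzK k i)
  have hzx' : Tendsto z (hyperfilter ℕ) (𝓝 x') := hx'
  have hx'P : ∀ p ∈ P, eval x' p = 0 := fun p hp => by
    refine tendsto_nhds_unique (((MvPolynomial.continuous_eval p).tendsto x').comp hzx') ?_
    simp only [Function.comp_def, hzP _ p hp]
    exact tendsto_const_nhds
  have hx'π : π x' = π x := by
    refine tendsto_nhds_unique ((hπ.tendsto x').comp hzx') ?_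
    exact tendsto_iff_dist_tendsto_zero.2
      (squeeze_zero (fun _ => dist_nonneg) (fun k => (hzπ k).le) hlim)
  have hx'θ : eval x' θ = 0 := by
    refine tendsto_nhds_unique (((MvPolynomial.continuous_eval θ).tendsto x').comp hzx') ?_
    exact squeeze_zero_norm (fun k => (hzθ k).le) hlim
  rw [hθ x' hx'P hx'π hx'θ] at hzx'
  exact mem_closure_of_tendsto hzx' (Eventually.of_forall fun k => ⟨hzP k, hzg k⟩)

end Density

section OrbitClosure
open Matrix
variable {n : ℕ} {G : Set (Matrix (Fin n) (Fin n) ℂ)} {u v w : Fin n → ℂ}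

lemma zclosure_orbit_subset_closure (hG : IsZClosedInGL ℂ n G) :
    zclosure ℂ n (orbit ℂ n G u) ⊆ closure (orbit ℂ n G u) := by
  intro x hxu
  have : (RingHom.ker (eval x)).IsPrime := RingHom.ker_isPrime _
  obtain ⟨P, hP, hPx⟩ := Ideal.exists_minimalPrimes_le
    (I := vanishingIdeal ℂ n (orbit ℂ n G u)) (J := RingHom.ker (eval x)) fun p hp => hxu p hp
  have := hP.isPrime
  obtain ⟨a, haP, ha⟩ := exists_notMem_forall_mem_orbit hG hP
  exact closure_mono (fun x' hx' => ha x' hx'.1 hx'.2)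
    (mem_closure_zeroSet_eval_ne_zero (fun p hp => hPx hp) haP)

lemma isAlgebraicSet_zclosure (A : Set (Fin n → ℂ)) : IsAlgebraicSet ℂ n (zclosure ℂ n A) :=
  ⟨_, rfl⟩

lemma zclosure_subset {A X : Set (Fin n → ℂ)} (hX : IsAlgebraicSet ℂ n X) (h : A ⊆ X) :
    zclosure ℂ n A ⊆ X := by
  obtain ⟨S, rfl⟩ := hX
  exact fun x hxA p hp => hxA p fun a ha => h ha p hp

lemma stabilizes_orbit (hG : IsMatSubgroup ℂ n G) (u : Fin n → ℂ) :
    Stabilizes ℂ n G (orbit ℂ n G u) := by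
  rintro g hg _ ⟨h, hh, rfl⟩
  exact ⟨g * h, hG.2.1 g hg h hh, (mulVec_mulVec u g h).symm⟩

lemma Stabilizes.zclosure {A : Set (Fin n → ℂ)} (hA : Stabilizes ℂ n G A) :
    Stabilizes ℂ n G (zclosure ℂ n A) := by
  intro g hg x hxA p hp
  obtain ⟨T, hT⟩ := exists_generic_translate p
  have h : ∀ y, eval (g *ᵥ y) p =
      eval y (map (eval fun ij : Fin n × Fin n => g ij.1 ij.2) T) := fun y => by
    rw [hT, eval_map]
  rw [h]
  exact hxA _ fun y hy => by
    rw [← h]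
    exact hp _ (hA g hg y hy)

lemma mem_orbit_self (hG : IsMatSubgroup ℂ n G) (u : Fin n → ℂ) : u ∈ orbit ℂ n G u :=
  ⟨1, hG.1, one_mulVec u⟩

lemma orbit_subset {X : Set (Fin n → ℂ)} (hX : Stabilizes ℂ n G X) (hu : u ∈ X) :
    orbit ℂ n G u ⊆ X := by
  rintro _ ⟨g, hg, rfl⟩
  exact hX g hg u hu

lemma orbit_eq_of_mem (hG : IsMatSubgroup ℂ n G) (h : v ∈ orbit ℂ n G u) :
    orbit ℂ n G v = orbit ℂ n G u := by
  obtain ⟨g, hg, rfl⟩ := h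
  exact orbit_mulVec hG hg u

/-- Orbit closures contain closed orbits. -/
lemma exists_hasClosedOrbit (hG : IsMatSubgroup ℂ n G) (hGz : IsZClosedInGL ℂ n G)
    (u : Fin n → ℂ) : ∃ w ∈ zclosure ℂ n (orbit ℂ n G u), HasClosedOrbit ℂ n G w := by
  have hstab : ∀ v, Stabilizes ℂ n G (zclosure ℂ n (orbit ℂ n G v)) :=
    fun v => (stabilizes_orbit hG v).zclosure
  obtain ⟨_, ⟨v, hv, rfl⟩, hmax⟩ := set_has_maximal_iff_noetherian.2
    (inferInstance : IsNoetherian (MvPolynomial (Fin n) ℂ) (MvPolynomial (Fin n) ℂ))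
    ((fun v => vanishingIdeal ℂ n (orbit ℂ n G v)) '' zclosure ℂ n (orbit ℂ n G u))
    ⟨_, u, subset_zclosure _ (mem_orbit_self hG u), rfl⟩
  refine ⟨v, hv, fun v' hv' => ?_⟩
  have hv'u : v' ∈ zclosure ℂ n (orbit ℂ n G u) :=
    zclosure_subset (isAlgebraicSet_zclosure _) (orbit_subset (hstab u) hv) hv'
  have hle : vanishingIdeal ℂ n (orbit ℂ n G v) ≤ vanishingIdeal ℂ n (orbit ℂ n G v') :=
    fun p hp x hxo => orbit_subset (hstab v) hv' hxo p hp
  have heq : vanishingIdeal ℂ n (orbit ℂ n G v) = vanishingIdeal ℂ n (orbit ℂ n G v') :=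
    hle.eq_of_not_lt (hmax _ ⟨v', hv'u, rfl⟩)
  have hne : vanishingIdeal ℂ n (orbit ℂ n G v) ≠ ⊤ := fun h => by
    have h1 : (1 : MvPolynomial (Fin n) ℂ) ∈ vanishingIdeal ℂ n (orbit ℂ n G v) := h ▸ trivial
    have h2 := h1 v (mem_orbit_self hG v)
    rw [map_one] at h2
    exact one_ne_zero h2
  obtain ⟨P, hP⟩ := Ideal.nonempty_minimalPrimes hne
  have := hP.isPrime
  obtain ⟨a, haP, ha⟩ := exists_notMem_forall_mem_orbit hGz hP
  obtain ⟨a', haP', ha'⟩ := exists_notMem_forall_mem_orbit hGz (heq ▸ hP)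
  have haa : a * a' ∉ P := fun h => (Ideal.IsPrime.mem_or_mem ‹_› h).elim haP haP'
  obtain ⟨x, hxP, hxa⟩ : ∃ x, (∀ p ∈ P, eval x p = 0) ∧ eval x (a * a') ≠ 0 := by
    by_contra! H
    exact haa (mem_of_forall_eval_eq_zero H)
  rw [map_mul] at hxa
  rw [← orbit_eq_of_mem hG (ha x hxP (left_ne_zero_of_mul hxa)),
    orbit_eq_of_mem hG (ha' x hxP (right_ne_zero_of_mul hxa))]
  exact mem_orbit_self hG v'

/-- A closed orbit in the fibre of the quotient morphism through `y` lies in the closure of the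
orbit of `y`. -/
lemma mem_zclosure_orbit_of_eval_eq (hG : IsReductiveGroup ℂ n G) {y : Fin n → ℂ}
    (hw : HasClosedOrbit ℂ n G w)
    (h : ∀ p, Invariant ℂ n G p → eval w p = eval y p) :
    w ∈ zclosure ℂ n (orbit ℂ n G y) := by
  by_contra hwy
  have hstab := (stabilizes_orbit hG.1 y).zclosure
  have hA : IsAlgebraicSet ℂ n (orbit ℂ n G w) :=
    ⟨_, (subset_zclosure _).antisymm hw⟩
  obtain ⟨Q, hQ, hQ0, hQ1⟩ := exists_invariant_separating hG hA
    (isAlgebraicSet_zclosure (orbit ℂ n G y)) (stabilizes_orbit hG.1 w) hstab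
    (fun x hxw hxy => hwy (by
      have hwx : w ∈ orbit ℂ n G x := by
        rw [orbit_eq_of_mem hG.1 hxw]
        exact mem_orbit_self hG.1 w
      exact orbit_subset hstab hxy hwx))
  have h0 := hQ0 w (mem_orbit_self hG.1 w)
  have h1 := hQ1 y (subset_zclosure _ (mem_orbit_self hG.1 y))
  rw [h Q hQ, h1] at h0
  exact one_ne_zero h0

lemma Invariant.eval_eq_of_mem_zclosure {p : MvPolynomial (Fin n) ℂ} (hp : Invariant ℂ n G p)
    (hw : w ∈ zclosure ℂ n (orbit ℂ n G u)) : eval w p = eval u p := by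
  have := hw (p - C (eval u p)) (by
    rintro _ ⟨g, hg, rfl⟩
    rw [map_sub, eval_C, hp g hg u, sub_self])
  rwa [map_sub, eval_C, sub_eq_zero] at this

end OrbitClosure

section Dimension
variable {n : ℕ}

lemma height_ker_eval_le (x y : Fin n → ℂ) :
    (RingHom.ker (eval x)).height ≤ (RingHom.ker (eval y)).height := by
  let τ : (Fin n → ℂ) → MvPolynomial (Fin n) ℂ →ₐ[ℂ] MvPolynomial (Fin n) ℂ :=
    fun c => aeval fun i => X i + C (c i)
  have hτ : ∀ c, (τ c).comp (τ (-c)) = AlgHom.id ℂ _ := by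
    intro c
    ext i
    simp [τ, algHom_C]
  let e : MvPolynomial (Fin n) ℂ ≃ₐ[ℂ] MvPolynomial (Fin n) ℂ :=
    AlgEquiv.ofAlgHom (τ (x - y)) (τ (y - x)) (by rw [← neg_sub x y]; exact hτ _)
      (by rw [← neg_sub y x]; exact hτ _)
  have he : (eval y).comp e.toRingEquiv.toRingHom = eval x := by
    ext i
    · simp [e, τ, algHom_C]
    · simp [e, τ]
  have h1 : (RingHom.ker (eval y)).comap e.toRingEquiv = RingHom.ker (eval x) := by
    rw [← he]
    exact RingHom.comap_ker _ _
  rw [← h1, RingEquiv.height_comap]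

lemma natCast_le_height_ker_eval (x : Fin n → ℂ) :
    (n : ℕ∞) ≤ (RingHom.ker (eval x)).height := by
  have h := Ideal.sup_isMaximal_height_eq_ringKrullDim (R := MvPolynomial (Fin n) ℂ)
  rw [MvPolynomial.ringKrullDim_of_isNoetherianRing, ringKrullDim_eq_zero_of_field, zero_add,
    Nat.card_fin] at h
  have h' : (⨆ (I : Ideal (MvPolynomial (Fin n) ℂ)) (_ : I.IsMaximal), I.height) = (n : ℕ∞) := by
    exact_mod_cast h
  rw [← h']
  refine iSup₂_le fun M hM => ?_
  obtain ⟨y, hy⟩ := exists_eval_eq_zero_of_ne_top hM.ne_top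
  have : M = RingHom.ker (eval y) :=
    hM.eq_of_le (RingHom.ker_ne_top _) fun p hp => hy p hp
  rw [this]
  exact height_ker_eval_le y x

/-- A prime contained in `m` cutting out a subvariety through `m` of dimension at least the
height of `m` modulo `I`. -/
lemma exists_isPrime_height_le {R : Type*} [CommRing R] [IsNoetherianRing R] {I m : Ideal R}
    [m.IsPrime] (hI : I ≤ m) : ∃ P : Ideal R, P.IsPrime ∧ I ≤ P ∧ P ≤ m ∧
      ((m.map (Ideal.Quotient.mk I)).height : WithBot ℕ∞) ≤ ringKrullDim (R ⧸ P) := by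
  have hm : (m.map (Ideal.Quotient.mk I)).IsPrime := Ideal.isPrime_map_quotientMk_of_isPrime hI
  let q : PrimeSpectrum (R ⧸ I) := ⟨_, hm⟩
  have hq : (m.map (Ideal.Quotient.mk I)).height = Order.height q :=
    q.height_eq_orderHeight
  obtain ⟨d, hd⟩ := ENat.ne_top_iff_exists.1 ((Ideal.finiteHeight_iff _).1
    (inferInstance : (m.map (Ideal.Quotient.mk I)).FiniteHeight) |>.resolve_left hm.ne_top)
  rw [← hd] at hq ⊢
  obtain ⟨s, hs, hsd⟩ := Order.exists_series_of_le_height q hq.le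
  have hmono : Monotone (PrimeSpectrum.comap (Ideal.Quotient.mk I)) :=
    fun a b hab => Ideal.comap_mono hab
  have hsm : StrictMono (PrimeSpectrum.comap (Ideal.Quotient.mk I)) :=
    hmono.strictMono_of_injective
      (PrimeSpectrum.comap_injective_of_surjective _ Ideal.Quotient.mk_surjective)
  let P := PrimeSpectrum.comap (Ideal.Quotient.mk I) s.head
  have hP : ∀ i, P ≤ PrimeSpectrum.comap (Ideal.Quotient.mk I) (s i) :=
    fun i => hmono (LTSeries.head_le s i)
  refine ⟨P.asIdeal, P.isPrime, ?_, ?_, ?_⟩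
  · intro a ha
    change Ideal.Quotient.mk I a ∈ s.head.asIdeal
    rw [Ideal.Quotient.eq_zero_iff_mem.2 ha]
    exact zero_mem _
  · have h1 : P.asIdeal ≤ (m.map (Ideal.Quotient.mk I)).comap (Ideal.Quotient.mk I) := by
      have := hmono (LTSeries.head_le_last s)
      rw [hs] at this
      exact this
    rwa [Ideal.comap_map_of_surjective _ Ideal.Quotient.mk_surjective,
      ← RingHom.ker_eq_comap_bot, Ideal.mk_ker, sup_eq_left.2 hI] at h1
  · rw [ringKrullDim_quotient]
    let s' : LTSeries (PrimeSpectrum.zeroLocus (P.asIdeal : Set R)) :=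
      { length := s.length
        toFun := fun i => ⟨PrimeSpectrum.comap (Ideal.Quotient.mk I) (s i), hP i⟩
        step := fun i => hsm (s.step i) }
    have := Order.LTSeries.length_le_krullDim s'
    rw [← hsd]
    exact this

lemma exists_isPrime_of_eval_eq_zero {k : ℕ} (f : Fin k → MvPolynomial (Fin n) ℂ)
    {z : Fin n → ℂ} (hz : ∀ i, eval z (f i) = 0) :
    ∃ P : Ideal (MvPolynomial (Fin n) ℂ), P.IsPrime ∧ (∀ i, f i ∈ P) ∧
      (∀ p ∈ P, eval z p = 0) ∧
      (n : WithBot ℕ∞) ≤ ringKrullDim (MvPolynomial (Fin n) ℂ ⧸ P) + k := by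
  have : (RingHom.ker (eval z)).IsPrime := RingHom.ker_isPrime _
  have hfz : Set.range f ⊆ RingHom.ker (eval z) := by
    rintro _ ⟨i, rfl⟩
    exact hz i
  obtain ⟨P, hP, hIP, hPz, hdim⟩ := exists_isPrime_height_le
    (I := Ideal.span (Set.range f)) (m := RingHom.ker (eval z)) (Ideal.span_le.2 hfz)
  refine ⟨P, hP, fun i => hIP (Ideal.subset_span ⟨i, rfl⟩), fun p hp => hPz hp, ?_⟩
  have hk : (Set.range f).encard ≤ k := by
    rw [← Set.image_univ]
    refine (Set.encard_image_le _ _).trans ?_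
    simp
  have h1 := (natCast_le_height_ker_eval z).trans
    ((Ideal.height_le_height_add_encard_of_subset _ hfz).trans (add_le_add_right hk _))
  have h2 : (n : WithBot ℕ∞) ≤ (((RingHom.ker (eval z)).map
      (Ideal.Quotient.mk (Ideal.span (Set.range f)))).height : WithBot ℕ∞) + k := by
    exact_mod_cast h1
  exact h2.trans (by gcongr)

end Dimension

section Baire
open Filter Topology
variable {n : ℕ}

/-- An irreducible affine variety is not covered by countably many proper closed subsets. -/
lemma exists_mem_subset_of_countable_cover {P : Ideal (MvPolynomial (Fin n) ℂ)} [hP : P.IsPrime]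
    {T : Set (Set (Fin n → ℂ))} (hT : T.Countable)
    (h : ∀ x, (∀ p ∈ P, eval x p = 0) → ∃ S ∈ T, x ∈ S) :
    ∃ S ∈ T, vanishingIdeal ℂ n S ≤ P := by
  by_contra! H
  choose! g hg hgP using fun S hS => SetLike.not_le_iff_exists.1 (H S hS)
  let V := zeroSet ℂ n (P : Set (MvPolynomial (Fin n) ℂ))
  have hV : IsClosed V := isClosed_zeroSet _
  have : CompleteSpace V := hV.completeSpace_coe
  have hd : Dense (⋂ S ∈ T, {x : V | eval (x : Fin n → ℂ) (g S) ≠ 0}) := by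
    refine dense_biInter_of_isOpen (fun S hS => ?_) hT fun S hS => ?_
    · exact isOpen_ne_fun ((MvPolynomial.continuous_eval _).comp continuous_subtype_val)
        continuous_const
    · intro x
      rw [closure_subtype]
      refine closure_mono ?_ (mem_closure_zeroSet_eval_ne_zero x.2 (hgP S hS))
      exact fun x' hx' => ⟨⟨x', hx'.1⟩, hx'.2, rfl⟩
  obtain ⟨z, hz⟩ := exists_eval_eq_zero_of_ne_top hP.ne_top
  obtain ⟨x, hxT⟩ := hd.nonempty (h := ⟨⟨z, hz⟩⟩)
  obtain ⟨S, hS, hxS⟩ := h x x.2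
  exact Set.mem_iInter₂.1 hxT S hS (hg S hS x hxS)

end Baire

/-- **Theorem 3.7.** Let `G` be a complex reductive group, `V = ℂⁿ` a stable `G`-module and
`Y ⊆ V` a `G`-stable algebraic subset such that (1) `Y_apr` is Zariski dense in `Y` and
(2) `π(Y) ⊆ V//G` is the zero set of invariants `f_1, …, f_k` and every stratum of `V` which
intersects `Y` and is not almost principal has codimension at least `k + 1` in `V`.  Then
`Y` is `G`-saturated. -/
theorem saturated_of_apr_dense_and_strata_codim
    (n : ℕ) (G : Set (Matrix (Fin n) (Fin n) ℂ)) (hG : IsReductiveGroup ℂ n G)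
    (hstab : IsStableModule ℂ n G)
    (Y : Set (Fin n → ℂ)) (hYalg : IsAlgebraicSet ℂ n Y) (hYstab : Stabilizes ℂ n G Y)
    (hdense : ZDenseIn ℂ n (Y ∩ aprPoints ℂ n G) Y)
    (k : ℕ) (f : Fin k → MvPolynomial (Fin n) ℂ) (hf : ∀ i, Invariant ℂ n G (f i))
    (hzero : saturation ℂ n G Y = {v | ∀ i, eval v (f i) = 0})
    (hcodim : ∀ v : Fin n → ℂ, HasClosedOrbit ℂ n G v → ¬ IsAlmostPrincipalPt ℂ n G v →
      ((stratumOf ℂ n G v) ∩ Y).Nonempty →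
      adim ℂ n (stratumOf ℂ n G v) + ((k + 1 : ℕ) : WithBot ℕ∞) ≤ (n : WithBot ℕ∞)) :
    IsSaturated ℂ n G Y := by
  refine Set.Subset.antisymm (fun y hy => ⟨y, hy, fun _ _ => rfl⟩) fun z hz => ?_
  by_contra hzY
  obtain ⟨P, hP, hfP, hPz, hdim⟩ := exists_isPrime_of_eval_eq_zero (n := n) f (z := z) (by
    rw [hzero] at hz
    exact hz)
  obtain ⟨T, hT, hTw⟩ := exists_countable_conjIsotropy hG
  let T' := {t ∈ T | ∃ w, HasClosedOrbit ℂ n G w ∧ ¬ IsAlmostPrincipalPt ℂ n G w ∧ w ∈ Y ∧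
    ConjIsotropy ℂ n G t w}
  have hcover : ∀ u, (∀ p ∈ P, eval u p = 0) →
      ∃ S ∈ insert Y (stratumOf ℂ n G '' T'), u ∈ S := by
    intro u hu
    by_cases huY : u ∈ Y
    · exact ⟨Y, Set.mem_insert _ _, huY⟩
    obtain ⟨w, hwu, hw⟩ := exists_hasClosedOrbit hG.1 hG.2.1 u
    obtain ⟨y, hy, huy⟩ : u ∈ saturation ℂ n G Y := by
      rw [hzero]
      exact fun i => hu _ (hfP i)
    have hwY : w ∈ Y := zclosure_subset hYalg (orbit_subset hYstab hy)
      (mem_zclosure_orbit_of_eval_eq hG hw fun p hp =>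
        (hp.eval_eq_of_mem_zclosure hwu).trans (huy p hp))
    have hwA : ¬ IsAlmostPrincipalPt ℂ n G w := fun hA => huY (by
      have h1 := hA.mem_orbit_of_mem_closure hG (zclosure_orbit_subset_closure hG.2.1 hwu)
      refine orbit_subset hYstab hwY ?_
      rw [orbit_eq_of_mem hG.1 h1]
      exact mem_orbit_self hG.1 u)
    obtain ⟨t, ht, htw⟩ := hTw w hw
    exact ⟨_, Set.mem_insert_of_mem _ ⟨t, ⟨ht, w, hw, hwA, hwY, htw⟩, rfl⟩, w, hw, hwu, htw⟩
  obtain ⟨S, hS, hSP⟩ := exists_mem_subset_of_countable_cover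
    (((hT.mono (Set.sep_subset _ _)).image _).insert Y) hcover
  rcases hS with rfl | ⟨t, ⟨-, w, hw, hwA, hwY, htw⟩, rfl⟩
  · exact hzY (zclosure_subset hYalg subset_rfl fun p hp => hPz p (hSP hp))
  have hst : stratumOf ℂ n G t = stratumOf ℂ n G w := by
    ext u
    exact ⟨fun ⟨x, h1, h2, h3⟩ => ⟨x, h1, h2, (htw.symm hG.1).trans hG.1 h3⟩,
      fun ⟨x, h1, h2, h3⟩ => ⟨x, h1, h2, htw.trans hG.1 h3⟩⟩
  rw [hst] at hSP
  have hle : ringKrullDim (MvPolynomial (Fin n) ℂ ⧸ P) ≤ adim ℂ n (stratumOf ℂ n G w) :=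
    ringKrullDim_le_of_surjective (Ideal.Quotient.factor hSP) (Ideal.Quotient.factor_surjective hSP)
  have h1 := hcodim w hw hwA ⟨w, ⟨w, hw, subset_zclosure _ (mem_orbit_self hG.1 w),
    (htw.symm hG.1).trans hG.1 htw⟩, hwY⟩
  have h2 : (n : WithBot ℕ∞) ≤ adim ℂ n (stratumOf ℂ n G w) + k :=
    hdim.trans (add_le_add_left hle _)
  revert h1 h2
  generalize adim ℂ n (stratumOf ℂ n G w) = d
  intro h1 h2
  induction d with
  | bot => simp at h2
  | coe d =>
    have h1' : d + ((k + 1 : ℕ) : ℕ∞) ≤ n := by exact_mod_cast h1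
    have h2' : (n : ℕ∞) ≤ d + k := by exact_mod_cast h2
    have h3 := h1'.trans h2'
    induction d with
    | top => simp at h1'
    | coe d =>
      have h4 : d + (k + 1) ≤ d + k := by exact_mod_cast h3
      omega

end ZPaper
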